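/- arXiv:math/9910054 — 3 statements merged into one kernel-verified Lean document; each statement's English description precedes it below -/
import Mathlib

section
/- For every c ∈ ℂ, the fiber {(x,y) ∈ ℂ × ℂ : f(x,y) = c} of the Briançon polynomial is nonempty and connected. -/
/-- The Briançon polynomial. -/
noncomputable def briancon (x y : ℂ) : ℂ :=
  x ^ 2 * (1 + x * y) ^ 4 + 3 * x * (1 + x * y) ^ 3 + (3 - (8 / 3) * x) * (1 + x * y) ^ 2
    - 4 * (1 + x * y) + y

open Polynomial in
/-- A complex polynomial all of whose root multiplicities are even is a square. -/
lemma exists_sq_of_even (p : ℂ[X]) (h : ∀ a, Even (p.rootMultiplicity a)) :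
    ∃ r : ℂ[X], p = r ^ 2 := by
  obtain ⟨l, hl⟩ := IsAlgClosed.exists_pow_nat_eq p.leadingCoeff (n := 2) (by norm_num)
  refine ⟨C l * ∏ a ∈ p.roots.toFinset, (X - C a) ^ (p.rootMultiplicity a / 2), ?_⟩
  rw [mul_pow, ← C_pow, hl, ← Finset.prod_pow]
  conv_lhs => rw [(IsAlgClosed.splits p).eq_prod_roots, prod_multiset_root_eq_finset_root]
  congr 1
  refine Finset.prod_congr rfl fun a _ => ?_
  rw [← pow_mul, Nat.div_mul_cancel (h a).two_dvd]

/-- The quadratic `q`. -/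
noncomputable def qq (u : ℂ) : ℂ := 8 / 3 * u ^ 2 + 4 * u + 1

/-- The discriminant. -/
noncomputable def dd (c u : ℂ) : ℂ := qq u ^ 2 + 4 * c * u * (u + 1) ^ 3

open Polynomial in
/-- The discriminant as a polynomial. -/
noncomputable def ddPoly (c : ℂ) : ℂ[X] :=
  (C (8 / 3) * X ^ 2 + C 4 * X + C 1) ^ 2 + C (4 * c) * X * (X + C 1) ^ 3

open Polynomial in
lemma eval_ddPoly (c u : ℂ) : (ddPoly c).eval u = dd c u := by
  simp [ddPoly, dd, qq]

lemma ddPoly_ne_zero (c : ℂ) : ddPoly c ≠ 0 := by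
  intro h
  have := eval_ddPoly c 0
  rw [h] at this
  norm_num [dd, qq] at this

open Polynomial in
lemma ddPoly_not_sq (c : ℂ) (hc : c ≠ 0) (r : ℂ[X]) : ddPoly c ≠ r ^ 2 := by
  intro h
  have hd : (ddPoly c).natDegree ≤ 4 := by
    unfold ddPoly
    compute_degree
  have hr : r.natDegree < 3 := by
    rw [h, natDegree_pow] at hd
    omega
  have he : ∀ u, (r.coeff 0 + r.coeff 1 * u + r.coeff 2 * u ^ 2) ^ 2 = dd c u := by
    intro u
    rw [← eval_ddPoly, h, eval_pow, eval_eq_sum_range' hr]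
    simp [Finset.sum_range_succ]
  generalize r.coeff 0 = a at he
  generalize r.coeff 1 = b at he
  generalize r.coeff 2 = d at he
  have h0 := he 0
  have h1 := he 1
  have h2 := he (-1)
  have h3 := he 2
  have h4 := he (-2)
  simp only [dd, qq] at h0 h1 h2 h3 h4
  have e0 : a ^ 2 = 1 := by linear_combination h0
  have e4 : d ^ 2 = 64 / 9 + 4 * c := by
    linear_combination (h3 + h4 - 4 * h1 - 4 * h2 + 6 * h0) / 24
  have e2 : b ^ 2 + 2 * a * d = 16 + 16 / 3 + 12 * c := by
    linear_combination (h1 + h2) / 2 - e0 - e4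
  have e3 : 2 * b * d = 64 / 3 + 12 * c := by
    linear_combination (h3 - h4 - 2 * h1 + 2 * h2) / 12
  have e1 : 2 * a * b = 8 + 4 * c := by
    linear_combination (h1 - h2) / 2 - e3
  have key : ∀ b d : ℂ, d ^ 2 = 64 / 9 + 4 * c → b ^ 2 + 2 * d = 16 + 16 / 3 + 12 * c →
      2 * b * d = 64 / 3 + 12 * c → 2 * b = 8 + 4 * c → False := by
    intro b d e4 e2 e3 e1
    have hb : b = 4 + 2 * c := by linear_combination e1 / 2
    subst hb
    have hd : d = 8 / 3 - 2 * c - 2 * c ^ 2 := by linear_combination e2 / 2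
    subst hd
    have f1 : 8 * c ^ 2 + 24 * c + 52 / 3 = 0 := by
      apply mul_left_cancel₀ hc
      linear_combination -e3
    have f2 : 4 * c * (1 + c) ^ 2 - 32 / 3 * (1 + c) - 4 = 0 := by
      apply mul_left_cancel₀ hc
      linear_combination e4
    have f3 : c = - 9 / 5 := by
      linear_combination (-3 / 10) * (f2 - (c / 2 - 1 / 2) * f1)
    rw [f3] at f1
    norm_num at f1
  rcases mul_self_eq_one_iff.mp ((sq a).symm.trans e0) with rfl | rfl
  · exact key b d e4 (by linear_combination e2) e3 (by linear_combination e1)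
  · exact key (-b) (-d) (by linear_combination e4) (by linear_combination e2)
      (by linear_combination e3) (by linear_combination e1)

/-- The discriminant has a root of odd multiplicity. -/
lemma exists_odd_root (c : ℂ) (hc : c ≠ 0) : ∃ (u₀ : ℂ) (m : ℕ) (g : ℂ → ℂ), Odd m ∧
    AnalyticAt ℂ g u₀ ∧ g u₀ ≠ 0 ∧ ∀ u, dd c u = (u - u₀) ^ m * g u := by
  by_contra hcon
  have : ∀ a, Even ((ddPoly c).rootMultiplicity a) := by
    intro a
    by_contra hodd
    obtain ⟨g, hg, hg'⟩ :=
      Polynomial.exists_eq_pow_rootMultiplicity_mul_and_not_dvd (ddPoly c) (ddPoly_ne_zero c) a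
    refine hcon ⟨a, _, fun u => g.eval u, Nat.not_even_iff_odd.mp hodd, ?_, ?_, ?_⟩
    · exact (Polynomial.differentiable g).analyticAt a
    · intro h0
      exact hg' (Polynomial.dvd_iff_isRoot.mpr h0)
    · intro u
      rw [← eval_ddPoly]
      conv_lhs => rw [hg]
      simp
  obtain ⟨r, hr⟩ := exists_sq_of_even _ this
  exact ddPoly_not_sq c hc r hr

lemma finite_dd (c : ℂ) : {u | dd c u = 0}.Finite := by
  refine ((ddPoly c).roots.toFinset.finite_toSet).subset ?_
  intro u hu
  simpa [ddPoly_ne_zero, eval_ddPoly] using hu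

lemma differentiable_dd (c : ℂ) : Differentiable ℂ (dd c) := by
  unfold dd qq; fun_prop

/-- A function with square the discriminant cannot be analytic at an odd root. -/
lemma no_analytic_sqrt {c u₀ : ℂ} {m : ℕ} {g r : ℂ → ℂ} (hm : Odd m) (hg : AnalyticAt ℂ g u₀)
    (hg0 : g u₀ ≠ 0) (hD : ∀ u, dd c u = (u - u₀) ^ m * g u) (hr : AnalyticAt ℂ r u₀)
    (hr2 : ∀ u, r u ^ 2 = dd c u) : False := by
  have h1 : analyticOrderAt (r ^ 2) u₀ = m := by
    rw [(hr.pow 2).analyticOrderAt_eq_natCast]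
    exact ⟨g, hg, hg0, Filter.Eventually.of_forall fun u => by simp [hr2, hD]⟩
  rw [analyticOrderAt_pow hr] at h1
  rcases h : analyticOrderAt r u₀ with _ | n
  · rw [h] at h1
    revert h1
    change (2 • (⊤ : ℕ∞)) = m → False
    simp
  · rw [h] at h1
    have : 2 * n = m := by
      have h2 : ((2 * n : ℕ) : ℕ∞) = (m : ℕ∞) := by
        rw [← h1]; simp; rfl
      exact_mod_cast h2
    rw [← this] at hm
    exact absurd hm (by simp)

/-- A square-root function of the discriminant is continuous at its zeros. -/
lemma continuousAt_sqrt_zero {c u₁ : ℂ} {r : ℂ → ℂ} (hr2 : ∀ u, r u ^ 2 = dd c u)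
    (h0 : dd c u₁ = 0) : ContinuousAt r u₁ := by
  have hr0 : r u₁ = 0 := by
    have := hr2 u₁
    rw [h0] at this
    exact pow_eq_zero_iff (two_ne_zero) |>.mp this
  have hn : ∀ u, ‖r u‖ = Real.sqrt ‖dd c u‖ := by
    intro u
    rw [← hr2, norm_pow, Real.sqrt_sq (norm_nonneg _)]
  rw [ContinuousAt, hr0, tendsto_zero_iff_norm_tendsto_zero]
  simp only [hn]
  have : Continuous fun u => Real.sqrt ‖dd c u‖ :=
    ((differentiable_dd c).continuous.norm).sqrt
  have h := this.tendsto u₁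
  simpa [h0] using h

/-- The principal square root of the discriminant. -/
noncomputable def sr (c u : ℂ) : ℂ := (dd c u) ^ ((2 : ℂ)⁻¹)

lemma sr_sq (c u : ℂ) : sr c u ^ 2 = dd c u := by
  have := Complex.cpow_nat_inv_pow (dd c u) (n := 2) (by norm_num)
  simpa [sr] using this

/-- Holomorphic local branches of the square root of the discriminant. -/
lemma exists_branch {c u₁ R : ℂ} (hR : R ^ 2 = dd c u₁) (h : dd c u₁ ≠ 0) :
    ∃ ρ : ℂ → ℂ, DifferentiableAt ℂ ρ u₁ ∧ ρ u₁ = R ∧ ∀ u, ρ u ^ 2 = dd c u := by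
  refine ⟨fun u => R * (dd c u / dd c u₁) ^ ((2 : ℂ)⁻¹), ?_, ?_, ?_⟩
  · refine DifferentiableAt.const_mul ?_ _
    refine DifferentiableAt.cpow ((differentiable_dd c u₁).div_const _) (by fun_prop) ?_
    simp [h]
  · simp [h]
  · intro u
    have := Complex.cpow_nat_inv_pow (dd c u / dd c u₁) (n := 2) (by norm_num)
    simp only [Nat.cast_ofNat] at this
    rw [mul_pow, this, hR]
    field_simp

lemma exists_cont_branch {c u₁ R : ℂ} (hR : R ^ 2 = dd c u₁) :
    ∃ ρ : ℂ → ℂ, ContinuousAt ρ u₁ ∧ ρ u₁ = R ∧ ∀ u, ρ u ^ 2 = dd c u := by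
  by_cases h : dd c u₁ = 0
  · refine ⟨sr c, continuousAt_sqrt_zero (sr_sq c) h, ?_, sr_sq c⟩
    have h1 := sr_sq c u₁
    rw [h] at h1 hR
    rw [pow_eq_zero_iff two_ne_zero] at h1 hR
    rw [h1, hR]
  · obtain ⟨ρ, h1, h2, h3⟩ := exists_branch hR h
    exact ⟨ρ, h1.continuousAt, h2, h3⟩

/-- The plane curve isomorphic to the fibre when `c ≠ 0`. -/
def GG (c : ℂ) : Set (ℂ × ℂ) :=
  {p | p.2 ^ 2 * (p.1 + 1) ^ 3 - qq p.1 * p.2 - c * p.1 = 0}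

/-- Solution of the quadratic equation. -/
noncomputable def sg (u ρ : ℂ) : ℂ := (qq u + ρ) / (2 * (u + 1) ^ 3)

lemma sg_mem {c u ρ : ℂ} (hu : u ≠ -1) (hρ : ρ ^ 2 = dd c u) : (u, sg u ρ) ∈ GG c := by
  have h1 : u + 1 ≠ 0 := fun h => hu (eq_neg_of_add_eq_zero_left h)
  simp only [GG, Set.mem_ofPred_eq, sg]
  field_simp
  simp only [dd] at hρ
  linear_combination hρ

lemma eq_sg {c u s : ℂ} (hu : u ≠ -1) (h : (u, s) ∈ GG c) :
    (2 * (u + 1) ^ 3 * s - qq u) ^ 2 = dd c u ∧ s = sg u (2 * (u + 1) ^ 3 * s - qq u) := by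
  have h1 : u + 1 ≠ 0 := fun h => hu (eq_neg_of_add_eq_zero_left h)
  simp only [GG, Set.mem_ofPred_eq] at h
  constructor
  · simp only [dd]
    linear_combination 4 * (u + 1) ^ 3 * h
  · simp only [sg]
    field_simp
    ring

lemma continuousAt_sg {u₁ : ℂ} {ρ : ℂ → ℂ} (hu : u₁ ≠ -1) (hρ : ContinuousAt ρ u₁) :
    ContinuousAt (fun u => sg u (ρ u)) u₁ := by
  have h1 : u₁ + 1 ≠ 0 := fun h => hu (eq_neg_of_add_eq_zero_left h)
  unfold sg qq
  refine ContinuousAt.div (by fun_prop) (by fun_prop) ?_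
  simp [h1]

open Filter Topology

/-- A locally constant function on the curve is locally constant along continuous sections. -/
lemma section_const {c u₁ : ℂ} {χ : ℂ × ℂ → Bool} (hχ : ContinuousOn χ (GG c)) {t : ℂ → ℂ}
    (ht : ContinuousAt t u₁) (hm : ∀ᶠ u in 𝓝 u₁, (u, t u) ∈ GG c) :
    ∀ᶠ u in 𝓝 u₁, χ (u, t u) = χ (u₁, t u₁) := by
  have h1 : Tendsto (fun u => (u, t u)) (𝓝 u₁) (𝓝[GG c] (u₁, t u₁)) :=
    tendsto_nhdsWithin_iff.mpr ⟨(continuousAt_id.prodMk ht), hm⟩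
  have h2 := (hχ _ hm.self_of_nhds).tendsto.comp h1
  rw [nhds_discrete Bool, tendsto_pure] at h2
  exact h2

lemma branch_const {c u₁ : ℂ} {χ : ℂ × ℂ → Bool} (hχ : ContinuousOn χ (GG c)) {ρ : ℂ → ℂ}
    (hu : u₁ ≠ -1) (hρ : ContinuousAt ρ u₁) (h2 : ∀ u, ρ u ^ 2 = dd c u) :
    ∀ᶠ u in 𝓝 u₁, χ (u, sg u (ρ u)) = χ (u₁, sg u₁ (ρ u₁)) := by
  refine section_const hχ (continuousAt_sg hu hρ) ?_
  filter_upwards [isOpen_ne.mem_nhds hu] with u hu'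
  exact sg_mem hu' (h2 u)

/-- Through every point of the curve passes a continuous section. -/
lemma exists_section {c u₁ s : ℂ} (h : (u₁, s) ∈ GG c) : ∃ t : ℂ → ℂ, ContinuousAt t u₁ ∧
    t u₁ = s ∧ ∀ᶠ u in 𝓝 u₁, (u, t u) ∈ GG c := by
  by_cases hu : u₁ = -1
  · subst hu
    have hR : (1 / 3 : ℂ) ^ 2 = dd c (-1) := by
      norm_num [dd, qq]
    obtain ⟨ρ, h1, h2, h3⟩ := exists_cont_branch hR
    have hc1 : ContinuousAt (fun u => qq u - ρ u) (-1) := by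
      unfold qq; fun_prop
    have hne : qq (-1) - ρ (-1) ≠ 0 := by
      rw [h2]; norm_num [qq]
    refine ⟨fun u => -2 * c * u / (qq u - ρ u), ContinuousAt.div (by fun_prop) hc1 hne, ?_, ?_⟩
    · simp only [GG, Set.mem_ofPred_eq] at h
      simp only [qq] at h ⊢
      rw [h2]
      norm_num at h ⊢
      linear_combination (-3) * h
    · filter_upwards [hc1.eventually_ne hne] with u hu
      simp only [GG, Set.mem_ofPred_eq]
      have := h3 u
      simp only [dd] at this
      field_simp
      linear_combination (-c * u) * this
  · obtain ⟨h1, h2⟩ := eq_sg hu h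
    obtain ⟨ρ, k1, k2, k3⟩ := exists_cont_branch h1
    refine ⟨fun u => sg u (ρ u), continuousAt_sg hu k1, ?_, ?_⟩
    · simp only [k2]; exact h2.symm
    · filter_upwards [isOpen_ne.mem_nhds hu] with u hu'
      exact sg_mem hu' (k3 u)

lemma isPreconnected_GG {c : ℂ} (hc : c ≠ 0) : IsPreconnected (GG c) := by
  refine isPreconnected_of_forall_constant fun χ hχ => ?_
  let Z : Set ℂ := {-1} ∪ {u | dd c u = 0}
  have hZ : Z.Finite := (Set.finite_singleton _).union (finite_dd c)
  have hU : IsPreconnected Zᶜ :=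
    (hZ.countable.isConnected_compl_of_one_lt_rank (by simp)).isPreconnected
  have hUmem : ∀ u, u ∈ Zᶜ ↔ u ≠ -1 ∧ dd c u ≠ 0 := by
    intro u; simp [Z]
  -- punctured neighbourhoods lie in the good set
  have hpunct : ∀ u₁ : ℂ, ∀ᶠ u in 𝓝[≠] u₁, u ∈ Zᶜ := by
    intro u₁
    have h1 : (Z \ {u₁})ᶜ ∈ 𝓝 u₁ :=
      (hZ.subset Set.sdiff_subset).isClosed.isOpen_compl.mem_nhds (by simp)
    filter_upwards [nhdsWithin_le_nhds h1, self_mem_nhdsWithin] with u hu hu' hz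
    exact hu ⟨hz, hu'⟩
  have hpm : ∀ (u a b : ℂ), a ^ 2 = dd c u → b ^ 2 = dd c u → a = b ∨ a = -b := by
    intro u a b ha hb
    exact sq_eq_sq_iff_eq_or_eq_neg.mp (ha.trans hb.symm)
  -- local constancy of the values on both sheets
  have hloc : ∀ u₁ ∈ Zᶜ, ∀ R, R ^ 2 = dd c u₁ → ∃ ρ : ℂ → ℂ, DifferentiableAt ℂ ρ u₁ ∧
      (∀ u, ρ u ^ 2 = dd c u) ∧ ∀ᶠ u in 𝓝 u₁, χ (u, sg u (ρ u)) = χ (u₁, sg u₁ R) ∧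
        χ (u, sg u (-ρ u)) = χ (u₁, sg u₁ (-R)) := by
    intro u₁ hu₁ R hR
    obtain ⟨hu, hd⟩ := (hUmem u₁).mp hu₁
    obtain ⟨ρ, h1, h2, h3⟩ := exists_branch hR hd
    refine ⟨ρ, h1, h3, ?_⟩
    have e1 := branch_const hχ hu h1.continuousAt h3
    have e2 := branch_const hχ hu h1.continuousAt.neg (fun u => by simp [h3])
    simp only [Pi.neg_apply, h2] at e1 e2
    exact e1.and e2
  have hcont : ∀ f : ℂ → Bool, (∀ u₁ ∈ Zᶜ, ∀ᶠ u in 𝓝 u₁, f u = f u₁) →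
      ∀ u ∈ Zᶜ, ∀ v ∈ Zᶜ, f u = f v := by
    intro f hf u hu v hv
    refine hU.constant (f := f) ?_ hu hv
    intro w hw
    refine ContinuousAt.continuousWithinAt ?_
    rw [ContinuousAt, nhds_discrete Bool, tendsto_pure]
    exact hf w hw
  have hE := hcont (fun u => xor (χ (u, sg u (sr c u))) (χ (u, sg u (-sr c u)))) (by
    intro u₁ hu₁
    obtain ⟨ρ, _, h2, h3⟩ := hloc u₁ hu₁ _ (sr_sq c u₁)
    filter_upwards [h3] with u hu
    rcases hpm u _ _ (sr_sq c u) (h2 u) with h | h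
    · rw [h, hu.1, hu.2]
    · rw [h, neg_neg, hu.1, hu.2, Bool.xor_comm])
  obtain ⟨u₀, m, g, hm, hg, hg0, hD⟩ := exists_odd_root c hc
  obtain ⟨v, hv⟩ := (hpunct u₀).exists
  -- the two sheets carry the same value
  have hsame : ∀ u ∈ Zᶜ, χ (u, sg u (sr c u)) = χ (u, sg u (-sr c u)) := by
    by_contra hcon
    push Not at hcon
    obtain ⟨w, hw, hne⟩ := hcon
    have hdiff : ∀ u ∈ Zᶜ, χ (u, sg u (sr c u)) ≠ χ (u, sg u (-sr c u)) := by
      intro u hu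
      have := hE u hu w hw
      revert this hne
      cases χ (u, sg u (sr c u)) <;> cases χ (u, sg u (-sr c u)) <;>
        cases χ (w, sg w (sr c w)) <;> cases χ (w, sg w (-sr c w)) <;> simp
    let r : ℂ → ℂ := fun u => if χ (u, sg u (sr c u)) = true then sr c u else -sr c u
    have hr2 : ∀ u, r u ^ 2 = dd c u := by
      intro u
      simp only [r]
      split_ifs <;> simp [sr_sq]
    have hrt : ∀ u ∈ Zᶜ, χ (u, sg u (r u)) = true ∧ χ (u, sg u (-r u)) = false := by
      intro u hu
      have := hdiff u hu
      simp only [r]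
      split_ifs with h
      · refine ⟨h, ?_⟩
        rw [h] at this
        simpa using this.symm
      · rw [neg_neg]
        rw [Bool.not_eq_true] at h
        refine ⟨?_, h⟩
        rw [h] at this
        simpa using this.symm
    have hrd : ∀ u₁ ∈ Zᶜ, DifferentiableAt ℂ r u₁ := by
      intro u₁ hu₁
      obtain ⟨ρ, h1, h2, h3⟩ := hloc u₁ hu₁ _ (hr2 u₁)
      refine h1.congr_of_eventuallyEq ?_
      filter_upwards [h3, hZ.isClosed.isOpen_compl.mem_nhds hu₁] with u hu huZ
      rw [(hrt u₁ hu₁).1, (hrt u₁ hu₁).2] at hu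
      rcases hpm u _ _ (hr2 u) (h2 u) with h | h
      · exact h
      · exfalso
        have h4 := (hrt u huZ).1
        rw [h, hu.2] at h4
        simp at h4
    have hd0 : dd c u₀ = 0 := by
      rw [hD]; simp [hm.pos.ne']
    have hra : AnalyticAt ℂ r u₀ :=
      Complex.analyticAt_of_differentiable_on_punctured_nhds_of_continuousAt
        ((hpunct u₀).mono fun u hu => hrd u hu) (continuousAt_sqrt_zero hr2 hd0)
    exact no_analytic_sqrt hm hg hg0 hD hra hr2
  have hη := hcont (fun u => χ (u, sg u (sr c u))) (by
    intro u₁ hu₁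
    obtain ⟨ρ, _, h2, h3⟩ := hloc u₁ hu₁ _ (sr_sq c u₁)
    filter_upwards [h3] with u hu
    rcases hpm u _ _ (sr_sq c u) (h2 u) with h | h
    · rw [h, hu.1]
    · rw [h, hu.2, ← hsame u₁ hu₁])
  have hgood : ∀ u s, u ∈ Zᶜ → (u, s) ∈ GG c → χ (u, s) = χ (v, sg v (sr c v)) := by
    intro u s hu hs
    obtain ⟨h1, h2⟩ := eq_sg ((hUmem u).mp hu).1 hs
    rw [← hη u hu v hv, h2]
    rcases hpm u _ _ h1 (sr_sq c u) with h | h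
    · rw [h]
    · rw [h, ← hsame u hu]
  have hall : ∀ p ∈ GG c, χ p = χ (v, sg v (sr c v)) := by
    rintro ⟨u₁, s⟩ hp
    obtain ⟨t, h1, h2, h3⟩ := exists_section hp
    have h4 := section_const hχ h1 h3
    obtain ⟨u, hu, hu', hu''⟩ :=
      (((h4.filter_mono nhdsWithin_le_nhds :
        ∀ᶠ u in 𝓝[≠] u₁, χ (u, t u) = χ (u₁, t u₁))).and
        ((h3.filter_mono nhdsWithin_le_nhds).and (hpunct u₁))).exists
    rw [← hgood u _ hu'' hu', hu, h2]
  intro p hp p' hp'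
  rw [hall p hp, hall p' hp']

lemma briancon_of_GG {c u s : ℂ} (hc : c ≠ 0) (h : (u, s) ∈ GG c) :
    briancon ((s * (u + 1) ^ 3 - qq u) / c)
      (c + 4 * s + 8 / 3 * u * s - 3 * s ^ 2 - 3 * u * s ^ 2 - u ^ 2 * s ^ 2) = c := by
  simp only [GG, Set.mem_ofPred_eq] at h
  set x := (s * (u + 1) ^ 3 - qq u) / c with hx
  set y := c + 4 * s + 8 / 3 * u * s - 3 * s ^ 2 - 3 * u * s ^ 2 - u ^ 2 * s ^ 2 with hy
  have hcx : c * x = s * (u + 1) ^ 3 - qq u := by rw [hx]; field_simp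
  have hxs : x * s = u := by
    apply mul_left_cancel₀ hc
    linear_combination s * hcx + h
  have hxy : 1 + x * y = s := by
    simp only [qq] at hcx
    rw [hy]
    linear_combination hcx + (4 + 8 / 3 * u - 3 * s - 3 * u * s - u ^ 2 * s) * hxs
  simp only [briancon, hxy]
  rw [hy]
  linear_combination (x * s ^ 3 + u * s ^ 2 + 3 * s ^ 2 - 8 / 3 * s) * hxs

lemma GG_of_briancon {c x y : ℂ} (h : briancon x y = c) :
    (x * (1 + x * y), 1 + x * y) ∈ GG c := by
  simp only [GG, Set.mem_ofPred_eq, qq]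
  simp only [briancon] at h
  linear_combination (x * (1 + x * y)) * h

lemma briancon_x {c x y : ℂ} (h : briancon x y = c) :
    (1 + x * y) * (x * (1 + x * y) + 1) ^ 3 - qq (x * (1 + x * y)) = c * x := by
  simp only [qq]
  simp only [briancon] at h
  linear_combination x * h

lemma briancon_y {c x y u s : ℂ} (h : briancon x y = c) (hs : s = 1 + x * y) (hu : u = x * s) :
    c + 4 * s + 8 / 3 * u * s - 3 * s ^ 2 - 3 * u * s ^ 2 - u ^ 2 * s ^ 2 = y := by
  subst hu
  subst hs
  simp only [briancon] at h
  linear_combination -h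

lemma preconnected_ne_zero {c : ℂ} (hc : c ≠ 0) :
    IsPreconnected {p : ℂ × ℂ | briancon p.1 p.2 = c} := by
  have h := (isPreconnected_GG hc).image (fun p : ℂ × ℂ =>
    ((p.2 * (p.1 + 1) ^ 3 - qq p.1) / c,
      c + 4 * p.2 + 8 / 3 * p.1 * p.2 - 3 * p.2 ^ 2 - 3 * p.1 * p.2 ^ 2 - p.1 ^ 2 * p.2 ^ 2))
    (Continuous.continuousOn (by unfold qq; fun_prop))
  convert h using 1
  ext ⟨x, y⟩
  constructor
  · intro hp
    refine ⟨_, GG_of_briancon hp, Prod.ext ?_ ?_⟩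
    · simp only
      rw [briancon_x hp]
      field_simp
    · exact briancon_y hp rfl rfl
  · rintro ⟨⟨u, s⟩, hm, hp⟩
    rw [← hp]
    exact briancon_of_GG hc hm

lemma preconnected_zero : IsPreconnected {p : ℂ × ℂ | briancon p.1 p.2 = 0} := by
  let Z : Set ℂ := {-1} ∪ {u | qq u = 0}
  have hZ : Z.Finite := by
    refine (Set.finite_singleton _).union ((finite_dd 0).subset ?_)
    intro u hu
    simp only [Set.mem_ofPred_eq] at hu
    simp [dd, hu]
  have hU : IsPreconnected Zᶜ :=
    (hZ.countable.isConnected_compl_of_one_lt_rank (by simp)).isPreconnected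
  let S : ℂ → ℂ := fun u => qq u / (u + 1) ^ 3
  have hn : ∀ u ∈ Zᶜ, u + 1 ≠ 0 ∧ qq u ≠ 0 := by
    intro u hu
    simp only [Z, Set.mem_compl_iff, Set.mem_union, Set.mem_singleton_iff, Set.mem_ofPred_eq,
      not_or] at hu
    exact ⟨fun h => hu.1 (eq_neg_of_add_eq_zero_left h), hu.2⟩
  have hqc : Continuous qq := by unfold qq; fun_prop
  have hS : ContinuousOn S Zᶜ :=
    hqc.continuousOn.div (by fun_prop) fun u hu => pow_ne_zero _ (hn u hu).1
  have h := hU.image (fun u : ℂ => (u * (u + 1) ^ 3 / qq u,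
    0 + 4 * S u + 8 / 3 * u * S u - 3 * S u ^ 2 - 3 * u * S u ^ 2 - u ^ 2 * S u ^ 2)) (by
      refine ContinuousOn.prodMk
        (ContinuousOn.div (by fun_prop) hqc.continuousOn fun u hu => (hn u hu).2) ?_
      fun_prop)
  convert h using 1
  ext ⟨x, y⟩
  constructor
  · intro hp
    have hp' : briancon x y = 0 := hp
    have hx := briancon_x hp'
    have hs : 1 + x * y ≠ 0 := by
      intro hs
      have : y = 0 := by simpa [briancon, hs] using hp'
      simp [this] at hs
    have hu1 : x * (1 + x * y) + 1 ≠ 0 := by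
      intro h1
      have h2 : x * (1 + x * y) = -1 := by linear_combination h1
      rw [h2] at hx
      norm_num [qq] at hx
    have hq : qq (x * (1 + x * y)) = (1 + x * y) * (x * (1 + x * y) + 1) ^ 3 := by
      linear_combination -hx
    have hS1 : S (x * (1 + x * y)) = 1 + x * y := by
      simp only [S]
      rw [hq]
      field_simp
    refine ⟨x * (1 + x * y), ?_, Prod.ext ?_ ?_⟩
    · simp only [Z, Set.mem_compl_iff, Set.mem_union, Set.mem_singleton_iff, Set.mem_ofPred_eq,
        not_or]
      refine ⟨fun h => hu1 (by rw [h]; norm_num), ?_⟩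
      rw [hq]
      exact mul_ne_zero hs (pow_ne_zero _ hu1)
    · simp only
      rw [hq]
      field_simp
    · simp only [hS1]
      exact briancon_y hp' rfl rfl
  · rintro ⟨u, hm, hp⟩
    rw [← hp]
    obtain ⟨h1, h2⟩ := hn u hm
    simp only [Set.mem_ofPred_eq]
    have hSq : S u * (u + 1) ^ 3 = qq u := by simp only [S]; field_simp
    have hS0 : S u ≠ 0 := div_ne_zero h2 (pow_ne_zero _ h1)
    have hxs : u * (u + 1) ^ 3 / qq u * S u = u := by simp only [S]; field_simp
    set x := u * (u + 1) ^ 3 / qq u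
    generalize S u = s at *
    set y := 0 + 4 * s + 8 / 3 * u * s - 3 * s ^ 2 - 3 * u * s ^ 2 - u ^ 2 * s ^ 2 with hy
    have hxy : 1 + x * y = s := by
      simp only [qq] at hSq
      rw [hy]
      linear_combination -hSq + (4 + 8 / 3 * u - 3 * s - 3 * u * s - u ^ 2 * s) * hxs
    simp only [briancon, hxy]
    rw [hy]
    linear_combination (x * s ^ 3 + u * s ^ 2 + 3 * s ^ 2 - 8 / 3 * s) * hxs

/-- Every fiber of the Briançon polynomial is nonempty and connected. -/
theorem briancon_fibers_connected (c : ℂ) :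
    {p : ℂ × ℂ | briancon p.1 p.2 = c}.Nonempty ∧
      IsConnected {p : ℂ × ℂ | briancon p.1 p.2 = c} := by
  have hne : {p : ℂ × ℂ | briancon p.1 p.2 = c}.Nonempty :=
    ⟨(0, c + 1), by simp only [Set.mem_ofPred_eq, briancon]; ring⟩
  refine ⟨hne, hne, ?_⟩
  by_cases hc : c = 0
  · subst hc
    exact preconnected_zero
  · exact preconnected_ne_zero hc
end

section
/- For the Briançon polynomial f, the set of irregular values is exactly {0, −16/9}: a value c ∉ {0, −16/9} is a regular value (there is an open neighborhood U of c and a homeomorphism h : f⁻¹(U) → f⁻¹({c}) × U whose second component is f), while 0 and −16/9 are not regular values. -/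
/-- `c` is a regular (typical) value of `g : ℂ × ℂ → ℂ`: the family of fibers is
topologically trivial over some neighborhood of `c`. -/
def IsRegularValue (g : ℂ × ℂ → ℂ) (c : ℂ) : Prop :=
  ∃ U : Set ℂ, IsOpen U ∧ c ∈ U ∧
    ∃ h : (g ⁻¹' U) ≃ₜ (g ⁻¹' {c}) × U, ∀ z : g ⁻¹' U, ((h z).2 : ℂ) = g z

namespace Bri
open Set Filter Topology

noncomputable def Qp (w : ℂ) : ℂ := 8 / 3 * w ^ 2 + 4 * w + 1

noncomputable def Dp (c w : ℂ) : ℂ := Qp w ^ 2 + 4 * c * (w * (w + 1) ^ 3)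

/-- Total space in coordinates `(c, x, w)`, `w = x (1 + x y)`. -/
def EE : Set (ℂ × ℂ × ℂ) :=
  {q | q.1 * q.2.1 ^ 2 + Qp q.2.2 * q.2.1 = q.2.2 * (q.2.2 + 1) ^ 3 ∧ ¬ (q.2.1 = 0 ∧ q.2.2 = -1)}

open Classical in
noncomputable def YY (q : ℂ × ℂ × ℂ) : ℂ :=
  if q.2.1 = 0 then 1 + q.1 else (q.2.2 - q.2.1) / q.2.1 ^ 2

lemma mem_EE (x y : ℂ) : (briancon x y, x, x * (1 + x * y)) ∈ EE := by
  constructor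
  · simp only [briancon, Qp]; ring
  · rintro ⟨h1, h2⟩
    simp only at h1 h2
    subst h1
    simp at h2

lemma YY_eq (x y : ℂ) : YY (briancon x y, x, x * (1 + x * y)) = y := by
  unfold YY
  split_ifs with h
  · simp only at h
    subst h
    simp [briancon]; ring
  · simp only at h ⊢
    field_simp
    ring

lemma EE_w_zero {c w : ℂ} (h : (c, (0:ℂ), w) ∈ EE) : w = 0 := by
  obtain ⟨h1, h2⟩ := h
  simp only at h1 h2
  have : w * (w + 1) ^ 3 = 0 := by rw [← h1]; ring
  rcases mul_eq_zero.1 this with h | h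
  · exact h
  · exact absurd ⟨trivial, by linear_combination (pow_eq_zero_iff (three_ne_zero)).1 h⟩ h2

lemma w_YY {c x w : ℂ} (h : (c, x, w) ∈ EE) : x * (1 + x * YY (c, x, w)) = w := by
  by_cases hx : x = 0
  · subst hx; rw [EE_w_zero h]; simp
  · simp only [YY, hx, if_false]
    field_simp
    ring

lemma briancon_YY {c x w : ℂ} (h : (c, x, w) ∈ EE) : briancon x (YY (c, x, w)) = c := by
  by_cases hx : x = 0
  · subst hx
    simp [briancon, YY]; ring
  · have h1 := (mem_EE x (YY (c, x, w))).1
    rw [w_YY h] at h1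
    have h2 := h.1
    simp only at h1 h2
    have : x ^ 2 ≠ 0 := pow_ne_zero _ hx
    apply mul_right_cancel₀ this
    linear_combination h1 - h2

lemma YY_alt {c x w : ℂ} (h : (c, x, w) ∈ EE) :
    YY (c, x, w) * ((w + 1) ^ 3 + x * (w ^ 2 + w / 3 - 1)) = c - (w ^ 2 + w / 3 - 1) := by
  by_cases hx : x = 0
  · subst hx
    rw [EE_w_zero h]
    simp [YY]; ring
  · simp only [YY, hx, if_false]
    have h2 := h.1
    simp only [Qp] at h2
    field_simp
    linear_combination (-3 : ℂ) * h2

lemma continuousOn_YY : ContinuousOn YY EE := by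
  rintro ⟨c, x, w⟩ h
  by_cases hx : x = 0
  · have hw : w = 0 := by subst hx; exact EE_w_zero h
    have hden : ContinuousWithinAt (fun q : ℂ × ℂ × ℂ =>
        (q.1 - (q.2.2 ^ 2 + q.2.2 / 3 - 1)) /
          ((q.2.2 + 1) ^ 3 + q.2.1 * (q.2.2 ^ 2 + q.2.2 / 3 - 1))) EE (c, x, w) := by
      apply ContinuousAt.continuousWithinAt
      apply ContinuousAt.div
      · fun_prop
      · fun_prop
      · simp [hx, hw]
    have hne : ∀ᶠ q : ℂ × ℂ × ℂ in 𝓝 (c, x, w),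
        ((q.2.2 + 1) ^ 3 + q.2.1 * (q.2.2 ^ 2 + q.2.2 / 3 - 1)) ≠ 0 := by
      apply ContinuousAt.eventually_ne
      · fun_prop
      · simp [hx, hw]
    apply hden.congr_of_eventuallyEq
    · filter_upwards [self_mem_nhdsWithin, mem_nhdsWithin_of_mem_nhds hne] with q hq hq2
      rw [eq_div_iff hq2]
      exact YY_alt hq
    · rw [eq_div_iff (by simp [hx, hw])]
      exact YY_alt h
  · apply ContinuousAt.continuousWithinAt
    have hne : ∀ᶠ q : ℂ × ℂ × ℂ in 𝓝 (c, x, w), q.2.1 ≠ 0 := by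
      apply ContinuousAt.eventually_ne
      · fun_prop
      · exact hx
    have : ContinuousAt (fun q : ℂ × ℂ × ℂ => (q.2.2 - q.2.1) / q.2.1 ^ 2) (c, x, w) := by
      apply ContinuousAt.div
      · fun_prop
      · fun_prop
      · simp [hx]
    apply this.congr
    filter_upwards [hne] with q hq
    simp [YY, hq]

lemma continuous_briancon : Continuous (fun p : ℂ × ℂ => briancon p.1 p.2) := by
  unfold briancon; fun_prop

lemma continuous_Qp : Continuous Qp := by unfold Qp; fun_prop
lemma continuous_Dp : Continuous (fun p : ℂ × ℂ => Dp p.1 p.2) := by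
  unfold Dp Qp; fun_prop

/-- Total space over `S` in coordinates `(c, w, z)`. -/
def ZZ (S : Set ℂ) : Set (ℂ × ℂ × ℂ) :=
  {q | q.1 ∈ S ∧ q.2.2 ^ 2 = Dp q.1 q.2.1 ∧ ¬ (q.2.1 = -1 ∧ q.2.2 = -1 / 3)}

lemma EE_of_ZZ {c w z : ℂ} (hc : c ≠ 0) (h : z ^ 2 = Dp c w) (h' : ¬ (w = -1 ∧ z = -1 / 3)) :
    (c, (z - Qp w) / (2 * c), w) ∈ EE := by
  constructor
  · simp only [Dp] at h ⊢
    field_simp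
    linear_combination h
  · rintro ⟨h1, h2⟩
    simp only at h1 h2
    apply h'
    refine ⟨h2, ?_⟩
    have : z - Qp w = 0 := by
      rcases div_eq_zero_iff.1 h1 with h | h
      · exact h
      · simp [hc] at h
    rw [h2] at this
    simp only [Qp] at this
    linear_combination this

lemma ZZ_of_EE {c x w : ℂ} (hc : c ≠ 0) (h : (c, x, w) ∈ EE) :
    (2 * c * x + Qp w) ^ 2 = Dp c w ∧ ¬ (w = -1 ∧ 2 * c * x + Qp w = -1 / 3) := by
  obtain ⟨h1, h2⟩ := h
  simp only at h1 h2
  constructor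
  · simp only [Dp]
    linear_combination 4 * c * h1
  · rintro ⟨h3, h4⟩
    apply h2
    refine ⟨?_, h3⟩
    subst h3
    simp only [Qp] at h4
    have : c * x = 0 := by linear_combination h4 / 2
    simpa [hc] using this

/-- The preimage of `S ∌ 0` in double cover coordinates. -/
noncomputable def homeoZZ (S : Set ℂ) (hS : (0:ℂ) ∉ S) :
    ((fun p : ℂ × ℂ => briancon p.1 p.2) ⁻¹' S) ≃ₜ ZZ S where
  toFun p := ⟨(briancon p.1.1 p.1.2, p.1.1 * (1 + p.1.1 * p.1.2),
      2 * briancon p.1.1 p.1.2 * p.1.1 + Qp (p.1.1 * (1 + p.1.1 * p.1.2))), p.2,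
      ZZ_of_EE (fun h => hS (h ▸ p.2)) (mem_EE _ _)⟩
  invFun q := ⟨((q.1.2.2 - Qp q.1.2.1) / (2 * q.1.1),
      YY (q.1.1, (q.1.2.2 - Qp q.1.2.1) / (2 * q.1.1), q.1.2.1)), by
      have hc : q.1.1 ≠ 0 := fun h => hS (h ▸ q.2.1)
      have := briancon_YY (EE_of_ZZ hc q.2.2.1 q.2.2.2)
      simp only [mem_preimage, this]
      exact q.2.1⟩
  left_inv p := by
    have hc : briancon p.1.1 p.1.2 ≠ 0 := fun h => hS (h ▸ p.2)
    have hx : (2 * briancon p.1.1 p.1.2 * p.1.1 + Qp (p.1.1 * (1 + p.1.1 * p.1.2))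
      - Qp (p.1.1 * (1 + p.1.1 * p.1.2))) / (2 * briancon p.1.1 p.1.2) = p.1.1 := by
      field_simp; ring
    apply Subtype.ext
    simp only [hx, YY_eq]
  right_inv q := by
    have hc : q.1.1 ≠ 0 := fun h => hS (h ▸ q.2.1)
    have hE := EE_of_ZZ hc q.2.2.1 q.2.2.2
    have h1 := briancon_YY hE
    have h2 := w_YY hE
    apply Subtype.ext
    simp only [h1, h2]
    refine Prod.ext rfl (Prod.ext rfl ?_)
    simp only
    field_simp
    ring
  continuous_toFun := by
    have := continuous_briancon
    have h2 := continuous_Qp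
    apply Continuous.subtype_mk
    have h3 : Continuous (fun p : ((fun p : ℂ × ℂ => briancon p.1 p.2) ⁻¹' S) =>
      briancon p.1.1 p.1.2) := this.comp continuous_subtype_val
    fun_prop
  continuous_invFun := by
    have h2 := continuous_Qp
    have h0 : ∀ q : ZZ S, 2 * q.1.1 ≠ 0 := fun q h => hS (by
      have : q.1.1 = 0 := by simpa using h
      exact this ▸ q.2.1)
    have hx : Continuous (fun q : ZZ S => (q.1.2.2 - Qp q.1.2.1) / (2 * q.1.1)) := by
      apply Continuous.div
      · fun_prop
      · fun_prop
      · exact h0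
    apply Continuous.subtype_mk
    apply Continuous.prodMk hx
    apply continuousOn_YY.comp_continuous
    · fun_prop
    · intro q
      exact EE_of_ZZ (fun h => hS (h ▸ q.2.1)) q.2.2.1 q.2.2.2

lemma homeoZZ_fst (S : Set ℂ) (hS : (0:ℂ) ∉ S) (p) :
    ((homeoZZ S hS p).1.1) = briancon p.1.1 p.1.2 := rfl

noncomputable def Rp (w : ℂ) : ℂ := - Qp w ^ 2 / (4 * (w * (w + 1) ^ 3))

lemma root_facts {c w : ℂ} (hc : c ≠ 0) (h : Dp c w = 0) :
    Qp w ≠ 0 ∧ w ≠ 0 ∧ w + 1 ≠ 0 := by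
  have h0 : w ≠ 0 := by rintro rfl; simp [Dp, Qp] at h
  have h1 : w + 1 ≠ 0 := by
    intro h1
    have : w = -1 := by linear_combination h1
    subst this
    norm_num [Dp, Qp] at h
  refine ⟨?_, h0, h1⟩
  intro hq
  simp only [Dp, hq] at h
  have : c * (w * (w + 1) ^ 3) = 0 := by linear_combination h / 4
  simp [hc, h0, h1] at this

lemma Rp_strict {w : ℂ} (h0 : w ≠ 0) (h1 : w + 1 ≠ 0) :
    HasStrictDerivAt Rp (Qp w * (w + 1) ^ 2 / (4 * (w * (w + 1) ^ 3) ^ 2)) w := by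
  have hQ : HasStrictDerivAt Qp (8 / 3 * (2 * w) + 4) w := by
    unfold Qp
    have := ((((hasStrictDerivAt_id w).pow 2).const_mul (8/3 : ℂ)).add
      ((hasStrictDerivAt_id w).const_mul (4:ℂ))).add_const 1
    convert! this using 1
    simp
  have hP : HasStrictDerivAt (fun w : ℂ => 4 * (w * (w + 1) ^ 3))
      (4 * ((w + 1) ^ 3 + w * (3 * (w + 1) ^ 2))) w := by
    have := ((hasStrictDerivAt_id w).mul (((hasStrictDerivAt_id w).add_const 1).pow 3)).const_mul (4:ℂ)
    convert! this using 1
    simp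
  have hne : 4 * (w * (w + 1) ^ 3) ≠ 0 := by simp [h0, h1]
  have := ((hQ.pow 2).neg).div hP hne
  unfold Rp
  convert! this using 1
  simp only [Qp, Pi.neg_apply, Pi.pow_apply]
  field_simp
  ring

lemma Rp_of_root {c w : ℂ} (hc : c ≠ 0) (h : Dp c w = 0) : Rp w = c := by
  obtain ⟨_, h0, h1⟩ := root_facts hc h
  simp only [Rp, Dp] at h ⊢
  field_simp
  linear_combination -h

lemma root_of_Rp {c w : ℂ} (hc : c ≠ 0) (h : Rp w = c) : Dp c w = 0 := by
  have hne : 4 * (w * (w + 1) ^ 3) ≠ 0 := by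
    intro h'
    rw [Rp, h', div_zero] at h
    exact hc h.symm
  rw [Rp, div_eq_iff hne] at h
  simp only [Dp]
  linear_combination -h

lemma local_root {c i : ℂ} (hc : c ≠ 0) (h : Dp c i = 0) :
    ∃ e : ℂ → ℂ, e c = i ∧ ∀ᶠ c' in 𝓝 c, ContinuousAt e c' ∧ Dp c' (e c') = 0 := by
  obtain ⟨hq, h0, h1⟩ := root_facts hc h
  have hs := Rp_strict h0 h1
  have hd : Qp i * (i + 1) ^ 2 / (4 * (i * (i + 1) ^ 3) ^ 2) ≠ 0 := by
    simp [hq, h0, h1]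
  have hF := hs.hasStrictFDerivAt_equiv hd
  let P := hF.toOpenPartialHomeomorph Rp
  have hcoe : ∀ x, P x = Rp x := fun x => rfl
  have hi : i ∈ P.source := hF.mem_toOpenPartialHomeomorph_source
  have hc' : P i = c := Rp_of_root hc h
  have ht : c ∈ P.target := hc' ▸ P.map_source hi
  refine ⟨P.symm, ?_, ?_⟩
  · rw [← hc', P.left_inv hi]
  · filter_upwards [P.open_target.mem_nhds ht, isOpen_ne.mem_nhds hc] with c' h1 h2
    refine ⟨P.continuousAt_symm h1, root_of_Rp h2 ?_⟩
    exact P.right_inv h1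

open Polynomial in
noncomputable def pD (c : ℂ) : ℂ[X] :=
  C (64 / 9 + 4 * c) * X ^ 4 + C (64 / 3 + 12 * c) * X ^ 3 + C (64 / 3 + 12 * c) * X ^ 2
    + C (8 + 4 * c) * X + C 1

lemma pD_eval (c w : ℂ) : (pD c).eval w = Dp c w := by
  simp [pD, Dp, Qp]; ring

lemma lead_ne {c : ℂ} (hc : c ≠ -16 / 9) : 64 / 9 + 4 * c ≠ 0 := by
  intro h; apply hc; linear_combination h / 4

lemma pD_natDegree {c : ℂ} (hc : c ≠ -16 / 9) : (pD c).natDegree = 4 := by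
  have := lead_ne hc
  unfold pD; compute_degree!

lemma pD_lead {c : ℂ} (hc : c ≠ -16 / 9) : (pD c).leadingCoeff = 64 / 9 + 4 * c := by
  rw [Polynomial.leadingCoeff, pD_natDegree hc]
  unfold pD
  simp only [Polynomial.coeff_add, Polynomial.coeff_C_mul, Polynomial.coeff_X_pow,
    Polynomial.coeff_X, Polynomial.coeff_C]
  norm_num

lemma pD_ne {c : ℂ} (hc : c ≠ -16 / 9) : pD c ≠ 0 := by
  intro h
  have := pD_natDegree hc
  simp [h] at this

lemma pD_nodup {c : ℂ} (h0 : c ≠ 0) (hc : c ≠ -16 / 9) : (pD c).roots.Nodup := by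
  rw [Multiset.nodup_iff_count_le_one]
  intro w
  rw [Polynomial.count_roots]
  by_contra! hlt
  rw [Polynomial.one_lt_rootMultiplicity_iff_isRoot (pD_ne hc)] at hlt
  obtain ⟨h1, h2⟩ := hlt
  have h1' : Dp c w = 0 := by rw [← pD_eval]; exact h1
  obtain ⟨hq, hw, hw1⟩ := root_facts h0 h1'
  have h2' : (Polynomial.derivative (pD c)).eval w = 0 := h2
  simp [pD] at h2'
  have : Qp w * (w + 1) ^ 2 = 0 := by
    simp only [Dp, Qp] at h1' ⊢
    linear_combination (-(w * (w+1)^3)) * h2' + ((w + 1) ^ 3 + w * (3 * (w + 1) ^ 2)) * h1'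
  simp [hq, hw1] at this

lemma pD_factor {c : ℂ} (hc : c ≠ -16 / 9) (s : Finset ℂ) (hs : s.card = 4) (e : ℂ → ℂ)
    (he : Set.InjOn e s) (hr : ∀ i ∈ s, Dp c (e i) = 0) (w : ℂ) :
    Dp c w = (64 / 9 + 4 * c) * ∏ i ∈ s, (w - e i) := by
  have hcard : (s.image e).card = 4 := by rw [Finset.card_image_of_injOn he, hs]
  have hle : (s.image e).val ≤ (pD c).roots := by
    rw [Multiset.le_iff_subset (s.image e).nodup]
    intro a ha
    have ha' : a ∈ s.image e := ha
    obtain ⟨i, hi, rfl⟩ := Finset.mem_image.1 ha'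
    rw [Polynomial.mem_roots (pD_ne hc), Polynomial.IsRoot, pD_eval]
    exact hr i hi
  have heq : (s.image e).val = (pD c).roots := by
    apply Multiset.eq_of_le_of_card_le hle
    rw [Finset.card_val, hcard, ← pD_natDegree hc]
    exact Polynomial.card_roots' _
  have hf := Polynomial.C_leadingCoeff_mul_prod_multiset_X_sub_C (p := pD c)
    (IsAlgClosed.card_roots_eq_natDegree)
  rw [← pD_eval, ← hf, ← heq, pD_lead hc]
  change Polynomial.eval w (_ * ∏ a ∈ s.image e, _) = _
  rw [Finset.prod_image he]
  simp [Polynomial.eval_prod]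

lemma roots_family {c : ℂ} (h0 : c ≠ 0) (hc : c ≠ -16 / 9) :
    ∃ (s : Finset ℂ) (e : ℂ → ℂ → ℂ), (∀ i ∈ s, i ≠ -1) ∧ (∀ i ∈ s, e i c = i) ∧
      ∀ᶠ c' in 𝓝 c, (c' ≠ 0 ∧ 64 / 9 + 4 * c' ≠ 0) ∧ (∀ i ∈ s, ContinuousAt (e i) c') ∧
        ∀ w, Dp c' w = (64 / 9 + 4 * c') * ∏ i ∈ s, (w - e i c') := by
  classical
  let s := (pD c).roots.toFinset
  have hs : ∀ i ∈ s, Dp c i = 0 := by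
    intro i hi
    have := (Multiset.mem_toFinset.1 hi)
    rw [Polynomial.mem_roots (pD_ne hc), Polynomial.IsRoot, pD_eval] at this
    exact this
  have hcard : s.card = 4 := by
    rw [Multiset.toFinset_card_of_nodup (pD_nodup h0 hc), IsAlgClosed.card_roots_eq_natDegree,
      pD_natDegree hc]
  have hex : ∀ i, ∃ e : ℂ → ℂ, i ∈ s → (e c = i ∧
      ∀ᶠ c' in 𝓝 c, ContinuousAt e c' ∧ Dp c' (e c') = 0) := by
    intro i
    by_cases hi : i ∈ s
    · obtain ⟨e, he⟩ := local_root h0 (hs i hi)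
      exact ⟨e, fun _ => he⟩
    · exact ⟨0, fun h => absurd h hi⟩
  choose e he using hex
  refine ⟨s, e, ?_, fun i hi => (he i hi).1, ?_⟩
  · rintro i hi rfl
    exact (root_facts h0 (hs _ hi)).2.2 (by ring)
  · have A : ∀ᶠ c' in 𝓝 c, ∀ i ∈ s, ContinuousAt (e i) c' ∧ Dp c' (e i c') = 0 := by
      rw [Filter.eventually_all_finset]
      exact fun i hi => (he i hi).2
    have B : ∀ᶠ c' in 𝓝 c, ∀ i ∈ s, ∀ j ∈ s, i ≠ j → e i c' ≠ e j c' := by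
      rw [Filter.eventually_all_finset]
      intro i hi
      rw [Filter.eventually_all_finset]
      intro j hj
      by_cases hij : i = j
      · simp [hij]
      · have h1 := (he i hi).2.self_of_nhds.1
        have h2 := (he j hj).2.self_of_nhds.1
        have := h1.ne_iff_eventually_ne h2
        filter_upwards [this.1 (by rw [(he i hi).1, (he j hj).1]; exact hij)] with c' h _
        exact h
    filter_upwards [A, B, isOpen_ne.mem_nhds h0, isOpen_ne.mem_nhds hc] with c' hA hB h1 h2
    refine ⟨⟨h1, lead_ne h2⟩, fun i hi => (hA i hi).1, ?_⟩
    apply pD_factor h2 s hcard (fun i => e i c')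
    · intro i hi j hj hij
      by_contra hne
      exact hB i hi j hj hne hij
    · exact fun i hi => (hA i hi).2

noncomputable def chi (r : ℝ) (i w : ℂ) : ℝ := max (min (2 - ‖w - i‖ / r) 1) 0

lemma chi_one {r : ℝ} (hr : 0 < r) {i w : ℂ} (h : ‖w - i‖ ≤ r) : chi r i w = 1 := by
  have : ‖w - i‖ / r ≤ 1 := (div_le_one hr).2 h
  unfold chi
  rw [min_eq_right (by linarith), max_eq_left (by norm_num)]

lemma chi_zero {r : ℝ} (hr : 0 < r) {i w : ℂ} (h : 2 * r ≤ ‖w - i‖) : chi r i w = 0 := by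
  have : 2 ≤ ‖w - i‖ / r := (le_div_iff₀ hr).2 h
  unfold chi
  rw [min_eq_left (by linarith), max_eq_right (by linarith)]

lemma chi_abs {r : ℝ} (i w : ℂ) : |chi r i w| ≤ 1 := by
  unfold chi
  rw [abs_of_nonneg (le_max_right _ _)]
  exact max_le (min_le_right _ _) (by norm_num)

lemma chi_lip {r : ℝ} (hr : 0 < r) (i w w' : ℂ) :
    |chi r i w - chi r i w'| ≤ ‖w - w'‖ / r := by
  unfold chi
  have h1 : |(2 - ‖w - i‖ / r) - (2 - ‖w' - i‖ / r)| ≤ ‖w - w'‖ / r := by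
    have : (2 - ‖w - i‖ / r) - (2 - ‖w' - i‖ / r) = (‖w' - i‖ - ‖w - i‖) / r := by ring
    rw [this, abs_div, abs_of_pos hr]
    gcongr
    have := abs_norm_sub_norm_le (w' - i) (w - i)
    rw [sub_sub_sub_cancel_right, norm_sub_rev w' w] at this
    exact this
  refine le_trans ?_ h1
  refine le_trans (abs_max_sub_max_le_abs _ _ _) ?_
  exact abs_inf_sub_inf_le_abs _ _ _

lemma chi_cont (r : ℝ) (i : ℂ) : Continuous (chi r i) := by
  unfold chi; fun_prop


lemma inverse_family {U : Set ℂ} (ψ : ℂ → ℂ → ℂ)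
    (hcont : ContinuousOn (fun p : ℂ × ℂ => ψ p.1 p.2) (U ×ˢ univ))
    (hlip : ∀ c ∈ U, ∀ w w', ‖ψ c w - ψ c w'‖ ≤ 1 / 2 * ‖w - w'‖) :
    ∃ φi : ℂ → ℂ → ℂ, ContinuousOn (fun p : ℂ × ℂ => φi p.1 p.2) (U ×ˢ univ) ∧
      (∀ c ∈ U, ∀ v, φi c v + ψ c (φi c v) = v) ∧
      (∀ c ∈ U, ∀ w, φi c (w + ψ c w) = w) := by
  have hanti : ∀ c ∈ U, ∀ w w', ‖w - w'‖ ≤ 2 * ‖(w + ψ c w) - (w' + ψ c w')‖ := by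
    intro c hc w w'
    have h1 := hlip c hc w w'
    have h2 : ‖w - w'‖ ≤ ‖(w + ψ c w) - (w' + ψ c w')‖ + ‖ψ c w - ψ c w'‖ := by
      have := norm_sub_le ((w + ψ c w) - (w' + ψ c w')) (ψ c w - ψ c w')
      have h3 : (w + ψ c w) - (w' + ψ c w') - (ψ c w - ψ c w') = w - w' := by ring
      rwa [h3] at this
    linarith
  have hsurj : ∀ c, ∀ v, ∃ w, c ∈ U → w + ψ c w = v := by
    intro c v
    by_cases hc : c ∈ U
    · have hC : ContractingWith (1/2) (fun w => v - ψ c w) := by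
        refine ⟨by rw [← NNReal.coe_lt_coe]; norm_num, ?_⟩
        apply LipschitzWith.of_dist_le_mul
        intro w w'
        rw [dist_eq_norm, dist_eq_norm]
        have := hlip c hc w w'
        rw [norm_sub_rev] at this
        simpa using this
      have := hC.fixedPoint_isFixedPt
      refine ⟨hC.fixedPoint, fun _ => ?_⟩
      have h : v - ψ c hC.fixedPoint = hC.fixedPoint := this
      linear_combination -h
    · exact ⟨0, fun h => absurd h hc⟩
  choose φi hφi using hsurj
  refine ⟨φi, ?_, fun c hc v => hφi c v hc, ?_⟩
  · rintro ⟨c, v⟩ ⟨hc, -⟩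
    have hc : c ∈ U := hc
    rw [ContinuousWithinAt, tendsto_iff_norm_sub_tendsto_zero]
    have hle : ∀ᶠ p : ℂ × ℂ in 𝓝[U ×ˢ univ] (c, v), ‖φi p.1 p.2 - φi c v‖ ≤
        2 * ‖p.2 - (φi c v + ψ p.1 (φi c v))‖ := by
      filter_upwards [self_mem_nhdsWithin] with p hp
      have := hanti p.1 hp.1 (φi p.1 p.2) (φi c v)
      rwa [hφi p.1 p.2 hp.1] at this
    refine squeeze_zero' (Eventually.of_forall fun _ => norm_nonneg _) hle ?_
    have h1 : ContinuousOn (fun p : ℂ × ℂ => 2 * ‖p.2 - (φi c v + ψ p.1 (φi c v))‖) (U ×ˢ univ) := by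
      have : ContinuousOn (fun p : ℂ × ℂ => ψ p.1 (φi c v)) (U ×ˢ univ) :=
        hcont.comp (f := fun p : ℂ × ℂ => (p.1, φi c v)) (by fun_prop) (fun p hp => ⟨hp.1, trivial⟩)
      exact continuousOn_const.mul (continuousOn_snd.sub (continuousOn_const.add this)).norm
    have h2 := h1 (c, v) ⟨hc, trivial⟩
    have h3 : 2 * ‖v - (φi c v + ψ c (φi c v))‖ = 0 := by rw [hφi c v hc]; simp
    rw [ContinuousWithinAt] at h2
    simp only [h3] at h2
    exact h2
  · intro c hc w
    have := hanti c hc (φi c (w + ψ c w)) w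
    rw [hφi c _ hc] at this
    simp only [sub_self, norm_zero, mul_zero] at this
    exact sub_eq_zero.1 (norm_le_zero_iff.1 this)

lemma triv_data {c0 : ℂ} (h0 : c0 ≠ 0) (hc : c0 ≠ -16 / 9) :
    ∃ (U : Set ℂ) (φ φi S : ℂ → ℂ → ℂ), IsOpen U ∧ c0 ∈ U ∧ (0 : ℂ) ∉ U ∧
      ContinuousOn (fun p : ℂ × ℂ => φ p.1 p.2) (U ×ˢ univ) ∧
      ContinuousOn (fun p : ℂ × ℂ => φi p.1 p.2) (U ×ˢ univ) ∧
      ContinuousOn (fun p : ℂ × ℂ => S p.1 p.2) (U ×ˢ univ) ∧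
      (∀ c ∈ U, ∀ w, φ c (φi c w) = w ∧ φi c (φ c w) = w ∧ S c w ≠ 0 ∧
        S c w ^ 2 * Dp c0 w = Dp c (φ c w) ∧ φ c (-1) = -1 ∧ S c (-1) = 1) := by
  classical
  obtain ⟨s, e, hs1, hec, hev⟩ := roots_family h0 hc
  obtain ⟨r, hr, hr1, hr2⟩ : ∃ r : ℝ, 0 < r ∧ (∀ i ∈ s, ∀ j ∈ s, i ≠ j → 3 * r < ‖i - j‖) ∧
      (∀ i ∈ s, 2 * r < ‖-1 - i‖) := by
    have key : ∀ (k d : ℝ), 0 < d → ∀ᶠ r : ℝ in 𝓝[>] 0, k * r < d := by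
      intro k d hd
      apply mem_nhdsWithin_of_mem_nhds
      have : ContinuousAt (fun r : ℝ => k * r) 0 := by fun_prop
      exact this.eventually_lt continuousAt_const (by simpa using hd)
    have h1 : ∀ᶠ r : ℝ in 𝓝[>] 0, ∀ i ∈ s, ∀ j ∈ s, i ≠ j → 3 * r < ‖i - j‖ := by
      rw [Filter.eventually_all_finset]
      intro i hi
      rw [Filter.eventually_all_finset]
      intro j hj
      by_cases hij : i = j
      · simp [hij]
      · filter_upwards [key 3 _ (norm_pos_iff.2 (sub_ne_zero.2 hij))] with r hr _
        exact hr
    have h2 : ∀ᶠ r : ℝ in 𝓝[>] 0, ∀ i ∈ s, 2 * r < ‖-1 - i‖ := by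
      rw [Filter.eventually_all_finset]
      intro i hi
      exact key 2 _ (norm_pos_iff.2 (sub_ne_zero.2 (hs1 i hi).symm))
    have h6 : ∀ᶠ r : ℝ in 𝓝[>] 0, 0 < r := self_mem_nhdsWithin
    obtain ⟨r, h3, h4, h5⟩ := (h6.and (h1.and h2)).exists
    exact ⟨r, h3, h4, h5⟩
  have hsmall : ∀ᶠ c in 𝓝 c0, ∑ i ∈ s, ‖e i c - i‖ < r / 4 := by
    have : ContinuousAt (fun c => ∑ i ∈ s, ‖e i c - i‖) c0 := by
      apply tendsto_finsetSum
      intro i hi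
      exact ((hev.self_of_nhds.2.1 i hi).sub continuousAt_const).norm
    apply this.eventually_lt continuousAt_const
    rw [Finset.sum_eq_zero (fun i hi => by rw [hec i hi]; simp)]
    positivity
  obtain ⟨U, hUsub, hU, hcU⟩ := mem_nhds_iff.1 (hev.and hsmall)
  have hUne : ∀ c ∈ U, c ≠ 0 := fun c h => (hUsub h).1.1.1
  have hlead : ∀ c ∈ U, 64 / 9 + 4 * c ≠ 0 := fun c h => (hUsub h).1.1.2
  have hcon : ∀ i ∈ s, ContinuousOn (e i) U :=
    fun i hi c h => ((hUsub h).1.2.1 i hi).continuousWithinAt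
  have hfac : ∀ c ∈ U, ∀ w, Dp c w = (64 / 9 + 4 * c) * ∏ i ∈ s, (w - e i c) :=
    fun c h => (hUsub h).1.2.2
  have hM : ∀ c ∈ U, ∑ i ∈ s, ‖e i c - i‖ < r / 4 := fun c h => (hUsub h).2
  let ψ : ℂ → ℂ → ℂ := fun c w => ∑ i ∈ s, (chi r i w : ℂ) * (e i c - i)
  have hconp : ∀ i ∈ s, ContinuousOn (fun p : ℂ × ℂ => e i p.1) (U ×ˢ univ) := fun i hi =>
    (hcon i hi).comp continuousOn_fst (fun p hp => hp.1)
  have hψc : ContinuousOn (fun p : ℂ × ℂ => ψ p.1 p.2) (U ×ˢ univ) := by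
    apply continuousOn_finsetSum
    intro i hi
    have h1 := hconp i hi
    have h2 := chi_cont r i
    apply ContinuousOn.mul
    · apply Continuous.continuousOn; fun_prop
    · exact h1.sub continuousOn_const
  have hψlip : ∀ c ∈ U, ∀ w w', ‖ψ c w - ψ c w'‖ ≤ 1 / 2 * ‖w - w'‖ := by
    intro c hcU w w'
    have : ψ c w - ψ c w' = ∑ i ∈ s, ((chi r i w - chi r i w' : ℝ) : ℂ) * (e i c - i) := by
      simp only [ψ]
      rw [← Finset.sum_sub_distrib]
      apply Finset.sum_congr rfl
      intro i _
      push_cast; ring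
    rw [this]
    calc _ ≤ ∑ i ∈ s, ‖((chi r i w - chi r i w' : ℝ) : ℂ) * (e i c - i)‖ := norm_sum_le _ _
      _ ≤ ∑ i ∈ s, ‖w - w'‖ / r * ‖e i c - i‖ := by
        apply Finset.sum_le_sum
        intro i _
        rw [norm_mul, Complex.norm_real, Real.norm_eq_abs]
        gcongr
        exact chi_lip hr i w w'
      _ = ‖w - w'‖ / r * ∑ i ∈ s, ‖e i c - i‖ := by rw [Finset.mul_sum]
      _ ≤ ‖w - w'‖ / r * (r / 4) := by gcongr; exact (hM c hcU).le
      _ ≤ 1 / 2 * ‖w - w'‖ := by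
        have := norm_nonneg (w - w')
        field_simp; linarith
  have hψnorm : ∀ c ∈ U, ∀ w, ‖ψ c w‖ ≤ r / 4 := by
    intro c hcU w
    refine le_trans (norm_sum_le _ _) (le_trans ?_ (hM c hcU).le)
    apply Finset.sum_le_sum
    intro i _
    rw [norm_mul, Complex.norm_real, Real.norm_eq_abs]
    have := chi_abs (r := r) i w
    have := norm_nonneg (e i c - i)
    nlinarith
  have hψnear : ∀ c, ∀ i ∈ s, ∀ w, ‖w - i‖ ≤ r → ψ c w = e i c - i := by
    intro c i hi w hw
    simp only [ψ]
    rw [Finset.sum_eq_single_of_mem i hi]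
    · rw [chi_one hr hw]; simp
    · intro j hj hji
      rw [chi_zero hr]
      · simp
      · have h1 := hr1 j hj i hi hji
        have h2 := norm_sub_le_norm_sub_add_norm_sub j w i
        rw [norm_sub_rev j w] at h2
        linarith
  have hψm1 : ∀ c, ψ c (-1) = 0 := by
    intro c
    apply Finset.sum_eq_zero
    intro i hi
    rw [chi_zero hr (hr2 i hi).le]; simp
  obtain ⟨φi, hφic, hφ1, hφ2⟩ := inverse_family ψ hψc hψlip
  let q : ℂ → ℂ → ℂ → ℂ := fun i c w => (ψ c w - (e i c - i)) / (w - i)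
  have hqnorm : ∀ i ∈ s, ∀ c ∈ U, ∀ w, ‖q i c w‖ < 1 := by
    intro i hi c hcU w
    by_cases hw : ‖w - i‖ ≤ r
    · simp [q, hψnear c i hi w hw]
    · push Not at hw
      simp only [q, norm_div]
      rw [div_lt_one (by linarith)]
      have h1 := norm_sub_le (ψ c w) (e i c - i)
      have h2 := hψnorm c hcU w
      have h3 : ‖e i c - i‖ ≤ ∑ i ∈ s, ‖e i c - i‖ :=
        Finset.single_le_sum (f := fun i => ‖e i c - i‖) (fun i _ => norm_nonneg _) hi
      have := hM c hcU
      linarith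
  have hqc : ∀ i ∈ s, ContinuousOn (fun p : ℂ × ℂ => q i p.1 p.2) (U ×ˢ univ) := by
    rintro i hi ⟨c, w⟩ hp
    by_cases hw : w = i
    · have hev : ∀ᶠ p : ℂ × ℂ in 𝓝 (c, w), ‖p.2 - i‖ < r := by
        have : ContinuousAt (fun p : ℂ × ℂ => ‖p.2 - i‖) (c, w) := by fun_prop
        apply this.eventually_lt continuousAt_const
        simpa [hw] using hr
      have hz : ContinuousWithinAt (fun _ : ℂ × ℂ => (0:ℂ)) (U ×ˢ univ) (c, w) :=
        continuousWithinAt_const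
      apply hz.congr_of_eventuallyEq
      · filter_upwards [mem_nhdsWithin_of_mem_nhds hev] with p hp
        simp [q, hψnear p.1 i hi p.2 hp.le]
      · simp [q, hw]
    · apply ContinuousWithinAt.div
      · exact (hψc _ hp).sub ((hconp i hi _ hp).sub continuousWithinAt_const)
      · apply ContinuousAt.continuousWithinAt; fun_prop
      · exact sub_ne_zero.2 hw
  have hqid : ∀ i ∈ s, ∀ c w, (1 + q i c w) * (w - i) = w + ψ c w - e i c := by
    intro i hi c w
    by_cases hw : w = i
    · have := hψnear c i hi w (by simp [hw, hr.le])
      rw [this, hw]; ring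
    · have : w - i ≠ 0 := sub_ne_zero.2 hw
      simp only [q]
      field_simp
      ring
  let T : ℂ → ℂ → ℂ := fun c w => ∏ i ∈ s, (1 + q i c w) ^ (((2:ℕ) : ℂ)⁻¹)
  have hTc : ContinuousOn (fun p : ℂ × ℂ => T p.1 p.2) (U ×ˢ univ) := by
    apply continuousOn_finsetProd
    intro i hi p hp
    have h1 : ContinuousWithinAt (fun p : ℂ × ℂ => 1 + q i p.1 p.2) (U ×ˢ univ) p :=
      continuousWithinAt_const.add (hqc i hi p hp)
    exact ContinuousAt.comp_continuousWithinAt (f := fun p : ℂ × ℂ => 1 + q i p.1 p.2)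
      (continuousAt_cpow_const
      (Complex.mem_slitPlane_of_norm_lt_one (hqnorm i hi p.1 hp.1 p.2))) h1
  have hT2 : ∀ c w, T c w ^ 2 = ∏ i ∈ s, (1 + q i c w) := by
    intro c w
    simp only [T]
    rw [← Finset.prod_pow]
    apply Finset.prod_congr rfl
    intro i _
    exact Complex.cpow_nat_inv_pow _ two_ne_zero
  have hTne : ∀ c ∈ U, ∀ w, T c w ≠ 0 := by
    intro c hcU w h
    have := hT2 c w
    rw [h, zero_pow two_ne_zero] at this
    refine Finset.prod_ne_zero_iff.2 ?_ this.symm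
    intro i hi
    exact Complex.slitPlane_ne_zero (Complex.mem_slitPlane_of_norm_lt_one (hqnorm i hi c hcU w))
  have hTD : ∀ c ∈ U, ∀ w, (64 / 9 + 4 * c) * (T c w ^ 2 * Dp c0 w) =
      (64 / 9 + 4 * c0) * Dp c (w + ψ c w) := by
    intro c hcU' w
    rw [hfac c hcU', hfac c0 hcU, hT2]
    have : (∏ i ∈ s, (1 + q i c w)) * ∏ i ∈ s, (w - e i c0) = ∏ i ∈ s, (w + ψ c w - e i c) := by
      rw [← Finset.prod_mul_distrib]
      apply Finset.prod_congr rfl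
      intro i hi
      rw [hec i hi, hqid i hi]
    rw [← this]
    ring
  have hDm1 : ∀ c, Dp c (-1) = 1 / 9 := by intro c; norm_num [Dp, Qp]
  refine ⟨U, fun c w => w + ψ c w, φi, fun c w => T c w / T c (-1), hU, hcU,
    fun h => hUne 0 h rfl, continuousOn_snd.add hψc, hφic, ?_, ?_⟩
  · apply hTc.div
    · exact hTc.comp (f := fun p : ℂ × ℂ => (p.1, (-1 : ℂ))) (by fun_prop)
        (fun p hp => ⟨hp.1, trivial⟩)
    · exact fun p hp => hTne p.1 hp.1 _
  · intro c hcU' w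
    refine ⟨hφ1 c hcU' w, hφ2 c hcU' w, div_ne_zero (hTne c hcU' _) (hTne c hcU' _), ?_, ?_,
      div_self (hTne c hcU' _)⟩
    · have h1 := hTD c hcU' w
      have h2 := hTD c hcU' (-1)
      rw [hψm1, add_zero, hDm1, hDm1] at h2
      have h3 := hlead c hcU'
      have h4 := hTne c hcU' (-1)
      rw [div_pow]
      field_simp
      apply mul_left_cancel₀ h3
      linear_combination h1 - 9 * Dp c (w + ψ c w) * h2
    · simp only [hψm1, add_zero]

theorem regular_of_ne {c0 : ℂ} (h0 : c0 ≠ 0) (hc : c0 ≠ -16 / 9) :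
    IsRegularValue (fun p => briancon p.1 p.2) c0 := by
  obtain ⟨U, φ, φi, S, hU, hcU, h0U, hφ, hφi, hS, H⟩ := triv_data h0 hc
  have hcm : ∀ q : ZZ {c0}, q.1.1 = c0 := fun q => q.2.1
  have h1 : ∀ c ∈ U, ∀ w, φ c w = -1 → w = -1 := by
    intro c hc' w h
    rw [← (H c hc' w).2.1, h]
    have := (H c hc' (-1)).2.1
    rwa [(H c hc' (-1)).2.2.2.2.1] at this
  let g : ZZ U ≃ₜ ZZ {c0} × U :=
  { toFun := fun q => (⟨(c0, φi q.1.1 q.1.2.1, q.1.2.2 / S q.1.1 (φi q.1.1 q.1.2.1)), by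
        obtain ⟨⟨c, w, z⟩, hcU', hz, hne⟩ := q
        simp only at hcU' hz hne ⊢
        obtain ⟨_, _, hS0, hSD, _, _⟩ := H c hcU' (φi c w)
        rw [(H c hcU' w).1] at hSD
        refine ⟨rfl, ?_, ?_⟩
        · simp only
          rw [div_pow, hz, ← hSD]
          field_simp
        · rintro ⟨ha, hb⟩
          simp only at ha hb
          rw [ha, (H c hcU' w).2.2.2.2.2, div_one] at hb
          apply hne
          refine ⟨?_, hb⟩
          rw [← (H c hcU' w).1, ha, (H c hcU' w).2.2.2.2.1]⟩, ⟨q.1.1, q.2.1⟩)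
    invFun := fun p => ⟨(p.2.1, φ p.2.1 p.1.1.2.1, S p.2.1 p.1.1.2.1 * p.1.1.2.2), by
        obtain ⟨⟨⟨c', w, z⟩, hc', hz, hne⟩, c, hcU'⟩ := p
        have hc'' : c' = c0 := hc'
        subst hc''
        simp only at hcU' hz hne ⊢
        obtain ⟨_, _, hS0, hSD, _, hS1⟩ := H c hcU' w
        refine ⟨hcU', ?_, ?_⟩
        · simp only
          rw [mul_pow, hz, hSD]
        · rintro ⟨ha, hb⟩
          simp only at ha hb
          have hw := h1 c hcU' w ha
          subst hw
          rw [hS1, one_mul] at hb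
          exact hne ⟨rfl, hb⟩⟩
    left_inv := by
      rintro ⟨⟨c, w, z⟩, hcU', hz, hne⟩
      apply Subtype.ext
      have hcU' : c ∈ U := hcU'
      have := (H c hcU' (φi c w)).2.2.1
      simp only [(H c hcU' w).1]
      refine Prod.ext rfl (Prod.ext rfl ?_)
      simp only
      field_simp
    right_inv := by
      rintro ⟨⟨⟨c', w, z⟩, hc', hz, hne⟩, c, hcU'⟩
      have hc'' : c' = c0 := hc'
      subst hc''
      have := (H c hcU' w).2.2.1
      refine Prod.ext (Subtype.ext ?_) rfl
      simp only [(H c hcU' w).2.1]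
      refine Prod.ext rfl (Prod.ext rfl ?_)
      simp only
      field_simp
    continuous_toFun := by
      have a1 : Continuous (fun q : ZZ U => φi q.1.1 q.1.2.1) :=
        hφi.comp_continuous (f := fun q : ZZ U => (q.1.1, q.1.2.1)) (by fun_prop)
          (fun q => ⟨q.2.1, trivial⟩)
      have a2 : Continuous (fun q : ZZ U => S q.1.1 (φi q.1.1 q.1.2.1)) :=
        hS.comp_continuous (f := fun q : ZZ U => (q.1.1, φi q.1.1 q.1.2.1))
          (Continuous.prodMk (by fun_prop) a1)
          (fun q => ⟨q.2.1, trivial⟩)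
      apply Continuous.prodMk
      · apply Continuous.subtype_mk
        apply Continuous.prodMk continuous_const
        apply Continuous.prodMk a1
        apply Continuous.div _ a2
        · exact fun q => (H _ q.2.1 _).2.2.1
        · fun_prop
      · apply Continuous.subtype_mk; fun_prop
    continuous_invFun := by
      have a1 : Continuous (fun p : ZZ {c0} × U => φ p.2.1 p.1.1.2.1) :=
        hφ.comp_continuous (f := fun p : ZZ {c0} × U => (p.2.1, p.1.1.2.1)) (by fun_prop)
          (fun q => ⟨q.2.2, trivial⟩)
      have a2 : Continuous (fun p : ZZ {c0} × U => S p.2.1 p.1.1.2.1) :=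
        hS.comp_continuous (f := fun p : ZZ {c0} × U => (p.2.1, p.1.1.2.1)) (by fun_prop)
          (fun q => ⟨q.2.2, trivial⟩)
      apply Continuous.subtype_mk
      exact Continuous.prodMk (by fun_prop) (Continuous.prodMk a1 (a2.mul (by fun_prop))) }
  have h0c : (0:ℂ) ∉ ({c0} : Set ℂ) := fun h => h0 (by simpa using h.symm)
  refine ⟨U, hU, hcU, (homeoZZ U h0U).trans (g.trans
    ((homeoZZ {c0} h0c).symm.prodCongr (Homeomorph.refl U))), ?_⟩
  intro z
  rfl

/-- `X` has at least as many ends as elements of `ι`. -/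
def EndsGE (X ι : Type) [TopologicalSpace X] : Prop :=
  ∃ (K : Set X) (V : ι → Set X), IsCompact K ∧ (∀ i, IsOpen (V i)) ∧
    (∀ i j, i ≠ j → Disjoint (V i) (V j)) ∧ (∀ i L, IsCompact L → ¬ V i ⊆ L) ∧ Kᶜ ⊆ ⋃ i, V i

/-- `X` has at most as many ends as elements of `ι`. -/
def EndsLE (X ι : Type) [TopologicalSpace X] : Prop :=
  ∀ K : Set X, IsCompact K → ∃ (L : Set X) (W : ι → Set X), IsCompact L ∧
    (∀ i, IsPreconnected (W i)) ∧ (∀ i, W i ⊆ Kᶜ) ∧ Lᶜ ⊆ ⋃ i, W i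

lemma EndsGE.congr {X Y ι : Type} [TopologicalSpace X] [TopologicalSpace Y] (e : X ≃ₜ Y)
    (h : EndsGE X ι) : EndsGE Y ι := by
  obtain ⟨K, V, hK, hV, hd, hL, hc⟩ := h
  refine ⟨e.symm ⁻¹' K, fun i => e.symm ⁻¹' (V i), ?_, ?_, ?_, ?_, ?_⟩
  · exact e.symm.isCompact_preimage.2 hK
  · exact fun i => (hV i).preimage e.symm.continuous
  · exact fun i j hij => (hd i j hij).preimage _
  · intro i L hLc hsub
    refine hL i (e ⁻¹' L) (e.isCompact_preimage.2 hLc) ?_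
    intro x hx
    exact hsub (by simpa using hx)
  · intro y hy
    have := hc (show e.symm y ∈ Kᶜ from hy)
    simpa using this

lemma ends_false {X ι κ : Type} [Fintype ι] [Fintype κ] [TopologicalSpace X]
    (hlt : Fintype.card κ < Fintype.card ι) (h1 : EndsGE X ι) (h2 : EndsLE X κ) : False := by
  obtain ⟨K, V, hK, hV, hd, hL, hc⟩ := h1
  obtain ⟨L, W, hLc, hW, hWK, hcov⟩ := h2 K hK
  have hne : Nonempty ι := Fintype.card_pos_iff.1 (by omega)
  have hex : ∀ j, ∃ i, W j ⊆ V i := by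
    intro j
    rcases (W j).eq_empty_or_nonempty with h | ⟨x, hx⟩
    · exact ⟨hne.some, by simp [h]⟩
    · obtain ⟨i, hi⟩ := mem_iUnion.1 (hc (hWK j hx))
      refine ⟨i, ?_⟩
      apply (hW j).subset_left_of_subset_union (hV i)
        (isOpen_iUnion (fun k => isOpen_iUnion (fun (_ : i ≠ k) => hV k)))
      · simp only [disjoint_iUnion_right]
        exact fun k hk => hd i k hk
      · intro y hy
        obtain ⟨k, hk⟩ := mem_iUnion.1 (hc (hWK j hy))
        by_cases hik : i = k
        · left; rw [hik]; exact hk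
        · right; exact mem_iUnion.2 ⟨k, mem_iUnion.2 ⟨hik, hk⟩⟩
      · exact ⟨x, hx, hi⟩
  choose f hf using hex
  have : ¬ Function.Surjective f := fun hs => by
    have := Fintype.card_le_of_surjective f hs
    omega
  simp only [Function.Surjective, not_forall, not_exists] at this
  obtain ⟨i, hi⟩ := this
  apply hL i L hLc
  intro x hx
  by_contra hxL
  obtain ⟨j, hj⟩ := mem_iUnion.1 (hcov hxL)
  exact Set.disjoint_left.1 (hd i (f j) (fun h => hi j h.symm)) hx (hf j hj)

lemma EndsGE.mk_subset {E ι : Type} [NormedAddCommGroup E] (S K : Set E) (V : ι → Set E)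
    (hK : IsCompact K) (hKS : K ⊆ S) (hV : ∀ i, IsOpen (V i))
    (hd : ∀ i j, i ≠ j → ∀ x ∈ S, x ∈ V i → x ∉ V j)
    (hc : ∀ x ∈ S, x ∉ K → ∃ i, x ∈ V i)
    (hn : ∀ i, (∃ p ∉ S, p ∈ closure (V i ∩ S)) ∨ ∀ M : ℝ, ∃ p ∈ V i ∩ S, M < ‖p‖) :
    EndsGE S ι := by
  refine ⟨Subtype.val ⁻¹' K, fun i => Subtype.val ⁻¹' V i, ?_, ?_, ?_, ?_, ?_⟩
  · apply Topology.IsInducing.isCompact_preimage' Topology.IsInducing.subtypeVal hK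
    simpa using hKS
  · exact fun i => (hV i).preimage continuous_subtype_val
  · intro i j hij
    rw [Set.disjoint_left]
    exact fun x hx hx' => hd i j hij x.1 x.2 hx hx'
  · intro i L hL hsub
    have hL' : IsCompact (Subtype.val '' L) := hL.image continuous_subtype_val
    have hsub' : V i ∩ S ⊆ Subtype.val '' L := fun x hx => ⟨⟨x, hx.2⟩, hsub hx.1, rfl⟩
    rcases hn i with ⟨p, hp, hpc⟩ | h
    · obtain ⟨q, _, rfl⟩ := (closure_minimal hsub' hL'.isClosed) hpc
      exact hp q.2
    · obtain ⟨M, hM⟩ := hL'.isBounded.exists_norm_le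
      obtain ⟨p, hp, hlt⟩ := h M
      exact absurd (hM p (hsub' hp)) (not_le.2 hlt)
  · intro x hx
    obtain ⟨i, hi⟩ := hc x.1 x.2 hx
    exact mem_iUnion.2 ⟨i, hi⟩

lemma EndsLE.mk_subset {E ι : Type} [NormedAddCommGroup E] (S : Set E)
    (h : ∀ A : Set E, IsCompact A → A ⊆ S → ∃ (B : Set E) (W : ι → Set E), IsCompact B ∧ B ⊆ S ∧
      (∀ i, IsPreconnected (W i)) ∧ (∀ i, ∀ x ∈ W i, x ∈ S ∧ x ∉ A) ∧
      ∀ x ∈ S, x ∉ B → ∃ i, x ∈ W i) : EndsLE S ι := by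
  intro K hK
  obtain ⟨B, W, hB, hBS, hW, hWS, hc⟩ := h (Subtype.val '' K) (hK.image continuous_subtype_val)
    (by rintro _ ⟨x, _, rfl⟩; exact x.2)
  refine ⟨Subtype.val ⁻¹' B, fun i => Subtype.val ⁻¹' W i, ?_, ?_, ?_, ?_⟩
  · apply Topology.IsInducing.isCompact_preimage' Topology.IsInducing.subtypeVal hB
    simpa using hBS
  · intro i
    rw [← Topology.IsInducing.subtypeVal.isPreconnected_image, Subtype.image_preimage_coe,
      Set.inter_eq_right.2 (fun x hx => (hWS i x hx).1)]
    exact hW i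
  · intro i x hx hxK
    exact (hWS i x.1 hx).2 ⟨x, hxK, rfl⟩
  · intro x hx
    obtain ⟨i, hi⟩ := hc x.1 x.2 hx
    exact mem_iUnion.2 ⟨i, hi⟩

lemma fiber_homeo {g : ℂ × ℂ → ℂ} {c : ℂ} (h : IsRegularValue g c) :
    ∀ᶠ c' in 𝓝 c, Nonempty ((g ⁻¹' {c'}) ≃ₜ (g ⁻¹' {c})) := by
  obtain ⟨U, hU, hcU, h, hh⟩ := h
  filter_upwards [hU.mem_nhds hcU] with c' hc'
  have key : ∀ p : (g ⁻¹' {c}), g (h.symm (p, ⟨c', hc'⟩)).1 = c' := by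
    intro p
    rw [← hh, h.apply_symm_apply]
  refine ⟨
  { toFun := fun z => (h ⟨z.1, by
        have : g z.1 = c' := z.2
        simpa [this] using hc'⟩).1
    invFun := fun p => ⟨(h.symm (p, ⟨c', hc'⟩)).1, key p⟩
    left_inv := ?_
    right_inv := ?_
    continuous_toFun := ?_
    continuous_invFun := ?_ }⟩
  · intro z
    apply Subtype.ext
    have hz : g z.1 = c' := z.2
    have hzU : z.1 ∈ g ⁻¹' U := by simpa [hz] using hc'
    have : ((h ⟨z.1, hzU⟩).1, (⟨c', hc'⟩ : U)) = h ⟨z.1, hzU⟩ := by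
      refine Prod.ext rfl (Subtype.ext ?_)
      rw [hh]; exact hz.symm
    simp only [this, h.symm_apply_apply]
  · intro p
    simp only [Subtype.coe_eta, h.apply_symm_apply]
  · fun_prop
  · fun_prop

lemma preconn_punct (a : ℂ) {ρ : ℝ} (hρ : 0 < ρ) :
    IsPreconnected {w : ℂ | w ≠ a ∧ ‖w - a‖ < ρ} := by
  have : {w : ℂ | w ≠ a ∧ ‖w - a‖ < ρ} =
      (fun u => a + Complex.exp u) '' {u : ℂ | u.re < Real.log ρ} := by
    ext w
    constructor
    · rintro ⟨h1, h2⟩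
      have h3 : w - a ≠ 0 := sub_ne_zero.2 h1
      refine ⟨Complex.log (w - a), ?_, ?_⟩
      · simp only [mem_ofPred_eq, Complex.log_re]
        exact Real.log_lt_log (norm_pos_iff.2 h3) h2
      · simp only [Complex.exp_log h3]; ring
    · rintro ⟨u, hu, rfl⟩
      refine ⟨by simp [Complex.exp_ne_zero], ?_⟩
      simp only [add_sub_cancel_left, Complex.norm_exp]
      exact (Real.lt_log_iff_exp_lt hρ).1 hu
  rw [this]
  apply IsPreconnected.image
  · exact (convex_halfSpace_re_lt _).isPreconnected
  · fun_prop

lemma preconn_out (a : ℂ) {ρ : ℝ} (hρ : 0 < ρ) :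
    IsPreconnected {w : ℂ | ρ < ‖w - a‖} := by
  have : {w : ℂ | ρ < ‖w - a‖} =
      (fun u => a + Complex.exp u) '' {u : ℂ | Real.log ρ < u.re} := by
    ext w
    constructor
    · intro h2
      have h2 : ρ < ‖w - a‖ := h2
      have h3 : w - a ≠ 0 := norm_pos_iff.1 (hρ.trans h2)
      refine ⟨Complex.log (w - a), ?_, ?_⟩
      · simp only [mem_ofPred_eq, Complex.log_re]
        exact Real.log_lt_log hρ h2
      · simp only [Complex.exp_log h3]; ring
    · rintro ⟨u, hu, rfl⟩
      simp only [mem_ofPred_eq, add_sub_cancel_left, Complex.norm_exp]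
      exact (Real.log_lt_iff_lt_exp hρ).1 hu
  rw [this]
  apply IsPreconnected.image
  · exact (convex_halfSpace_re_gt _).isPreconnected
  · fun_prop

/-- The plane minus a point has at most two ends. -/
lemma endsLE_two (a : ℂ) : EndsLE ({w : ℂ | w ≠ a} : Set ℂ) Bool := by
  apply EndsLE.mk_subset
  intro A hA hAS
  have haA : a ∉ A := fun h => hAS h rfl
  obtain ⟨ρ, hρ, hball⟩ := Metric.isOpen_iff.1 hA.isClosed.isOpen_compl a haA
  obtain ⟨R, hR⟩ := hA.isBounded.subset_closedBall a
  refine ⟨{w | ρ ≤ ‖w - a‖ ∧ ‖w - a‖ ≤ max R 1},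
    fun b => bif b then {w : ℂ | w ≠ a ∧ ‖w - a‖ < ρ} else {w : ℂ | max R 1 < ‖w - a‖},
    ?_, ?_, ?_, ?_, ?_⟩
  · apply (isCompact_closedBall a (max R 1)).of_isClosed_subset
    · have h1 : IsClosed {w : ℂ | ρ ≤ ‖w - a‖} := isClosed_le (by fun_prop) (by fun_prop)
      have h2 : IsClosed {w : ℂ | ‖w - a‖ ≤ max R 1} := isClosed_le (by fun_prop) (by fun_prop)
      exact h1.inter h2
    · intro w hw
      simpa [dist_eq_norm] using hw.2
  · rintro w ⟨h1, _⟩ rfl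
    simp at h1; linarith
  · rintro (_ | _)
    · exact preconn_out a (by positivity)
    · exact preconn_punct a hρ
  · rintro (_ | _) w hw
    · have hw : max R 1 < ‖w - a‖ := hw
      refine ⟨?_, ?_⟩
      · rintro rfl
        simp at hw
        linarith [hw.2]
      · intro hwA
        have := hR hwA
        simp [dist_eq_norm] at this
        have := le_max_left R 1
        linarith
    · obtain ⟨h1, h2⟩ := hw
      refine ⟨h1, ?_⟩
      intro hwA
      exact hball (by simpa [dist_eq_norm] using h2) hwA
  · intro w hw hwB
    by_cases h : ‖w - a‖ < ρ
    · exact ⟨true, hw, h⟩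
    · refine ⟨false, ?_⟩
      by_contra h2
      exact hwB ⟨not_lt.1 h, not_lt.1 h2⟩

/-- The plane minus `n` points has at least `n + 1` ends. -/
lemma endsGE_plane {n : ℕ} (t : Fin n → ℂ) (ht : Function.Injective t) :
    EndsGE ({w : ℂ | ∀ i, w ≠ t i} : Set ℂ) (Option (Fin n)) := by
  obtain ⟨r, hr, hr1⟩ : ∃ r : ℝ, 0 < r ∧ (∀ i j, i ≠ j → 2 * r < ‖t i - t j‖) := by
    have h1 : ∀ᶠ r : ℝ in 𝓝[>] 0, ∀ i j, i ≠ j → 2 * r < ‖t i - t j‖ := by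
      rw [Filter.eventually_all]
      intro i
      rw [Filter.eventually_all]
      intro j
      by_cases hij : i = j
      · simp [hij]
      · apply mem_nhdsWithin_of_mem_nhds
        have : ContinuousAt (fun r : ℝ => 2 * r) 0 := by fun_prop
        filter_upwards [this.eventually_lt (continuousAt_const (y := ‖t i - t j‖)) (by
          simpa [sub_eq_zero] using fun h => hij (ht h))] with r hr _
        exact hr
    have h6 : ∀ᶠ r : ℝ in 𝓝[>] 0, 0 < r := self_mem_nhdsWithin
    obtain ⟨r, h3, h4⟩ := (h6.and h1).exists
    exact ⟨r, h3, h4⟩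
  have hR : ∀ i, ‖t i‖ + r ≤ ∑ j, ‖t j‖ + r := by
    intro i
    have := Finset.single_le_sum (f := fun j => ‖t j‖) (fun j _ => norm_nonneg _)
      (Finset.mem_univ i)
    linarith
  set R := ∑ j, ‖t j‖ + r with hRdef
  apply EndsGE.mk_subset _ {w | ‖w‖ ≤ R ∧ ∀ i, r ≤ ‖w - t i‖}
    (fun o => match o with
      | none => {w | R < ‖w‖}
      | some i => {w | ‖w - t i‖ < r})
  · apply (isCompact_closedBall (0:ℂ) R).of_isClosed_subset
    · have h1 : IsClosed {w : ℂ | ‖w‖ ≤ R} := isClosed_le (by fun_prop) (by fun_prop)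
      have h2 : IsClosed (⋂ i, {w : ℂ | r ≤ ‖w - t i‖}) :=
        isClosed_iInter (fun i => isClosed_le (by fun_prop) (by fun_prop))
      convert! h1.inter h2 using 1
      ext w
      simp
    · intro w hw
      simpa using hw.1
  · rintro w ⟨_, h⟩ i rfl
    have := h i
    simp at this; linarith
  · rintro (_ | i)
    · exact isOpen_lt (by fun_prop) (by fun_prop)
    · exact isOpen_lt (by fun_prop) (by fun_prop)
  · have far : ∀ i w, ‖w - t i‖ < r → ‖w‖ ≤ R := by
      intro i w h
      have h1 := norm_sub_norm_le w (t i)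
      have := hR i
      linarith
    rintro (_ | i) (_ | j) hij w _ h1 h2
    · exact hij rfl
    · exact absurd (far j w h2) (not_le.2 h1)
    · exact absurd (far i w h1) (not_le.2 h2)
    · have h3 := hr1 i j (fun h => hij (by rw [h]))
      have h1 : ‖w - t i‖ < r := h1
      have h2 : ‖w - t j‖ < r := h2
      have h4 := norm_sub_le_norm_sub_add_norm_sub (t i) w (t j)
      rw [norm_sub_rev (t i) w] at h4
      linarith
  · intro w _ hK
    by_cases h : R < ‖w‖
    · exact ⟨none, h⟩
    · by_contra! hc
      exact hK ⟨not_lt.1 h, fun i => not_lt.1 (hc (some i))⟩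
  · rintro (_ | i)
    · right
      intro M
      have hR0 : 0 < R := by positivity
      refine ⟨((|M| + R + 1 : ℝ) : ℂ), ⟨?_, ?_⟩, ?_⟩
      · change R < ‖_‖
        rw [Complex.norm_real, Real.norm_eq_abs, abs_of_pos (by positivity)]
        linarith [abs_nonneg M]
      · intro i h
        have h2 : ‖((|M| + R + 1 : ℝ) : ℂ)‖ = ‖t i‖ := by rw [h]
        rw [Complex.norm_real, Real.norm_eq_abs, abs_of_pos (by positivity)] at h2
        have := hR i
        linarith [abs_nonneg M]
      · rw [Complex.norm_real, Real.norm_eq_abs, abs_of_pos (by positivity)]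
        linarith [le_abs_self M]
    · left
      refine ⟨t i, fun h => h i rfl, ?_⟩
      have hne : (𝓝[≠] (t i)).NeBot := inferInstance
      apply mem_closure_of_tendsto (f := id) (b := 𝓝[≠] (t i))
      · exact tendsto_id.mono_left nhdsWithin_le_nhds
      · have h1 : ∀ᶠ w in 𝓝[≠] (t i), ‖w - t i‖ < r := by
          apply mem_nhdsWithin_of_mem_nhds
          have : ContinuousAt (fun w => ‖w - t i‖) (t i) := by fun_prop
          exact this.eventually_lt continuousAt_const (by simpa using hr)
        filter_upwards [h1, self_mem_nhdsWithin] with w hw hwne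
        refine ⟨hw, ?_⟩
        intro j hj
        by_cases hij : i = j
        · exact hwne (by rw [hij]; exact hj)
        · have h3 := hr1 i j hij
          simp only [id] at hj
          rw [hj, norm_sub_rev] at hw
          linarith

def Zc (c : ℂ) : Set (ℂ × ℂ) := {q | q.2 ^ 2 = Dp c q.1 ∧ ¬ (q.1 = -1 ∧ q.2 = -1 / 3)}

noncomputable def homeoZc (c : ℂ) : ZZ {c} ≃ₜ Zc c where
  toFun q := ⟨q.1.2, by
    have h := q.2
    have hc : q.1.1 = c := h.1
    refine ⟨?_, h.2.2⟩
    have h2 : q.1.2.2 ^ 2 = Dp q.1.1 q.1.2.1 := h.2.1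
    rw [hc] at h2
    exact h2⟩
  invFun p := ⟨(c, p.1), rfl, p.2.1, p.2.2⟩
  left_inv q := by
    have hc : q.1.1 = c := q.2.1
    apply Subtype.ext
    exact Prod.ext hc.symm rfl
  right_inv p := rfl
  continuous_toFun := by fun_prop
  continuous_invFun := by fun_prop

noncomputable def sq (u : ℂ) : ℂ := u ^ (((2:ℕ) : ℂ)⁻¹)

lemma sq_sq (u : ℂ) : sq u ^ 2 = u := Complex.cpow_nat_inv_pow _ two_ne_zero

lemma sq_cont {u : ℂ} (h : u ∈ Complex.slitPlane) : ContinuousAt sq u := continuousAt_cpow_const h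

lemma continuous_Dpc (c : ℂ) : Continuous (Dp c) := by
  unfold Dp Qp; fun_prop

lemma Dp_m1 (c : ℂ) : Dp c (-1) = 1 / 9 := by norm_num [Dp, Qp]

/-- The branch near the puncture. -/
noncomputable def sig0 (c w : ℂ) : ℂ := -(1 / 3) * sq (9 * Dp c w)

lemma sig0_sq (c w : ℂ) : sig0 c w ^ 2 = Dp c w := by
  rw [sig0, mul_pow, sq_sq]; ring

lemma sig0_m1 (c : ℂ) : sig0 c (-1) = -1 / 3 := by
  rw [sig0, Dp_m1]
  norm_num [sq]

lemma sig0_cont (c : ℂ) : ∃ ρ > 0, ∀ w, ‖w + 1‖ < ρ → ContinuousAt (sig0 c) w := by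
  have hD := continuous_Dpc c
  obtain ⟨G, hG⟩ : ∃ G : ℂ → ℂ, G = fun w => 9 * Dp c w := ⟨_, rfl⟩
  have hGc : Continuous G := by rw [hG]; exact continuous_const.mul hD
  have hG1 : G (-1) = 1 := by
    rw [hG]
    show 9 * Dp c (-1) = 1
    rw [Dp_m1]; norm_num
  have hs : sig0 c = fun w => -(1 / 3) * sq (G w) := by
    rw [hG]; rfl
  have h1 : ∀ᶠ w in 𝓝 (-1 : ℂ), G w ∈ Complex.slitPlane := by
    apply hGc.continuousAt.eventually_mem
    apply Complex.isOpen_slitPlane.mem_nhds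
    rw [hG1]; exact Complex.one_mem_slitPlane
  obtain ⟨ρ, hρ, h⟩ := Metric.eventually_nhds_iff.1 h1
  refine ⟨ρ, hρ, fun w hw => ?_⟩
  have h2 : G w ∈ Complex.slitPlane :=
    h (y := w) (by rw [dist_eq_norm, sub_neg_eq_add]; exact hw)
  rw [hs]
  have h4 : ContinuousAt (fun w => sq (G w)) w :=
    ContinuousAt.comp (g := sq) (f := G) (sq_cont h2) hGc.continuousAt
  exact continuousAt_const.mul h4

/-- Uniform control of the branch near the puncture. -/
lemma sig0_near (c : ℂ) (ε : ℝ) (hε : 0 < ε) : ∃ ρ, 0 < ρ ∧ ρ ≤ min 1 ε ∧ ∀ w, ‖w + 1‖ < ρ →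
    ContinuousAt (sig0 c) w ∧ ‖sig0 c w + 1 / 3‖ < ε := by
  obtain ⟨ρ₁, hρ₁, h1⟩ := sig0_cont c
  have h2 := h1 (-1) (by simpa using hρ₁)
  obtain ⟨ρ₂, hρ₂, h3⟩ := Metric.continuousAt_iff.1 h2 ε hε
  refine ⟨min (min 1 ε) (min ρ₁ ρ₂), by positivity, min_le_left _ _, fun w hw => ?_⟩
  obtain ⟨_, hw1, hw2⟩ : _ ∧ ‖w + 1‖ < ρ₁ ∧ ‖w + 1‖ < ρ₂ := by simpa only [lt_min_iff] using hw
  refine ⟨h1 w hw1, ?_⟩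
  have := h3 (x := w) (by rw [dist_eq_norm, sub_neg_eq_add]; exact hw2)
  rw [dist_eq_norm, sig0_m1] at this
  convert! this using 2
  ring

lemma D_infty {c : ℂ} (hc : c ≠ -16 / 9) : ∃ R, 3 ≤ R ∧ ∀ w, R < ‖w‖ →
    ‖Dp c w - (64 / 9 + 4 * c) * w ^ 4‖ < ‖(64 / 9 + 4 * c) * w ^ 4‖ := by
  have ha := lead_ne hc
  have ha' : 0 < ‖64 / 9 + 4 * c‖ := norm_pos_iff.2 ha
  set C := 2 * ‖64 / 3 + 12 * c‖ + ‖8 + 4 * c‖ + 1 with hC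
  refine ⟨max 3 (C / ‖64 / 9 + 4 * c‖), le_max_left _ _, fun w hw => ?_⟩
  have hw1 : 3 < ‖w‖ := lt_of_le_of_lt (le_max_left _ _) hw
  have hw2 : C / ‖64 / 9 + 4 * c‖ < ‖w‖ := lt_of_le_of_lt (le_max_right _ _) hw
  rw [div_lt_iff₀ ha'] at hw2
  have e : Dp c w - (64 / 9 + 4 * c) * w ^ 4 = (64 / 3 + 12 * c) * w ^ 3 +
      (64 / 3 + 12 * c) * w ^ 2 + (8 + 4 * c) * w + 1 := by
    simp only [Dp, Qp]; ring
  have hle : ‖Dp c w - (64 / 9 + 4 * c) * w ^ 4‖ ≤ C * ‖w‖ ^ 3 := by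
    rw [e]
    have h1 : ‖w‖ ^ 2 ≤ ‖w‖ ^ 3 := pow_le_pow_right₀ (by linarith) (by norm_num)
    have h2 : ‖w‖ ≤ ‖w‖ ^ 3 := le_self_pow₀ (by linarith) (by norm_num)
    have h3 : 1 ≤ ‖w‖ ^ 3 := one_le_pow₀ (by linarith)
    calc _ ≤ ‖(64 / 3 + 12 * c) * w ^ 3‖ + ‖(64 / 3 + 12 * c) * w ^ 2‖ + ‖(8 + 4 * c) * w‖ + ‖(1:ℂ)‖ :=
          norm_add₄_le
      _ = ‖64 / 3 + 12 * c‖ * ‖w‖ ^ 3 + ‖64 / 3 + 12 * c‖ * ‖w‖ ^ 2 + ‖8 + 4 * c‖ * ‖w‖ + 1 := by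
          simp only [norm_mul, norm_pow, norm_one]
      _ ≤ ‖64 / 3 + 12 * c‖ * ‖w‖ ^ 3 + ‖64 / 3 + 12 * c‖ * ‖w‖ ^ 3 + ‖8 + 4 * c‖ * ‖w‖ ^ 3
            + ‖w‖ ^ 3 := by gcongr
      _ = C * ‖w‖ ^ 3 := by rw [hC]; ring
  refine lt_of_le_of_lt hle ?_
  rw [norm_mul, norm_pow]
  have : 0 < ‖w‖ ^ 3 := by positivity
  calc C * ‖w‖ ^ 3 < (‖w‖ * ‖64 / 9 + 4 * c‖) * ‖w‖ ^ 3 := by gcongr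
    _ = _ := by ring

/-- The branch near infinity. -/
noncomputable def sigI (c w : ℂ) : ℂ :=
  sq (64 / 9 + 4 * c) * w ^ 2 * sq (1 + (Dp c w - (64 / 9 + 4 * c) * w ^ 4) / ((64 / 9 + 4 * c) * w ^ 4))

lemma sigI_sq {c w : ℂ} (hc : c ≠ -16 / 9) (hw : w ≠ 0) : sigI c w ^ 2 = Dp c w := by
  have ha := lead_ne hc
  rw [sigI, mul_pow, mul_pow, sq_sq, sq_sq, ← pow_mul]
  set a := 64 / 9 + 4 * c
  field_simp
  ring

lemma sigI_cont {c w : ℂ} (hc : c ≠ -16 / 9) (hw : w ≠ 0)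
    (h : ‖Dp c w - (64 / 9 + 4 * c) * w ^ 4‖ < ‖(64 / 9 + 4 * c) * w ^ 4‖) :
    ContinuousAt (sigI c) w := by
  have ha := lead_ne hc
  have hD := continuous_Dpc c
  have hne : (64 / 9 + 4 * c) * w ^ 4 ≠ 0 := mul_ne_zero ha (pow_ne_zero _ hw)
  unfold sigI
  have h1 : ContinuousAt (fun w => 1 + (Dp c w - (64 / 9 + 4 * c) * w ^ 4) /
      ((64 / 9 + 4 * c) * w ^ 4)) w := by
    apply continuousAt_const.add
    apply ContinuousAt.div
    · fun_prop
    · fun_prop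
    · exact hne
  have h2 : 1 + (Dp c w - (64 / 9 + 4 * c) * w ^ 4) / ((64 / 9 + 4 * c) * w ^ 4)
      ∈ Complex.slitPlane := by
    apply Complex.mem_slitPlane_of_norm_lt_one
    rw [norm_div, div_lt_one (norm_pos_iff.2 hne)]
    exact h
  exact ContinuousAt.mul (by fun_prop) (ContinuousAt.comp
    (f := fun w => 1 + (Dp c w - (64 / 9 + 4 * c) * w ^ 4) /
      ((64 / 9 + 4 * c) * w ^ 4)) (sq_cont h2) h1)

/-- The compact cores of the generic fiber. -/
def core (c : ℂ) (R ρ : ℝ) : Set (ℂ × ℂ) :=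
  {q | q.2 ^ 2 = Dp c q.1 ∧ ‖q.1‖ ≤ R ∧ (ρ ≤ ‖q.1 + 1‖ ∨ 1 / 3 ≤ ‖q.2 + 1 / 3‖)}

lemma core_sub {c : ℂ} {R ρ : ℝ} (hρ : 0 < ρ) : core c R ρ ⊆ Zc c := by
  rintro ⟨w, z⟩ ⟨h1, _, h2⟩
  refine ⟨h1, ?_⟩
  rintro ⟨h3, h4⟩
  simp only at h2 h3 h4
  subst h3 h4
  norm_num at h2
  linarith

lemma core_compact (c : ℂ) (R ρ : ℝ) : IsCompact (core c R ρ) := by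
  have hD := continuous_Dpc c
  obtain ⟨M, hM⟩ := ((isCompact_closedBall (0:ℂ) R).image hD).isBounded.exists_norm_le
  apply ((isCompact_closedBall (0:ℂ) R).prod (isCompact_closedBall (0:ℂ) (|M| + 1))).of_isClosed_subset
  · have h1 : IsClosed {q : ℂ × ℂ | q.2 ^ 2 = Dp c q.1} := isClosed_eq (by fun_prop) (by fun_prop)
    have h2 : IsClosed {q : ℂ × ℂ | ‖q.1‖ ≤ R} := isClosed_le (by fun_prop) (by fun_prop)
    have h3 : IsClosed {q : ℂ × ℂ | ρ ≤ ‖q.1 + 1‖} := isClosed_le (by fun_prop) (by fun_prop)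
    have h4 : IsClosed {q : ℂ × ℂ | 1 / 3 ≤ ‖q.2 + 1 / 3‖} :=
      isClosed_le (by fun_prop) (by fun_prop)
    exact h1.inter (h2.inter (h3.union h4))
  · rintro ⟨w, z⟩ ⟨h1, h2, _⟩
    simp only at h1 h2
    have hw : w ∈ Metric.closedBall (0:ℂ) R := by simpa using h2
    refine ⟨hw, ?_⟩
    have := hM _ ⟨w, hw, rfl⟩
    rw [← h1, norm_pow] at this
    simp only [mem_closedBall_zero_iff]
    nlinarith [le_abs_self M, abs_nonneg M, norm_nonneg z]

lemma near_eq {c w z : ℂ} (h : z ^ 2 = Dp c w) (h1 : ‖z + 1 / 3‖ < 1 / 3)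
    (h2 : ‖sig0 c w + 1 / 3‖ < 1 / 3) : z = sig0 c w := by
  rw [← sig0_sq] at h
  rcases sq_eq_sq_iff_eq_or_eq_neg.1 h with h | h
  · exact h
  · exfalso
    have h3 := norm_add_le (z + 1 / 3) (sig0 c w + 1 / 3)
    rw [h] at h3 h1
    have : -sig0 c w + 1 / 3 + (sig0 c w + 1 / 3) = 2 / 3 := by ring
    rw [this] at h3
    norm_num at h3 h1 h2
    linarith

lemma endsLE_three {c : ℂ} (hc : c ≠ -16 / 9) : EndsLE (Zc c) (Option Bool) := by
  apply EndsLE.mk_subset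
  intro A hA hAS
  have hpA : ((-1, -1 / 3) : ℂ × ℂ) ∉ A := fun h => (hAS h).2 ⟨rfl, rfl⟩
  obtain ⟨ε, hε, hball⟩ := Metric.isOpen_iff.1 hA.isClosed.isOpen_compl _ hpA
  obtain ⟨R₁, hR₁⟩ := hA.isBounded.exists_norm_le
  obtain ⟨R₀, hR₀, hinf⟩ := D_infty hc
  obtain ⟨ρ, hρ, hρ1, hs⟩ := sig0_near c (min ε (1 / 3)) (by positivity)
  set R := max R₀ R₁
  have hRR : R₀ ≤ R := le_max_left _ _
  have hnz : ∀ w : ℂ, R < ‖w‖ → w ≠ 0 := by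
    rintro w hw rfl
    rw [norm_zero] at hw; linarith
  have hm1 : ∀ w : ℂ, R < ‖w‖ → w ≠ -1 := by
    rintro w hw rfl
    rw [norm_neg, norm_one] at hw; linarith
  have hAw : ∀ w z : ℂ, R < ‖w‖ → (w, z) ∉ A := by
    intro w z hw h
    have h1 := hR₁ _ h
    have h2 : ‖w‖ ≤ ‖(w, z)‖ := norm_fst_le (w, z)
    have := le_max_right R₀ R₁
    linarith
  have hcI : ContinuousOn (sigI c) {w : ℂ | R < ‖w - 0‖} := by
    intro w hw
    have hw : R < ‖w‖ := by simpa using hw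
    exact (sigI_cont hc (hnz w hw) (hinf w (by linarith))).continuousWithinAt
  have hR0 : 0 < R := by linarith
  refine ⟨core c R ρ, fun o => match o with
    | none => (fun w => (w, sig0 c w)) '' {w : ℂ | w ≠ -1 ∧ ‖w - -1‖ < ρ}
    | some true => (fun w => (w, sigI c w)) '' {w : ℂ | R < ‖w - 0‖}
    | some false => (fun w => (w, - sigI c w)) '' {w : ℂ | R < ‖w - 0‖},
    core_compact c R ρ, core_sub hρ, ?_, ?_, ?_⟩
  · rintro (_ | _ | _)
    · apply (preconn_punct (-1) hρ).image
      intro w hw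
      have : ContinuousAt (sig0 c) w := (hs w (by simpa using hw.2)).1
      exact (continuousAt_id.prodMk this).continuousWithinAt
    · exact (preconn_out 0 hR0).image _ (continuousOn_id.prodMk hcI.neg)
    · exact (preconn_out 0 hR0).image _ (continuousOn_id.prodMk hcI)
  · rintro (_ | _ | _)
    · rintro _ ⟨w, ⟨hw1, hw2⟩, rfl⟩
      refine ⟨⟨sig0_sq c w, fun h => hw1 h.1⟩, ?_⟩
      have h3 := (hs w (by simpa using hw2)).2
      apply hball
      rw [Metric.mem_ball, Prod.dist_eq]
      apply max_lt
      · have h4 : ρ ≤ ε := hρ1.trans ((min_le_right _ _).trans (min_le_left _ _))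
        rw [dist_eq_norm]
        exact lt_of_lt_of_le hw2 h4
      · rw [dist_eq_norm]
        refine lt_of_le_of_lt (le_of_eq ?_) (lt_of_lt_of_le h3 (min_le_left _ _))
        congr 1
        ring
    · rintro _ ⟨w, hw, rfl⟩
      have hw : R < ‖w‖ := by simpa using hw
      refine ⟨⟨?_, fun h => hm1 w hw h.1⟩, hAw _ _ hw⟩
      simp only [neg_sq]
      exact sigI_sq hc (hnz w hw)
    · rintro _ ⟨w, hw, rfl⟩
      have hw : R < ‖w‖ := by simpa using hw
      exact ⟨⟨sigI_sq hc (hnz w hw), fun h => hm1 w hw h.1⟩, hAw _ _ hw⟩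
  · rintro ⟨w, z⟩ ⟨hz, hne⟩ hcore
    simp only at hz hne
    by_cases hw : R < ‖w‖
    · have h1 := sigI_sq hc (hnz w hw)
      rw [← h1] at hz
      rcases sq_eq_sq_iff_eq_or_eq_neg.1 hz with h | h
      · exact ⟨some true, w, by simpa using hw, by rw [h]⟩
      · exact ⟨some false, w, by simpa using hw, by rw [h]⟩
    · refine ⟨none, w, ?_, ?_⟩
      all_goals
        by_cases h : ρ ≤ ‖w + 1‖ ∨ 1 / 3 ≤ ‖z + 1 / 3‖
        · exact absurd ⟨hz, not_lt.1 hw, h⟩ hcore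
        push Not at h
        have hzz := near_eq hz h.2 (lt_of_lt_of_le (hs w h.1).2 (min_le_right _ _))
      · refine ⟨?_, by simpa using h.1⟩
        rintro rfl
        exact hne ⟨rfl, by rw [hzz, sig0_m1]⟩
      · rw [hzz]

lemma endsGE_three {c : ℂ} (hc : c ≠ -16 / 9) : EndsGE (Zc c) (Option Bool) := by
  have hD := continuous_Dpc c
  obtain ⟨R, hR, hinf⟩ := D_infty hc
  obtain ⟨ρ, hρ, hρ1, hs⟩ := sig0_near c (1 / 3) (by positivity)
  have hnz : ∀ w : ℂ, R < ‖w‖ → w ≠ 0 := by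
    rintro w hw rfl
    rw [norm_zero] at hw; linarith
  have hm1 : ∀ w : ℂ, R < ‖w‖ → w ≠ -1 := by
    rintro w hw rfl
    rw [norm_neg, norm_one] at hw; linarith
  have hb2 : sq (64 / 9 + 4 * c) ^ 2 = 64 / 9 + 4 * c := sq_sq _
  set b := sq (64 / 9 + 4 * c)
  have hcov : ∀ w z : ℂ, R < ‖w‖ → z ^ 2 = Dp c w →
      ‖z - b * w ^ 2‖ < ‖b * w ^ 2‖ ∨ ‖z + b * w ^ 2‖ < ‖b * w ^ 2‖ := by
    intro w z hw hz
    by_contra! h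
    have h1 := hinf w hw
    rw [← hz, ← hb2] at h1
    have e1 : z ^ 2 - b ^ 2 * w ^ 4 = (z - b * w ^ 2) * (z + b * w ^ 2) := by ring
    have e2 : b ^ 2 * w ^ 4 = (b * w ^ 2) * (b * w ^ 2) := by ring
    rw [e1, e2, norm_mul, norm_mul] at h1
    have := mul_le_mul h.1 h.2 (norm_nonneg _) (norm_nonneg _)
    linarith
  have hdis : ∀ w z : ℂ, ‖z - b * w ^ 2‖ < ‖b * w ^ 2‖ → ‖z + b * w ^ 2‖ < ‖b * w ^ 2‖ → False := by
    intro w z h1 h2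
    have h3 := norm_sub_le (z + b * w ^ 2) (z - b * w ^ 2)
    have e : (z + b * w ^ 2) - (z - b * w ^ 2) = 2 * (b * w ^ 2) := by ring
    rw [e, norm_mul, Complex.norm_ofNat] at h3
    linarith
  have hfar : ∀ w : ℂ, ‖w + 1‖ < ρ → ¬ R < ‖w‖ := by
    intro w h1 h2
    have := norm_sub_norm_le w (-1)
    rw [sub_neg_eq_add, norm_neg, norm_one] at this
    have := hρ1.trans (min_le_left _ _)
    linarith
  have hpt : ∀ M : ℝ, ∃ w : ℂ, R < ‖w‖ ∧ M < ‖w‖ := by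
    intro M
    refine ⟨((|M| + R + 1 : ℝ) : ℂ), ?_⟩
    rw [Complex.norm_real, Real.norm_eq_abs, abs_of_pos (by positivity)]
    constructor
    · linarith [abs_nonneg M]
    · linarith [le_abs_self M]
  apply EndsGE.mk_subset _ (core c R ρ) (fun o => match o with
    | none => {q : ℂ × ℂ | ‖q.1 + 1‖ < ρ ∧ ‖q.2 + 1 / 3‖ < 1 / 3}
    | some true => {q : ℂ × ℂ | R < ‖q.1‖ ∧ ‖q.2 - b * q.1 ^ 2‖ < ‖b * q.1 ^ 2‖}
    | some false => {q : ℂ × ℂ | R < ‖q.1‖ ∧ ‖q.2 + b * q.1 ^ 2‖ < ‖b * q.1 ^ 2‖})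
    (core_compact c R ρ) (core_sub hρ)
  · rintro (_ | _ | _)
    · have h1 : IsOpen {q : ℂ × ℂ | ‖q.1 + 1‖ < ρ} := isOpen_lt (by fun_prop) (by fun_prop)
      have h2 : IsOpen {q : ℂ × ℂ | ‖q.2 + 1 / 3‖ < 1 / 3} :=
        isOpen_lt (by fun_prop) (by fun_prop)
      exact h1.inter h2
    · have h1 : IsOpen {q : ℂ × ℂ | R < ‖q.1‖} := isOpen_lt (by fun_prop) (by fun_prop)
      have h2 : IsOpen {q : ℂ × ℂ | ‖q.2 + b * q.1 ^ 2‖ < ‖b * q.1 ^ 2‖} :=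
        isOpen_lt (by fun_prop) (by fun_prop)
      exact h1.inter h2
    · have h1 : IsOpen {q : ℂ × ℂ | R < ‖q.1‖} := isOpen_lt (by fun_prop) (by fun_prop)
      have h2 : IsOpen {q : ℂ × ℂ | ‖q.2 - b * q.1 ^ 2‖ < ‖b * q.1 ^ 2‖} :=
        isOpen_lt (by fun_prop) (by fun_prop)
      exact h1.inter h2
  · rintro (_ | _ | _) (_ | _ | _) hij ⟨w, z⟩ _ ⟨h1, h2⟩ ⟨h3, h4⟩
    · exact hij rfl
    · exact hfar w h1 h3
    · exact hfar w h1 h3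
    · exact hfar w h3 h1
    · exact hij rfl
    · exact hdis w z h4 h2
    · exact hfar w h3 h1
    · exact hdis w z h2 h4
    · exact hij rfl
  · rintro ⟨w, z⟩ ⟨hz, hne⟩ hcore
    simp only at hz hne
    by_cases hw : R < ‖w‖
    · rcases hcov w z hw hz with h | h
      · exact ⟨some true, hw, h⟩
      · exact ⟨some false, hw, h⟩
    · refine ⟨none, ?_⟩
      by_contra h
      apply hcore
      refine ⟨hz, not_lt.1 hw, ?_⟩
      by_contra! h2
      exact h h2
  · have hle : ∀ w z : ℂ, ‖w‖ ≤ ‖(w, z)‖ := fun w z => norm_fst_le (w, z)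
    rintro (_ | _ | _)
    · left
      refine ⟨(-1, -1 / 3), fun h => h.2 ⟨rfl, rfl⟩, ?_⟩
      have hc1 := (hs (-1) (by simpa using hρ)).1
      have ht : Tendsto (fun w => (w, sig0 c w)) (𝓝[≠] (-1)) (𝓝 (-1, -1 / 3)) := by
        have : ContinuousAt (fun w => (w, sig0 c w)) (-1) := continuousAt_id.prodMk hc1
        have := this.tendsto
        rw [sig0_m1] at this
        exact this.mono_left nhdsWithin_le_nhds
      apply mem_closure_of_tendsto ht
      have h1 : ∀ᶠ w : ℂ in 𝓝[≠] (-1), ‖w + 1‖ < ρ := by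
        apply mem_nhdsWithin_of_mem_nhds
        have : ContinuousAt (fun w : ℂ => ‖w + 1‖) (-1) := by fun_prop
        exact this.eventually_lt continuousAt_const (by simpa using hρ)
      filter_upwards [h1, self_mem_nhdsWithin] with w hw hwne
      exact ⟨⟨hw, (hs w hw).2⟩, sig0_sq c w, fun h => hwne h.1⟩
    · right
      intro M
      obtain ⟨w, h1, h2⟩ := hpt M
      have h3 := sigI_sq hc (hnz w h1)
      have h3' : (- sigI c w) ^ 2 = Dp c w := by rw [neg_sq, h3]
      rcases hcov w _ h1 h3 with h | h
      · refine ⟨(w, - sigI c w), ⟨⟨h1, ?_⟩, h3', fun h => hm1 w h1 h.1⟩, h2.trans_le (hle _ _)⟩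
        rw [← norm_neg] at h
        convert! h using 2
        simp only; ring
      · exact ⟨(w, sigI c w), ⟨⟨h1, h⟩, h3, fun h => hm1 w h1 h.1⟩, h2.trans_le (hle _ _)⟩
    · right
      intro M
      obtain ⟨w, h1, h2⟩ := hpt M
      have h3 := sigI_sq hc (hnz w h1)
      have h3' : (- sigI c w) ^ 2 = Dp c w := by rw [neg_sq, h3]
      rcases hcov w _ h1 h3 with h | h
      · exact ⟨(w, sigI c w), ⟨⟨h1, h⟩, h3, fun h => hm1 w h1 h.1⟩, h2.trans_le (hle _ _)⟩
      · refine ⟨(w, - sigI c w), ⟨⟨h1, ?_⟩, h3', fun h => hm1 w h1 h.1⟩, h2.trans_le (hle _ _)⟩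
        rw [← norm_neg] at h
        convert! h using 2
        simp only; ring

/-- The special fiber over `-16/9` is a punctured plane. -/
noncomputable def homeoS : ZZ {(-16 / 9 : ℂ)} ≃ₜ ({z : ℂ | z ≠ -1 / 3} : Set ℂ) where
  toFun q := ⟨q.1.2.2, by
    obtain ⟨⟨c, w, z⟩, h1, h2, h3⟩ := q
    have h1 : c = -16 / 9 := h1
    subst h1
    rintro h
    simp only [Dp, Qp] at h2 h3 h
    refine h3 ⟨?_, h⟩
    rw [h] at h2
    linear_combination (-9/8 : ℂ) * h2⟩
  invFun z := ⟨(-16 / 9, 9 / 8 * (z.1 ^ 2 - 1), z.1), rfl, by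
    simp only [Dp, Qp]; ring, fun h => z.2 h.2⟩
  left_inv := by
    rintro ⟨⟨c, w, z⟩, h1, h2, h3⟩
    have h1 : c = -16 / 9 := h1
    subst h1
    apply Subtype.ext
    refine Prod.ext rfl (Prod.ext ?_ rfl)
    simp only [Dp, Qp] at h2 ⊢
    linear_combination (9/8 : ℂ) * h2
  right_inv z := rfl
  continuous_toFun := by fun_prop
  continuous_invFun := by fun_prop

lemma EE_zero_Q {x w : ℂ} (h : ((0:ℂ), x, w) ∈ EE) : Qp w ≠ 0 ∧ w ≠ -1 := by
  obtain ⟨h1, h2⟩ := h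
  simp only at h1 h2
  constructor
  · intro hQ
    rw [hQ] at h1
    have h3 : w * (w + 1) ^ 3 = 0 := by linear_combination -h1
    rcases mul_eq_zero.1 h3 with h | h
    · subst h; simp [Qp] at hQ
    · have : w = -1 := by linear_combination (pow_eq_zero_iff (three_ne_zero)).1 h
      subst this
      norm_num [Qp] at hQ
  · intro hw
    refine h2 ⟨?_, hw⟩
    subst hw
    simp only [Qp] at h1
    linear_combination (-3 : ℂ) * h1

lemma EE_zero_mem {w : ℂ} (h : Qp w ≠ 0) (h' : w ≠ -1) :
    ((0:ℂ), w * (w + 1) ^ 3 / Qp w, w) ∈ EE := by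
  constructor
  · simp only; field_simp; ring
  · exact fun h2 => h' h2.2

noncomputable def homeo0 : ((fun p : ℂ × ℂ => briancon p.1 p.2) ⁻¹' {0}) ≃ₜ
    ({w : ℂ | Qp w ≠ 0 ∧ w ≠ -1} : Set ℂ) where
  toFun p := ⟨p.1.1 * (1 + p.1.1 * p.1.2), by
    have h := mem_EE p.1.1 p.1.2
    have h0 : briancon p.1.1 p.1.2 = 0 := p.2
    rw [h0] at h
    exact EE_zero_Q h⟩
  invFun w := ⟨(w.1 * (w.1 + 1) ^ 3 / Qp w.1, YY (0, w.1 * (w.1 + 1) ^ 3 / Qp w.1, w.1)),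
    briancon_YY (EE_zero_mem w.2.1 w.2.2)⟩
  left_inv p := by
    obtain ⟨⟨x, y⟩, h0⟩ := p
    have h0 : briancon x y = 0 := h0
    have h := mem_EE x y
    have hY := YY_eq x y
    rw [h0] at h hY
    have hQ := EE_zero_Q h
    have hx : x * (1 + x * y) * (x * (1 + x * y) + 1) ^ 3 / Qp (x * (1 + x * y)) = x := by
      have := h.1
      simp only at this
      rw [div_eq_iff hQ.1]
      linear_combination -this
    apply Subtype.ext
    simp only [hx, hY]
  right_inv w := Subtype.ext (w_YY (EE_zero_mem w.2.1 w.2.2))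
  continuous_toFun := by fun_prop
  continuous_invFun := by
    have hQ := continuous_Qp
    have hx : Continuous (fun w : ({w : ℂ | Qp w ≠ 0 ∧ w ≠ -1} : Set ℂ) =>
        w.1 * (w.1 + 1) ^ 3 / Qp w.1) := by
      apply Continuous.div
      · fun_prop
      · fun_prop
      · exact fun w => w.2.1
    apply Continuous.subtype_mk
    apply hx.prodMk
    apply continuousOn_YY.comp_continuous
    · fun_prop
    · exact fun w => EE_zero_mem w.2.1 w.2.2

lemma endsGE_zero : EndsGE ({w : ℂ | Qp w ≠ 0 ∧ w ≠ -1} : Set ℂ) (Option (Fin 3)) := by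
  have h3 : ((Real.sqrt 3 : ℝ) : ℂ) ^ 2 = 3 := by
    rw [← Complex.ofReal_pow, Real.sq_sqrt (by norm_num)]; norm_num
  set t : ℂ := ((Real.sqrt 3 : ℝ) : ℂ)
  have ht0 : t ≠ 0 := by intro h; rw [h] at h3; norm_num at h3
  have ht1 : t ≠ 1 := by intro h; rw [h] at h3; norm_num at h3
  have ht2 : t ≠ -1 := by intro h; rw [h] at h3; norm_num at h3
  have hQ : ∀ w, Qp w = 8 / 3 * ((w - (-3 + t) / 4) * (w - (-3 - t) / 4)) := by
    intro w
    simp only [Qp]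
    linear_combination (1 / 6 : ℂ) * h3
  have hset : {w : ℂ | Qp w ≠ 0 ∧ w ≠ -1} =
      {w : ℂ | ∀ i, w ≠ ![(-3 + t) / 4, (-3 - t) / 4, -1] i} := by
    ext w
    simp only [mem_ofPred_eq, Fin.forall_fin_succ, hQ]
    simp [sub_eq_zero, and_assoc]
  rw [hset]
  apply endsGE_plane
  have n1 : (-3 + t) / 4 ≠ (-3 - t) / 4 := fun h => ht0 (by linear_combination 2 * h)
  have n2 : (-3 + t) / 4 ≠ -1 := fun h => ht2 (by linear_combination 4 * h)
  have n3 : (-3 - t) / 4 ≠ -1 := fun h => ht1 (by linear_combination -4 * h)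
  intro i j hij
  fin_cases i <;> fin_cases j <;> simp_all [n1, n2, n3, n1.symm, n2.symm, n3.symm]

theorem irr_zero : ¬ IsRegularValue (fun p => briancon p.1 p.2) 0 := by
  intro h
  have h1 := fiber_homeo h
  have h2 : ∀ᶠ c : ℂ in 𝓝[≠] 0, Nonempty (((fun p : ℂ × ℂ => briancon p.1 p.2) ⁻¹' {c}) ≃ₜ
      ((fun p : ℂ × ℂ => briancon p.1 p.2) ⁻¹' {0})) := mem_nhdsWithin_of_mem_nhds h1
  have h3 : ∀ᶠ c : ℂ in 𝓝[≠] 0, c ≠ 0 := self_mem_nhdsWithin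
  have h4 : ∀ᶠ c : ℂ in 𝓝[≠] 0, c ≠ -16 / 9 :=
    mem_nhdsWithin_of_mem_nhds (isOpen_ne.mem_nhds (by norm_num))
  obtain ⟨c, ⟨e⟩, hc0, hc⟩ := (h2.and (h3.and h4)).exists
  have h0c : (0:ℂ) ∉ ({c} : Set ℂ) := fun h => hc0 (by simpa using h.symm)
  have g1 : EndsGE (Zc c) (Option (Fin 3)) :=
    endsGE_zero.congr (homeo0.symm.trans (e.symm.trans ((homeoZZ {c} h0c).trans (homeoZc c))))
  exact ends_false (by simp) g1 (endsLE_three hc)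

theorem irr_s : ¬ IsRegularValue (fun p => briancon p.1 p.2) (-16 / 9) := by
  intro h
  have h1 := fiber_homeo h
  have h2 : ∀ᶠ c : ℂ in 𝓝[≠] (-16 / 9),
      Nonempty (((fun p : ℂ × ℂ => briancon p.1 p.2) ⁻¹' {c}) ≃ₜ
      ((fun p : ℂ × ℂ => briancon p.1 p.2) ⁻¹' {-16 / 9})) := mem_nhdsWithin_of_mem_nhds h1
  have h3 : ∀ᶠ c : ℂ in 𝓝[≠] (-16 / 9), c ≠ -16 / 9 := self_mem_nhdsWithin
  have h4 : ∀ᶠ c : ℂ in 𝓝[≠] (-16 / 9), c ≠ 0 :=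
    mem_nhdsWithin_of_mem_nhds (isOpen_ne.mem_nhds (by norm_num))
  obtain ⟨c, ⟨e⟩, hc, hc0⟩ := (h2.and (h3.and h4)).exists
  have h0c : (0:ℂ) ∉ ({c} : Set ℂ) := fun h => hc0 (by simpa using h.symm)
  have h0s : (0:ℂ) ∉ ({-16 / 9} : Set ℂ) := fun h => by
    have : (0:ℂ) = -16 / 9 := h
    norm_num at this
  have g1 : EndsGE ({z : ℂ | z ≠ -1 / 3} : Set ℂ) (Option Bool) :=
    (endsGE_three hc).congr ((homeoZc c).symm.trans ((homeoZZ {c} h0c).symm.trans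
      (e.trans ((homeoZZ _ h0s).trans homeoS))))
  exact ends_false (by simp) g1 (endsLE_two _)


end Bri

/-- The set of irregular values of the Briançon polynomial is exactly `{0, −16/9}`. -/
theorem briancon_irregular_values :
    (∀ c : ℂ, c ≠ 0 → c ≠ -16 / 9 → IsRegularValue (fun p => briancon p.1 p.2) c) ∧
    ¬ IsRegularValue (fun p => briancon p.1 p.2) 0 ∧
    ¬ IsRegularValue (fun p => briancon p.1 p.2) (-16 / 9) := by
  exact ⟨fun _ h0 hc => Bri.regular_of_ne h0 hc, Bri.irr_zero, Bri.irr_s⟩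
end

section
/- For every c ∈ ℂ with c ≠ 0 and c ≠ −16/9, there exist three distinct points p₁, p₂, p₃ of the torus T := (ℝ/ℤ) × (ℝ/ℤ) such that the fiber {(x,y) ∈ ℂ × ℂ : f(x,y) = c} of the Briançon polynomial is homeomorphic to T ∖ {p₁, p₂, p₃}; that is, every regular fiber is a thrice-punctured torus. -/
namespace Briancon

open Topology Filter

/-- The affine hyperelliptic curve with branch points `S`. -/
def Curve (S : Finset ℂ) : Set (ℂ × ℂ) := {p | p.2 ^ 2 = ∏ e ∈ S, (p.1 - e)}

/-- Build a homeomorphism of subsets from maps of the ambient types. -/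
def homeoOf {X Y : Type*} [TopologicalSpace X] [TopologicalSpace Y] (A : Set X) (B : Set Y)
    (f : X → Y) (g : Y → X) (hf : ∀ x ∈ A, f x ∈ B) (hg : ∀ y ∈ B, g y ∈ A)
    (hl : ∀ x ∈ A, g (f x) = x) (hr : ∀ y ∈ B, f (g y) = y)
    (cf : Continuous fun x : A => f x) (cg : Continuous fun y : B => g y) : A ≃ₜ B where
  toFun x := ⟨f x, hf x x.2⟩
  invFun y := ⟨g y, hg y y.2⟩
  left_inv x := Subtype.ext (hl x x.2)
  right_inv y := Subtype.ext (hr y y.2)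
  continuous_toFun := cf.subtype_mk _
  continuous_invFun := cg.subtype_mk _

lemma cont_of_sq {X : Type*} [TopologicalSpace X] {g G : X → ℂ} (hG : Continuous G)
    (h : ∀ x, g x ^ 2 = G x) (hc : ∀ x, G x ≠ 0 → ContinuousAt g x) : Continuous g := by
  rw [continuous_iff_continuousAt]
  intro x
  by_cases hx : G x = 0
  · have hg : g x = 0 := by
      have := h x
      rw [hx] at this
      exact pow_eq_zero_iff (two_ne_zero) |>.1 this
    have hn : ∀ y, ‖g y‖ = Real.sqrt ‖G y‖ := by
      intro y
      rw [← h y, norm_pow, Real.sqrt_sq (norm_nonneg _)]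
    rw [ContinuousAt, hg, tendsto_zero_iff_norm_tendsto_zero]
    have : Continuous fun y => Real.sqrt ‖G y‖ := by fun_prop
    have h2 := this.tendsto x
    simp only [hx, norm_zero, Real.sqrt_zero] at h2
    simpa only [hn] using h2
  · exact hc x hx

lemma curve_homeo (h : ℂ ≃ₜ ℂ) (S : Finset ℂ)
    (hS : ∀ e ∈ S, ∀ z, z ≠ e → (h z - h e) / (z - e) ∈ Complex.slitPlane) :
    Nonempty (Curve S ≃ₜ Curve (S.image h)) := by
  classical
  set σ : ℂ → ℂ := fun t => ∏ e ∈ S, ((h t - h e) / (t - e)) ^ (1 / 2 : ℂ) with hσ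
  have hsq : ∀ z : ℂ, (z ^ (1 / 2 : ℂ)) ^ 2 = z := by
    intro z
    rw [one_div]
    exact_mod_cast Complex.cpow_nat_inv_pow z two_ne_zero
  have hσ2 : ∀ t, σ t ^ 2 = ∏ e ∈ S, ((h t - h e) / (t - e)) := by
    intro t
    simp only [hσ, ← Finset.prod_pow, hsq]
  have hσF : ∀ t, σ t ^ 2 * ∏ e ∈ S, (t - e) = ∏ e ∈ S, (h t - h e) := by
    intro t
    rw [hσ2, ← Finset.prod_mul_distrib]
    refine Finset.prod_congr rfl fun e _ => ?_
    by_cases hte : t = e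
    · simp [hte]
    · rw [div_mul_cancel₀ _ (sub_ne_zero.2 hte)]
  have hσ0 : ∀ t, t ∉ S → σ t ≠ 0 := by
    intro t ht h0
    have := hσF t
    rw [h0] at this
    simp only [ne_eq, OfNat.ofNat_ne_zero, not_false_eq_true, zero_pow, zero_mul] at this
    obtain ⟨e, he, h1⟩ := Finset.prod_eq_zero_iff.1 this.symm
    exact ht (by rwa [h.injective (sub_eq_zero.1 h1)])
  have hσc : ∀ t, t ∉ S → ContinuousAt σ t := by
    intro t ht
    simp only [hσ]
    refine tendsto_finsetProd _ fun e he => ?_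
    have hte : t ≠ e := fun h => ht (h ▸ he)
    have h1 : ContinuousAt (fun t => (h t - h e) / (t - e)) t :=
      ((h.continuous.continuousAt).sub continuousAt_const).div
        (continuousAt_id.sub continuousAt_const) (sub_ne_zero.2 hte)
    exact h1.cpow continuousAt_const (hS e he t hte)
  have hP : ∀ t, ∏ e ∈ S, (t - e) ≠ 0 ↔ t ∉ S := by
    intro t
    rw [Finset.prod_ne_zero_iff]
    constructor
    · intro hh ht
      exact hh t ht (sub_self t)
    · intro ht e he h0
      exact ht (sub_eq_zero.1 h0 ▸ he)
  have hI : ∀ t', ∏ e ∈ S.image h, (t' - e) = ∏ e ∈ S, (t' - h e) := fun t' =>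
    Finset.prod_image (fun a _ b _ hab => h.injective hab)
  have hF : Continuous (fun x : Curve S => ((h x.1.1, x.1.2 * σ x.1.1) : ℂ × ℂ)) := by
    refine Continuous.prodMk (by fun_prop) ?_
    refine cont_of_sq (G := fun x : Curve S => ∏ e ∈ S, (h x.1.1 - h e)) (by fun_prop) ?_ ?_
    · intro x
      rw [mul_pow, x.2, mul_comm, hσF]
    · intro x hx
      have hxS : x.1.1 ∉ S := by
        intro hxS
        exact hx (Finset.prod_eq_zero hxS (sub_self _))
      refine ContinuousAt.mul (by fun_prop) ?_
      exact ContinuousAt.comp (f := fun x : Curve S => x.1.1) (hσc _ hxS) (by fun_prop)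
  have hB : Continuous (fun x : Curve (S.image h) =>
      ((h.symm x.1.1, x.1.2 / σ (h.symm x.1.1)) : ℂ × ℂ)) := by
    refine Continuous.prodMk (by fun_prop) ?_
    refine cont_of_sq (G := fun x : Curve (S.image h) => ∏ e ∈ S, (h.symm x.1.1 - e))
      (by fun_prop) ?_ ?_
    · intro x
      have h1 := hσF (h.symm x.1.1)
      rw [div_pow, x.2, hI]
      by_cases hm : h.symm x.1.1 ∈ S
      · rw [Finset.prod_eq_zero hm, Finset.prod_eq_zero hm (sub_self _), zero_div]
        simp
      · rw [h.apply_symm_apply] at h1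
        rw [← h1, mul_div_cancel_left₀]
        exact pow_ne_zero _ (hσ0 _ hm)
    · intro x hx
      rw [hP] at hx
      refine ContinuousAt.div (by fun_prop) ?_ (hσ0 _ hx)
      exact ContinuousAt.comp (f := fun x : Curve (S.image h) => h.symm x.1.1)
        (hσc _ hx) (by fun_prop)
  have hz : ∀ x : ℂ × ℂ, x ∈ Curve S → x.1 ∈ S → x.2 = 0 := by
    intro x hx hxS
    have h1 : x.2 ^ 2 = ∏ e ∈ S, (x.1 - e) := hx
    rw [Finset.prod_eq_zero hxS (sub_self _)] at h1
    exact pow_eq_zero_iff (two_ne_zero) |>.1 h1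
  refine ⟨homeoOf _ _ (fun x => (h x.1, x.2 * σ x.1)) (fun x => (h.symm x.1, x.2 / σ (h.symm x.1)))
    ?_ ?_ ?_ ?_ hF hB⟩
  · intro x hx
    have hx' : x.2 ^ 2 = ∏ e ∈ S, (x.1 - e) := hx
    change (x.2 * σ x.1) ^ 2 = ∏ e ∈ S.image h, (h x.1 - e)
    rw [mul_pow, hx', mul_comm, hσF, hI]
  · intro x hx
    have hx' : x.2 ^ 2 = ∏ e ∈ S.image h, (x.1 - e) := hx
    change (x.2 / σ (h.symm x.1)) ^ 2 = ∏ e ∈ S, (h.symm x.1 - e)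
    have h1 := hσF (h.symm x.1)
    rw [div_pow, hx', hI]
    by_cases hm : h.symm x.1 ∈ S
    · rw [Finset.prod_eq_zero hm, Finset.prod_eq_zero hm (sub_self _), zero_div]
      simp
    · rw [h.apply_symm_apply] at h1
      rw [← h1, mul_div_cancel_left₀]
      exact pow_ne_zero _ (hσ0 _ hm)
  · intro x hx
    simp only [Homeomorph.symm_apply_apply]
    refine Prod.ext rfl ?_
    change x.2 * σ x.1 / σ x.1 = x.2
    by_cases hm : x.1 ∈ S
    · rw [hz _ hx hm]; simp
    · exact mul_div_cancel_right₀ _ (hσ0 _ hm)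
  · intro x hx
    simp only [Homeomorph.apply_symm_apply]
    refine Prod.ext rfl ?_
    change x.2 / σ (h.symm x.1) * σ (h.symm x.1) = x.2
    by_cases hm : h.symm x.1 ∈ S
    · have h1 : x.2 ^ 2 = ∏ e ∈ S.image h, (x.1 - e) := hx
      rw [hI, Finset.prod_eq_zero hm (by simp)] at h1
      rw [pow_eq_zero_iff (two_ne_zero) |>.1 h1]; simp
    · exact div_mul_cancel₀ _ (hσ0 _ hm)

lemma small_move (S : Finset ℂ) (a : ℂ) (ha : a ∉ S) :
    ∃ ε > 0, ∀ b, dist b a < ε →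
      Nonempty (Curve (insert a S) ≃ₜ Curve (insert b S)) := by
  classical
  have hop : (↑S : Set ℂ)ᶜ ∈ 𝓝 a := S.finite_toSet.isClosed.isOpen_compl.mem_nhds (by simpa using ha)
  obtain ⟨r, hr, hball⟩ := Metric.mem_nhds_iff.1 hop
  refine ⟨r, hr, fun b hb => ?_⟩
  set φ : ℂ → ℝ := fun z => max 0 (1 - ‖z - a‖ / r) with hφ
  set f : ℂ → ℂ := fun z => z + (b - a) * (φ z : ℂ) with hf
  set k : NNReal := ⟨‖b - a‖ / r, by positivity⟩ with hk
  have hk1 : k < 1 := by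
    rw [← NNReal.coe_lt_coe]
    change ‖b - a‖ / r < 1
    rw [div_lt_one hr, ← dist_eq_norm]
    exact hb
  have hφL : ∀ x y, |φ x - φ y| ≤ ‖x - y‖ / r := by
    intro x y
    simp only [hφ]
    rw [max_comm 0, max_comm 0]
    refine (abs_max_sub_max_le_abs _ _ _).trans ?_
    · have : (1 - ‖x - a‖ / r) - (1 - ‖y - a‖ / r) = (‖y - a‖ - ‖x - a‖) / r := by ring
      rw [this, abs_div, abs_of_pos hr]
      gcongr
      refine (abs_norm_sub_norm_le _ _).trans ?_
      rw [norm_sub_rev x y]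
      simp
  have happ : ∀ x y, ‖f x - f y - (x - y)‖ ≤ k * ‖x - y‖ := by
    intro x y
    have : f x - f y - (x - y) = (b - a) * ((φ x - φ y : ℝ) : ℂ) := by
      simp only [hf]; push_cast; ring
    rw [this, norm_mul, Complex.norm_real, Real.norm_eq_abs]
    change _ ≤ ‖b - a‖ / r * ‖x - y‖
    calc ‖b - a‖ * |φ x - φ y| ≤ ‖b - a‖ * (‖x - y‖ / r) := by gcongr; exact hφL x y
      _ = _ := by ring
  have hA : ApproximatesLinearOn f ((ContinuousLinearEquiv.refl ℂ ℂ : ℂ ≃L[ℂ] ℂ) : ℂ →L[ℂ] ℂ)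
      Set.univ k := by
    intro x _ y _
    simpa using happ x y
  let h : ℂ ≃ₜ ℂ := hA.toHomeomorph f (Or.inr (by
    have : ‖(((ContinuousLinearEquiv.refl ℂ ℂ).symm : ℂ ≃L[ℂ] ℂ) : ℂ →L[ℂ] ℂ)‖₊ = 1 := by
      simp
    rw [this]
    simpa using hk1))
  have hh : ∀ z, h z = f z := fun z => rfl
  have hS : ∀ e ∈ insert a S, ∀ z, z ≠ e → (h z - h e) / (z - e) ∈ Complex.slitPlane := by
    intro e _ z hz
    have hze := sub_ne_zero.2 hz
    left
    rw [hh, hh]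
    have h1 : ‖(f z - f e) / (z - e) - 1‖ < 1 := by
      rw [div_sub_one hze, norm_div, div_lt_one (norm_pos_iff.2 hze)]
      refine (happ z e).trans_lt ?_
      have : (k : ℝ) < 1 := by exact_mod_cast hk1
      nlinarith [norm_pos_iff.2 hze]
    have h2 := (Complex.abs_re_le_norm _).trans_lt h1
    rw [abs_lt] at h2
    simp only [Complex.sub_re, Complex.one_re] at h2
    linarith [h2.1]
  have himg : (insert a S).image h = insert b S := by
    rw [Finset.image_insert]
    congr 1
    · rw [hh]; simp [hf, hφ]
    · conv_rhs => rw [← Finset.image_id (s := S)]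
      refine Finset.image_congr fun e he => ?_
      have : e ∉ Metric.ball a r := fun hm => hball hm he
      rw [Metric.mem_ball, not_lt, dist_eq_norm] at this
      have h0 : φ e = 0 := by
        simp only [hφ]
        rw [max_eq_left]
        rw [sub_nonpos, one_le_div hr]; exact this
      rw [hh]; simp [hf, h0]
  have := curve_homeo h _ hS
  rwa [himg] at this

lemma swap_one (S : Finset ℂ) (a b : ℂ) (ha : a ∉ S) (hb : b ∉ S) :
    Nonempty (Curve (insert a S) ≃ₜ Curve (insert b S)) := by
  have hc : IsPreconnected ((↑S : Set ℂ)ᶜ) :=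
    (S.countable_toSet.isConnected_compl_of_one_lt_rank (by simp)).isPreconnected
  refine hc.induction₂ (fun a b => Nonempty (Curve (insert a S) ≃ₜ Curve (insert b S))) ?_ ?_ ?_
    (by simpa using ha) (by simpa using hb)
  · intro x hx
    obtain ⟨ε, hε, h⟩ := small_move S x (by simpa using hx)
    exact mem_nhdsWithin_of_mem_nhds (Filter.mem_of_superset (Metric.ball_mem_nhds x hε) h)
  · rintro x y z _ _ _ ⟨h1⟩ ⟨h2⟩
    exact ⟨h1.trans h2⟩
  · rintro x y _ _ ⟨h1⟩
    exact ⟨h1.symm⟩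

lemma curve_card (n : ℕ) : ∀ (S D : Finset ℂ), S.card = D.card → (D \ S).card = n →
    Nonempty (Curve S ≃ₜ Curve D) := by
  induction n with
  | zero =>
    intro S D h h0
    have h1 : D ⊆ S := by
      rw [Finset.card_eq_zero, Finset.sdiff_eq_empty_iff_subset] at h0; exact h0
    rw [Finset.eq_of_subset_of_card_le h1 h.le]
    exact ⟨Homeomorph.refl _⟩
  | succ n ih =>
    intro S D h hn
    have hn' : (S \ D).card = n + 1 := by rw [Finset.card_sdiff_comm h, hn]
    obtain ⟨d, hd⟩ := Finset.card_pos.1 (by omega : 0 < (D \ S).card)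
    obtain ⟨e, he⟩ := Finset.card_pos.1 (by omega : 0 < (S \ D).card)
    rw [Finset.mem_sdiff] at hd he
    have hde : d ∉ S.erase e := fun h => hd.2 (Finset.mem_of_mem_erase h)
    obtain ⟨H⟩ := swap_one (S.erase e) e d (by simp) hde
    rw [Finset.insert_erase he.1] at H
    obtain ⟨H'⟩ := ih (insert d (S.erase e)) D
      (by rw [Finset.card_insert_of_notMem hde, Finset.card_erase_of_mem he.1, ← h]
          have := Finset.card_pos.2 ⟨e, he.1⟩; omega)
      (by
        have : D \ insert d (S.erase e) = (D \ S).erase d := by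
          ext x
          simp only [Finset.mem_sdiff, Finset.mem_insert, Finset.mem_erase]
          constructor
          · rintro ⟨hx, h1⟩
            push Not at h1
            refine ⟨h1.1, hx, fun hxS => h1.2 ?_ hxS⟩
            rintro rfl; exact he.2 hx
          · rintro ⟨h1, hx, h2⟩
            exact ⟨hx, fun hh => hh.elim h1 (fun h3 => h2 h3.2)⟩
        rw [this, Finset.card_erase_of_mem (by simp [hd.1, hd.2]), hn]; rfl)
    exact ⟨H.trans H'⟩

lemma poly_curve (P : Polynomial ℂ) (hP : P ≠ 0)
    (hs : ∀ a, P.eval a = 0 → P.derivative.eval a ≠ 0) :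
    ∃ S : Finset ℂ, S.card = P.natDegree ∧
      Nonempty (({p | p.2 ^ 2 = P.eval p.1} : Set (ℂ × ℂ)) ≃ₜ Curve S) := by
  classical
  have hnd : P.roots.Nodup := by
    rw [Multiset.nodup_iff_count_le_one]
    intro a
    rw [Polynomial.count_roots]
    by_contra hlt
    push Not at hlt
    obtain ⟨h1, h2⟩ := (Polynomial.one_lt_rootMultiplicity_iff_isRoot hP).1 hlt
    exact hs a h1 h2
  have hspl : P.Splits := IsAlgClosed.splits P
  have hcard : P.roots.toFinset.card = P.natDegree := by
    rw [Multiset.toFinset_card_of_nodup hnd, hspl.natDegree_eq_card_roots]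
  have hev : ∀ t, P.eval t = P.leadingCoeff * ∏ e ∈ P.roots.toFinset, (t - e) := by
    intro t
    conv_lhs => rw [hspl.eq_prod_roots]
    rw [Polynomial.eval_mul, Polynomial.eval_C, Polynomial.eval_multiset_prod,
      Multiset.map_map, Finset.prod_eq_multiset_prod, Multiset.toFinset_val, hnd.dedup]
    simp
  obtain ⟨m, hm⟩ := IsAlgClosed.exists_pow_nat_eq P.leadingCoeff (n := 2) (by norm_num)
  have hm0 : m ≠ 0 := by
    rintro rfl
    exact hP (Polynomial.leadingCoeff_eq_zero.1 (by simpa using hm.symm))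
  refine ⟨_, hcard, ⟨homeoOf _ _ (fun x => (x.1, x.2 / m)) (fun x => (x.1, x.2 * m))
    ?_ ?_ ?_ ?_ (by fun_prop) (by fun_prop)⟩⟩
  · intro x hx
    have h1 : x.2 ^ 2 = P.eval x.1 := hx
    change (x.2 / m) ^ 2 = ∏ e ∈ _, (x.1 - e)
    rw [div_pow, h1, hev, hm, mul_div_cancel_left₀]
    rw [← hm]; exact pow_ne_zero _ hm0
  · intro x hx
    have h1 : x.2 ^ 2 = ∏ e ∈ _, (x.1 - e) := hx
    change (x.2 * m) ^ 2 = P.eval x.1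
    rw [mul_pow, h1, hev, hm, mul_comm]
  · intro x _
    exact Prod.ext rfl (div_mul_cancel₀ _ hm0)
  · intro x _
    exact Prod.ext rfl (mul_div_cancel_right₀ _ hm0)


/-! ### The fibre as a punctured quartic curve -/

/-- The quartic. -/
noncomputable def quart (c : ℂ) : Polynomial ℂ :=
  Polynomial.C (64 / 9 + 4 * c) * (Polynomial.X * (Polynomial.X + 1) ^ 3) +
    Polynomial.C (8 / 9) * Polynomial.X + 1

lemma quart_eval (c t : ℂ) : (quart c).eval t =
    ((8 * t ^ 2 + 12 * t + 3) / 3) ^ 2 + 4 * c * t * (t + 1) ^ 3 := by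
  simp [quart]; ring

lemma quart_deriv (c t : ℂ) : (quart c).derivative.eval t =
    (64 / 9 + 4 * c) * ((t + 1) ^ 2 * (4 * t + 1)) + 8 / 9 := by
  simp [quart, Polynomial.derivative_pow]
  left; ring

lemma quart_natDegree (c : ℂ) (hc : c ≠ -16 / 9) : (quart c).natDegree = 4 := by
  have h : (64 / 9 + 4 * c) ≠ 0 := by
    intro h; apply hc; linear_combination h / 4
  unfold quart
  compute_degree!

lemma quart_simple (c : ℂ) (hc : c ≠ 0) (a : ℂ) (h : (quart c).eval a = 0) :
    (quart c).derivative.eval a ≠ 0 := by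
  intro h'
  rw [quart_eval] at h
  rw [quart_deriv] at h'
  have hq : 8 * a ^ 2 + 12 * a + 3 = 0 := by
    linear_combination (3 * (4 * a + 1) / 1) * h - 3 * a * (a + 1) * h'
  rw [hq] at h
  have h2 : a * (a + 1) ^ 3 = 0 := by
    have : c * (a * (a + 1) ^ 3) = 0 := by linear_combination h / 4
    exact (mul_eq_zero.1 this).resolve_left hc
  rcases mul_eq_zero.1 h2 with h3 | h3
  · rw [h3] at hq; norm_num at hq
  · have : a = -1 := by
      have := pow_eq_zero_iff (three_ne_zero) |>.1 h3
      linear_combination this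
    rw [this] at hq; norm_num at hq

lemma fiber_homeo (c : ℂ) (hc : c ≠ 0) :
    Nonempty (({p : ℂ × ℂ | briancon p.1 p.2 = c} : Set (ℂ × ℂ)) ≃ₜ
      ({p : ℂ × ℂ | p.2 ^ 2 = (quart c).eval p.1 ∧ p ≠ (-1, -1 / 3)} : Set (ℂ × ℂ))) := by
  set q : ℂ → ℂ := fun t => (8 * t ^ 2 + 12 * t + 3) / 3 with hq
  set X : ℂ × ℂ → ℂ := fun p => (p.2 - q p.1) / (2 * c) with hX
  set d : ℂ × ℂ → ℂ := fun p => X p * star (X p) + (p.1 + 1) ^ 3 * star ((p.1 + 1) ^ 3) with hd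
  set s : ℂ × ℂ → ℂ := fun p =>
    (star (X p) * p.1 + star ((p.1 + 1) ^ 3) * (q p.1 + c * X p)) / d p with hs
  set Y : ℂ × ℂ → ℂ := fun p => c - s p ^ 2 * ((p.1 + 1) ^ 2 + (p.1 + 1) + 1)
    + (8 / 3) * s p * (p.1 + 1) + (4 / 3) * s p with hY
  have hd0 : ∀ p : ℂ × ℂ, p ≠ (-1, -1 / 3) → d p ≠ 0 := by
    intro p hp h0
    have e : ∀ z : ℂ, z * star z = ((Complex.normSq z : ℝ) : ℂ) := fun z => Complex.mul_conj z
    simp only [hd] at h0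
    rw [e, e, ← Complex.ofReal_add, Complex.ofReal_eq_zero] at h0
    have n1 := Complex.normSq_nonneg (X p)
    have n2 := Complex.normSq_nonneg ((p.1 + 1) ^ 3)
    have h1 : X p = 0 := Complex.normSq_eq_zero.1 (by linarith)
    have h2 : (p.1 + 1) ^ 3 = 0 := Complex.normSq_eq_zero.1 (by linarith)
    have h3 : p.1 = -1 := by
      have := pow_eq_zero_iff (three_ne_zero) |>.1 h2
      linear_combination this
    apply hp
    refine Prod.ext h3 ?_
    simp only [hX, hq] at h1
    rw [div_eq_zero_iff, h3] at h1
    rcases h1 with h1 | h1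
    · change p.2 = -1 / 3
      linear_combination h1
    · simp [hc] at h1
  have hc2 : (2 * c) ≠ 0 := by simp [hc]
  have hXe : ∀ p, 2 * c * X p = p.2 - q p.1 := fun p => by
    simp only [hX]; field_simp
  have comp : ∀ p : ℂ × ℂ, p.2 ^ 2 = (quart c).eval p.1 →
      X p * (q p.1 + c * X p) = p.1 * (p.1 + 1) ^ 3 := by
    intro p hp
    rw [quart_eval] at hp
    have h1 := hXe p
    have hp' : p.2 ^ 2 = q p.1 ^ 2 + 4 * c * p.1 * (p.1 + 1) ^ 3 := hp
    have h2 : p.2 = q p.1 + 2 * c * X p := by linear_combination -h1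
    rw [h2] at hp'
    refine mul_left_cancel₀ (mul_ne_zero two_ne_zero hc2) ?_
    linear_combination hp'
  have hsx : ∀ p : ℂ × ℂ, p.2 ^ 2 = (quart c).eval p.1 → p ≠ (-1, -1 / 3) → X p * s p = p.1 := by
    intro p h1 h2
    simp only [hs]
    rw [mul_div_assoc', div_eq_iff (hd0 p h2)]
    simp only [hd]
    linear_combination star ((p.1 + 1) ^ 3) * comp p h1
  have hsp : ∀ p : ℂ × ℂ, p.2 ^ 2 = (quart c).eval p.1 → p ≠ (-1, -1 / 3) →
      (p.1 + 1) ^ 3 * s p = q p.1 + c * X p := by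
    intro p h1 h2
    simp only [hs]
    rw [mul_div_assoc', div_eq_iff (hd0 p h2)]
    simp only [hd]
    linear_combination (-star (X p)) * comp p h1
  have hxy : ∀ p : ℂ × ℂ, p.2 ^ 2 = (quart c).eval p.1 → p ≠ (-1, -1 / 3) →
      1 + X p * Y p = s p := by
    intro p h1 h2
    have a1 := hsx p h1 h2
    have a2 := hsp p h1 h2
    simp only [hq] at a2
    simp only [hY]
    linear_combination (-(s p) * ((p.1 + 1) ^ 2 + (p.1 + 1) + 1) + (8 / 3) * (p.1 + 1) + 4 / 3) * a1
      - a2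
  have hfib : ∀ x y : ℂ, briancon x y = c →
      (x * (1 + x * y) + 1) ^ 3 * (1 + x * y) = q (x * (1 + x * y)) + c * x := by
    intro x y h
    rw [← h]
    simp only [hq, briancon]
    ring
  set F : ℂ × ℂ → ℂ × ℂ := fun z =>
    (z.1 * (1 + z.1 * z.2), q (z.1 * (1 + z.1 * z.2)) + 2 * c * z.1) with hF
  have hXF : ∀ z, X (F z) = z.1 := by
    intro z
    simp only [hX, hF]
    field_simp
    ring
  have hF1 : ∀ z : ℂ × ℂ, briancon z.1 z.2 = c → (F z).2 ^ 2 = (quart c).eval (F z).1 := by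
    intro z hz
    have h1 := hfib _ _ hz
    rw [quart_eval]
    change (q (z.1 * (1 + z.1 * z.2)) + 2 * c * z.1) ^ 2 = q (z.1 * (1 + z.1 * z.2)) ^ 2 +
      4 * c * (z.1 * (1 + z.1 * z.2)) * (z.1 * (1 + z.1 * z.2) + 1) ^ 3
    linear_combination (-4 * c * z.1) * h1
  have hF2 : ∀ z : ℂ × ℂ, briancon z.1 z.2 = c → F z ≠ (-1, -1 / 3) := by
    intro z hz h0
    have h1 := hXF z
    have h2 : (F z).1 = -1 := by rw [h0]
    rw [h0] at h1
    have h3 : z.1 = 0 := by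
      rw [← h1]; simp only [hX, hq]; norm_num
    simp only [hF] at h2
    rw [h3] at h2
    norm_num at h2
  have hsF : ∀ z : ℂ × ℂ, briancon z.1 z.2 = c → s (F z) = 1 + z.1 * z.2 := by
    intro z hz
    have h1 := hfib _ _ hz
    have h2 := hd0 _ (hF2 z hz)
    simp only [hs]
    rw [div_eq_iff h2]
    simp only [hd]
    rw [hXF]
    change star z.1 * (z.1 * (1 + z.1 * z.2)) + star ((z.1 * (1 + z.1 * z.2) + 1) ^ 3) *
      (q (z.1 * (1 + z.1 * z.2)) + c * z.1) = (1 + z.1 * z.2) * (z.1 * star z.1 +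
      (z.1 * (1 + z.1 * z.2) + 1) ^ 3 * star ((z.1 * (1 + z.1 * z.2) + 1) ^ 3))
    linear_combination (-star ((z.1 * (1 + z.1 * z.2) + 1) ^ 3)) * h1
  have cX : Continuous X := by fun_prop
  have cd : Continuous d := by fun_prop
  refine ⟨homeoOf _ _ F (fun p => (X p, Y p)) ?_ ?_ ?_ ?_ (by fun_prop) ?_⟩
  · intro z hz
    exact ⟨hF1 z hz, hF2 z hz⟩
  · rintro p ⟨h1, h2⟩
    change briancon (X p) (Y p) = c
    unfold briancon
    rw [hxy p h1 h2]
    have a1 := hsx p h1 h2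
    simp only [hY]
    linear_combination (s p ^ 2 * (X p * s p + p.1) + 3 * s p ^ 2 - 8 / 3 * s p) * a1
  · intro z hz
    refine Prod.ext (hXF z) ?_
    change Y (F z) = z.2
    simp only [hY]
    rw [hsF z hz]
    have h3 : briancon z.1 z.2 = c := hz
    rw [← h3]
    simp only [hF, briancon]
    ring
  · rintro p ⟨h1, h2⟩
    have a0 := hxy p h1 h2
    have a1 := hsx p h1 h2
    simp only [hF]
    rw [a0, a1]
    refine Prod.ext rfl ?_
    change q p.1 + 2 * c * X p = p.2
    rw [hXe]; ring
  · have cs : Continuous fun p : ({p : ℂ × ℂ | p.2 ^ 2 = (quart c).eval p.1 ∧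
        p ≠ (-1, -1 / 3)} : Set (ℂ × ℂ)) => s p := by
      simp only [hs]
      refine Continuous.div (by fun_prop) (by fun_prop) ?_
      intro p
      exact hd0 _ p.2.2
    have gen : ∀ g : ({p : ℂ × ℂ | p.2 ^ 2 = (quart c).eval p.1 ∧
        p ≠ (-1, -1 / 3)} : Set (ℂ × ℂ)) → ℂ, Continuous g →
        Continuous fun p => (X p.1, c - g p ^ 2 * ((p.1.1 + 1) ^ 2 + (p.1.1 + 1) + 1)
          + (8 / 3) * g p * (p.1.1 + 1) + (4 / 3) * g p) := by
      intro g hg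
      fun_prop
    exact gen _ cs


/-! ### The base curve `w ^ 2 = t ^ 4 + 1` as a twice punctured torus -/

lemma real_inj {p₁ p₁' q₁ q₁' p₂ p₂' q₂ q₂' N₁ N₂ D₁ D₂ : ℝ}
    (a1 : p₁ ^ 2 + p₁' ^ 2 = 1) (b1 : q₁ ^ 2 + q₁' ^ 2 = 1)
    (a2 : p₂ ^ 2 + p₂' ^ 2 = 1) (b2 : q₂ ^ 2 + q₂' ^ 2 = 1)
    (n1 : N₁ ^ 2 = 1 + p₁ ^ 2 * q₁ ^ 2) (n2 : N₂ ^ 2 = 1 + p₂ ^ 2 * q₂ ^ 2)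
    (d1 : D₁ = N₁ + p₁' * q₁') (d2 : D₂ = N₂ + p₂' * q₂')
    (P1 : 0 < D₁) (P2 : 0 < D₂) (Q1 : 0 < N₁) (Q2 : 0 < N₂)
    (hp : p₁ / D₁ = p₂ / D₂) (hq : q₁ / D₁ = q₂ / D₂) :
    p₁ = p₂ ∧ q₁ = q₂ ∧ ((p₁' = p₂' ∧ q₁' = q₂') ∨ (p₁' = -p₂' ∧ q₁' = -q₂')) := by
  have s1 : p₁ ^ 2 + q₁ ^ 2 = (2 * N₁ - D₁) * D₁ := by
    have : p₁' * q₁' = D₁ - N₁ := by linarith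
    have h2 : (p₁' * q₁') ^ 2 = (1 - p₁ ^ 2) * (1 - q₁ ^ 2) := by
      rw [mul_pow, show p₁' ^ 2 = 1 - p₁ ^ 2 by linarith, show q₁' ^ 2 = 1 - q₁ ^ 2 by linarith]
    rw [this] at h2
    linear_combination h2 - n1
  have s2 : p₂ ^ 2 + q₂ ^ 2 = (2 * N₂ - D₂) * D₂ := by
    have : p₂' * q₂' = D₂ - N₂ := by linarith
    have h2 : (p₂' * q₂') ^ 2 = (1 - p₂ ^ 2) * (1 - q₂ ^ 2) := by
      rw [mul_pow, show p₂' ^ 2 = 1 - p₂ ^ 2 by linarith, show q₂' ^ 2 = 1 - q₂ ^ 2 by linarith]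
    rw [this] at h2
    linear_combination h2 - n2
  obtain ⟨k, hk⟩ : ∃ k, k = D₂ / D₁ := ⟨_, rfl⟩
  have hk0 : 0 < k := by rw [hk]; positivity
  have kD : D₂ = k * D₁ := by rw [hk]; field_simp
  have kp : p₂ = k * p₁ := by
    rw [div_eq_div_iff P1.ne' P2.ne', kD] at hp
    refine mul_right_cancel₀ P1.ne' ?_
    linear_combination -hp
  have kq : q₂ = k * q₁ := by
    rw [div_eq_div_iff P1.ne' P2.ne', kD] at hq
    refine mul_right_cancel₀ P1.ne' ?_
    linear_combination -hq
  have kN : N₂ = k * N₁ := by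
    have hz : (k * D₁) ≠ 0 := by positivity
    rw [kp, kq, kD] at s2
    refine mul_right_cancel₀ hz ?_
    linear_combination (-1 / 2) * s2 + k ^ 2 / 2 * s1
  have hk1 : k = 1 := by
    have hk2 : (k ^ 2 - 1) * (1 - k ^ 2 * p₁ ^ 2 * q₁ ^ 2) = 0 := by
      rw [kN, kp, kq] at n2
      linear_combination n2 - k ^ 2 * n1
    have hk3 : k ^ 2 = 1 := by
      rcases mul_eq_zero.1 hk2 with h | h
      · linarith
      ·
        have e1 : p₁ ^ 2 ≤ 1 := by nlinarith [sq_nonneg p₁']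
        have e2 : q₁ ^ 2 ≤ 1 := by nlinarith [sq_nonneg q₁']
        have e3 : k ^ 2 * p₁ ^ 2 ≤ 1 := by rw [kp, mul_pow] at a2; linarith [sq_nonneg p₂']
        have e4 : k ^ 2 * q₁ ^ 2 ≤ 1 := by rw [kq, mul_pow] at b2; linarith [sq_nonneg q₂']
        have g1 := mul_le_mul_of_nonneg_right e3 (sq_nonneg q₁)
        have g2 := mul_le_mul_of_nonneg_right e4 (sq_nonneg p₁)
        have f1 : q₁ ^ 2 = 1 := by linarith
        have f2 : p₁ ^ 2 = 1 := by linarith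
        rw [f1, f2] at h
        linarith
    exact (pow_eq_one_iff_of_nonneg hk0.le two_ne_zero).1 hk3
  rw [hk1, one_mul] at kp kq kN kD
  refine ⟨kp.symm, kq.symm, ?_⟩
  have hr : p₁' * q₁' = p₂' * q₂' := by linarith
  have hp2 : p₁' ^ 2 = p₂' ^ 2 := by rw [kp] at a2; linarith
  have hq2 : q₁' ^ 2 = q₂' ^ 2 := by rw [kq] at b2; linarith
  rcases sq_eq_sq_iff_eq_or_eq_neg.1 hp2 with h | h <;>
  rcases sq_eq_sq_iff_eq_or_eq_neg.1 hq2 with h' | h'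
  · exact Or.inl ⟨h, h'⟩
  · have : p₂' * q₂' = 0 := by rw [h, h'] at hr; linarith
    rcases mul_eq_zero.1 this with h0 | h0
    · right; exact ⟨by rw [h, h0, neg_zero], h'⟩
    · left; exact ⟨h, by rw [h', h0, neg_zero]⟩
  · have : p₂' * q₂' = 0 := by rw [h, h'] at hr; linarith
    rcases mul_eq_zero.1 this with h0 | h0
    · left; exact ⟨by rw [h, h0, neg_zero], h'⟩
    · right; exact ⟨h, by rw [h', h0, neg_zero]⟩
  · exact Or.inr ⟨h, h'⟩

lemma real_surj (x y : ℝ) : ∃ p p' q q' : ℝ, p ^ 2 + p' ^ 2 = 1 ∧ q ^ 2 + q' ^ 2 = 1 ∧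
    0 < Real.sqrt (1 + p ^ 2 * q ^ 2) + p' * q' ∧
    p = x * (Real.sqrt (1 + p ^ 2 * q ^ 2) + p' * q') ∧
    q = y * (Real.sqrt (1 + p ^ 2 * q ^ 2) + p' * q') := by
  set m := x ^ 2 + y ^ 2 with hm
  have hm0 : 0 ≤ m := by positivity
  have hm1 : (1 + m) ≠ 0 := by positivity
  obtain ⟨a, ha⟩ : ∃ a, a = 2 * x / (1 + m) := ⟨_, rfl⟩
  obtain ⟨b, hb⟩ : ∃ b, b = 2 * y / (1 + m) := ⟨_, rfl⟩
  obtain ⟨d, hd⟩ : ∃ d, d = (1 - m) / (1 + m) := ⟨_, rfl⟩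
  have hu : a ^ 2 + b ^ 2 + d ^ 2 = 1 := by
    rw [ha, hb, hd]; field_simp; rw [hm]; ring
  have hx : a = x * (1 + d) := by rw [ha, hd]; field_simp; ring
  have hy : b = y * (1 + d) := by rw [hb, hd]; field_simp; ring
  have hd1 : 0 < 1 + d := by
    rw [hd]
    have : 1 + (1 - m) / (1 + m) = 2 / (1 + m) := by field_simp; ring
    rw [this]; positivity
  have hab : 0 ≤ 1 - 4 * a ^ 2 * b ^ 2 := by
    nlinarith [sq_nonneg (a ^ 2 - b ^ 2), sq_nonneg d, sq_nonneg a, sq_nonneg b]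
  set R := Real.sqrt (1 - 4 * a ^ 2 * b ^ 2) with hR
  have hR0 : 0 ≤ R := Real.sqrt_nonneg _
  have hR2 : R ^ 2 = 1 - 4 * a ^ 2 * b ^ 2 := Real.sq_sqrt hab
  obtain ⟨K, hK⟩ : ∃ K, K = 2 / (1 + R) := ⟨_, rfl⟩
  have hK0 : 0 < K := by rw [hK]; positivity
  have hK2 : K ≤ 2 := by rw [hK, div_le_iff₀ (by positivity)]; linarith
  have hKe : K = 1 + K ^ 2 * a ^ 2 * b ^ 2 := by
    have : K * (1 + R) = 2 := by rw [hK]; field_simp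
    have h1 : K * R = 2 - K := by linarith
    have h2 : (K * R) ^ 2 = (2 - K) ^ 2 := by rw [h1]
    rw [mul_pow, hR2] at h2
    linear_combination h2 / 4
  set k := Real.sqrt K with hk
  have hk0 : 0 < k := Real.sqrt_pos.2 hK0
  have hk2 : k ^ 2 = K := Real.sq_sqrt hK0.le
  have hprod : (1 - K * a ^ 2) * (1 - K * b ^ 2) = K * d ^ 2 := by
    linear_combination -hKe - K * hu
  have hsum : 0 ≤ (1 - K * a ^ 2) + (1 - K * b ^ 2) := by
    nlinarith [sq_nonneg d, sq_nonneg a, sq_nonneg b]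
  have hpr0 : 0 ≤ (1 - K * a ^ 2) * (1 - K * b ^ 2) := by rw [hprod]; positivity
  have hA : 0 ≤ 1 - K * a ^ 2 := by
    by_contra h; push Not at h; nlinarith
  have hB : 0 ≤ 1 - K * b ^ 2 := by
    by_contra h; push Not at h; nlinarith
  have hN : Real.sqrt (1 + (k * a) ^ 2 * (k * b) ^ 2) = k := by
    have : 1 + (k * a) ^ 2 * (k * b) ^ 2 = k ^ 2 := by
      rw [mul_pow, mul_pow, hk2]; linear_combination -hKe
    rw [this, Real.sqrt_sq hk0.le]
  obtain ⟨p', q', hp', hq', hr⟩ : ∃ p' q' : ℝ, p' ^ 2 = 1 - K * a ^ 2 ∧ q' ^ 2 = 1 - K * b ^ 2 ∧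
      p' * q' = k * d := by
    have hsq : (Real.sqrt (1 - K * a ^ 2) * Real.sqrt (1 - K * b ^ 2)) ^ 2 = (k * d) ^ 2 := by
      rw [mul_pow, Real.sq_sqrt hA, Real.sq_sqrt hB, hprod, mul_pow, hk2]
    rcases sq_eq_sq_iff_eq_or_eq_neg.1 hsq with h | h
    · exact ⟨_, _, Real.sq_sqrt hA, Real.sq_sqrt hB, h⟩
    · refine ⟨_, -Real.sqrt (1 - K * b ^ 2), Real.sq_sqrt hA, ?_, ?_⟩
      · rw [neg_sq, Real.sq_sqrt hB]
      · rw [mul_neg, h, neg_neg]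
  refine ⟨k * a, p', k * b, q', ?_, ?_, ?_, ?_, ?_⟩
  · rw [mul_pow, hk2, hp']; ring
  · rw [mul_pow, hk2, hq']; ring
  · rw [hN, hr]; nlinarith
  · rw [hN, hr]; linear_combination k * hx
  · rw [hN, hr]; linear_combination k * hy

/-- The norm function on the torus. -/
noncomputable def tN (z : Circle × Circle) : ℝ :=
  Real.sqrt (1 + (z.1 : ℂ).re ^ 2 * (z.2 : ℂ).re ^ 2)

/-- The third coordinate on the pillow. -/
noncomputable def tr (z : Circle × Circle) : ℝ := (z.1 : ℂ).im * (z.2 : ℂ).im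

/-- The denominator of the stereographic projection. -/
noncomputable def tD (z : Circle × Circle) : ℝ := tN z + tr z

/-- The first coordinate of the map to the base curve. -/
noncomputable def tt (z : Circle × Circle) : ℂ :=
  ((z.1 : ℂ).re + (z.2 : ℂ).re * Complex.I) / (tD z : ℂ)

/-- The denominator of the ratio. -/
noncomputable def tden (z : Circle × Circle) : ℂ :=
  2 * (tr z : ℂ) + (((z.1 : ℂ).re ^ 2 - (z.2 : ℂ).re ^ 2 : ℝ) : ℂ) * Complex.I

/-- The numerator of the ratio. -/
noncomputable def tnum (z : Circle × Circle) : ℂ :=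
  2 * (tN z : ℂ) * (tr z : ℂ) + (((z.1 : ℂ).re ^ 2 - (z.2 : ℂ).re ^ 2 : ℝ) : ℂ) * Complex.I

/-- The second coordinate of the map to the base curve. -/
noncomputable def tw (z : Circle × Circle) : ℂ :=
  (1 + Complex.I) * ((z.1 : ℂ).im + (z.2 : ℂ).im * Complex.I) *
    (tnum z / tden z) ^ (1 / 2 : ℂ) * (tt z ^ 2 + Complex.I) /
    ((tD z : ℂ) * (‖tt z ^ 2 + Complex.I‖ : ℂ))

lemma circ (u : Circle) : (u : ℂ).re ^ 2 + (u : ℂ).im ^ 2 = 1 := by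
  have := Circle.normSq_coe u
  rw [Complex.normSq_apply] at this
  linarith

lemma tN_sq (z : Circle × Circle) :
    tN z ^ 2 = 1 + (z.1 : ℂ).re ^ 2 * (z.2 : ℂ).re ^ 2 :=
  Real.sq_sqrt (by positivity)

lemma tN_pos (z : Circle × Circle) : 1 ≤ tN z := by
  rw [tN, Real.one_le_sqrt]
  nlinarith [sq_nonneg ((z.1 : ℂ).re * (z.2 : ℂ).re)]

lemma tr_sq (z : Circle × Circle) :
    tr z ^ 2 = (1 - (z.1 : ℂ).re ^ 2) * (1 - (z.2 : ℂ).re ^ 2) := by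
  have h1 := circ z.1
  have h2 := circ z.2
  rw [tr, mul_pow, show (z.1 : ℂ).im ^ 2 = 1 - (z.1 : ℂ).re ^ 2 by linarith,
    show (z.2 : ℂ).im ^ 2 = 1 - (z.2 : ℂ).re ^ 2 by linarith]

lemma pq_sq (z : Circle × Circle) :
    (z.1 : ℂ).re ^ 2 + (z.2 : ℂ).re ^ 2 = (tN z - tr z) * tD z := by
  rw [tD]
  linear_combination -tN_sq z + tr_sq z

lemma tD_nonneg (z : Circle × Circle) : 0 ≤ tD z := by
  have h1 := tN_pos z
  have h2 : tr z ^ 2 ≤ 1 := by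
    rw [tr_sq]
    have h1 := circ z.1
    have h2 := circ z.2
    have e1 : 0 ≤ 1 - (z.1 : ℂ).re ^ 2 := by nlinarith [sq_nonneg (z.1 : ℂ).im]
    have e2 : 0 ≤ 1 - (z.2 : ℂ).re ^ 2 := by nlinarith [sq_nonneg (z.2 : ℂ).im]
    nlinarith [sq_nonneg (z.1 : ℂ).re, sq_nonneg (z.2 : ℂ).re]
  have := abs_le_of_sq_le_sq' (a := tr z) (b := 1) (by simpa using h2) (by norm_num)
  rw [tD]; linarith [this.1]

lemma tD_zero (z : Circle × Circle) (h : tD z = 0) :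
    (z.1 : ℂ).re = 0 ∧ (z.2 : ℂ).re = 0 ∧ (z.1 : ℂ).im * (z.2 : ℂ).im = -1 := by
  have h1 := pq_sq z
  rw [h, mul_zero] at h1
  have e1 : (z.1 : ℂ).re = 0 := by nlinarith [sq_nonneg (z.1 : ℂ).re, sq_nonneg (z.2 : ℂ).re]
  have e2 : (z.2 : ℂ).re = 0 := by nlinarith [sq_nonneg (z.1 : ℂ).re, sq_nonneg (z.2 : ℂ).re]
  refine ⟨e1, e2, ?_⟩
  rw [tD, tN, tr, e1, e2] at h
  norm_num at h
  linarith

lemma K1 (z : Circle × Circle) (h : tD z ≠ 0) :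
    (tD z : ℂ) ^ 2 * ((tt z ^ 2 - Complex.I) * (star (tt z) ^ 2 - Complex.I)) = -2 * tnum z := by
  have hD : (tD z : ℂ) ≠ 0 := by exact_mod_cast h
  have hst : star (tt z) = ((z.1 : ℂ).re - (z.2 : ℂ).re * Complex.I) / (tD z : ℂ) := by
    simp [tt, sub_eq_add_neg]
  have hI : Complex.I ^ 2 = -1 := Complex.I_sq
  have hpq : (((z.1 : ℂ).re : ℂ) ^ 2 + ((z.2 : ℂ).re : ℂ) ^ 2) = ((tN z : ℂ) - tr z) * tD z := by
    exact_mod_cast pq_sq z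
  have hDe : (tD z : ℂ) = tN z + tr z := by rw [tD]; push_cast; ring
  have hTT : tt z * star (tt z) * tD z = tN z - tr z := by
    rw [hst, tt]
    field_simp
    linear_combination hpq - ((z.2 : ℂ).re : ℂ) ^ 2 * hI
  have hT2 : (tD z : ℂ) ^ 2 * (tt z ^ 2 + star (tt z) ^ 2) =
      2 * (((z.1 : ℂ).re : ℂ) ^ 2 - ((z.2 : ℂ).re : ℂ) ^ 2) := by
    rw [hst, tt]
    field_simp
    linear_combination (2 * ((z.2 : ℂ).re : ℂ) ^ 2) * hI
  rw [tnum]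
  push_cast
  linear_combination (tt z * star (tt z) * tD z + (tN z - tr z)) * hTT - Complex.I * hT2
    + (tD z : ℂ) ^ 2 * hI - (tD z + (tN z + tr z)) * hDe

lemma tden_eq (z : Circle × Circle) :
    tden z = -Complex.I * ((z.1 : ℂ).im + (z.2 : ℂ).im * Complex.I) ^ 2 := by
  have h1 := circ z.1
  have h2 := circ z.2
  have e1 : (((z.1 : ℂ).re : ℂ) ^ 2 + ((z.1 : ℂ).im : ℂ) ^ 2) = 1 := by exact_mod_cast h1
  have e2 : (((z.2 : ℂ).re : ℂ) ^ 2 + ((z.2 : ℂ).im : ℂ) ^ 2) = 1 := by exact_mod_cast h2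
  rw [tden, tr]
  push_cast
  have hI : Complex.I ^ 2 = -1 := Complex.I_sq
  linear_combination Complex.I * e1 - Complex.I * e2 + (2 * ((z.1 : ℂ).im : ℂ) * (z.2 : ℂ).im +
    Complex.I * (z.2 : ℂ).im ^ 2) * hI


lemma tden_re (z : Circle × Circle) : (tden z).re = 2 * tr z := by
  simp [tden, ← Complex.ofReal_pow]

lemma tden_im (z : Circle × Circle) :
    (tden z).im = (z.1 : ℂ).re ^ 2 - (z.2 : ℂ).re ^ 2 := by
  rw [tden]
  simp only [Complex.add_im, Complex.mul_im, Complex.ofReal_re, Complex.ofReal_im, Complex.I_re,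
    Complex.I_im, Complex.re_ofNat, Complex.im_ofNat]
  ring

lemma tnum_re (z : Circle × Circle) : (tnum z).re = 2 * tN z * tr z := by
  simp [tnum, ← Complex.ofReal_pow]

lemma tnum_im (z : Circle × Circle) :
    (tnum z).im = (z.1 : ℂ).re ^ 2 - (z.2 : ℂ).re ^ 2 := by
  rw [tnum]
  simp only [Complex.add_im, Complex.mul_im, Complex.ofReal_re, Complex.ofReal_im, Complex.I_re,
    Complex.I_im, Complex.re_ofNat, Complex.im_ofNat, Complex.mul_re]
  ring

lemma tnum_zero (z : Circle × Circle) (h : tden z = 0) : tnum z = 0 := by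
  have h1 := tden_re z
  have h2 := tden_im z
  rw [h] at h1 h2
  simp only [Complex.zero_re, Complex.zero_im] at h1 h2
  apply Complex.ext
  · rw [tnum_re, show tr z = 0 by linarith]; simp
  · rw [tnum_im, ← h2]; simp

lemma ratio_slit (z : Circle × Circle) (h : tden z ≠ 0) : tnum z / tden z ∈ Complex.slitPlane := by
  left
  have hpos : 0 < Complex.normSq (tden z) := Complex.normSq_pos.2 h
  have h2 := Complex.normSq_apply (tden z)
  rw [Complex.div_re, ← add_div]
  apply div_pos _ hpos
  rw [tnum_re, tnum_im, tden_re, tden_im]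
  rw [tden_re, tden_im] at h2
  have := tN_pos z
  nlinarith [sq_nonneg (tr z)]

lemma star_I' : star Complex.I = -Complex.I := Complex.conj_I

lemma tden_ne (z : Circle × Circle) (h : tD z ≠ 0) (h4 : tt z ^ 4 + 1 ≠ 0) : tden z ≠ 0 := by
  intro h0
  have hD : (tD z : ℂ) ≠ 0 := by exact_mod_cast h
  have hI : Complex.I ^ 2 = -1 := Complex.I_sq
  have h1 := K1 z h
  rw [tnum_zero z h0, mul_zero] at h1
  have h2 := (mul_eq_zero.1 h1).resolve_left (pow_ne_zero _ hD)
  apply h4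
  rcases mul_eq_zero.1 h2 with h3 | h3
  · linear_combination (tt z ^ 2 + Complex.I) * h3 + hI
  · have h5 := congrArg star h3
    simp only [star_sub, star_pow, star_star, star_zero, star_I'] at h5
    linear_combination (tt z ^ 2 - Complex.I) * h5 + hI

lemma hsq2 (z : ℂ) : (z ^ (1 / 2 : ℂ)) ^ 2 = z := by
  rw [one_div]
  exact_mod_cast Complex.cpow_nat_inv_pow z two_ne_zero

lemma tw_sq (z : Circle × Circle) (h : tD z ≠ 0) : tw z ^ 2 = tt z ^ 4 + 1 := by
  have hD : (tD z : ℂ) ≠ 0 := by exact_mod_cast h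
  have hI : Complex.I ^ 2 = -1 := Complex.I_sq
  by_cases hA : tt z ^ 2 + Complex.I = 0
  · have : tw z = 0 := by simp [tw, hA]
    rw [this]
    linear_combination -(tt z ^ 2 - Complex.I) * hA - hI
  · have hn : ((‖tt z ^ 2 + Complex.I‖ : ℝ) : ℂ) ^ 2 =
        (tt z ^ 2 + Complex.I) * (star (tt z) ^ 2 - Complex.I) := by
      have := Complex.mul_conj' (tt z ^ 2 + Complex.I)
      rw [← this]
      simp [sub_eq_add_neg]
    have hn0 : ((‖tt z ^ 2 + Complex.I‖ : ℝ) : ℂ) ≠ 0 := by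
      simpa using hA
    have hr : ((z.1 : ℂ).im + (z.2 : ℂ).im * Complex.I) ^ 2 * (tnum z / tden z) * (-Complex.I) =
        tnum z := by
      have h1 := tden_eq z
      by_cases h0 : tden z = 0
      · rw [tnum_zero z h0]; simp
      · calc _ = tden z * (tnum z / tden z) := by rw [h1]; ring
          _ = _ := mul_div_cancel₀ _ h0
    rw [tw, div_pow, div_eq_iff (pow_ne_zero _ (mul_ne_zero hD hn0))]
    simp only [mul_pow, hsq2]
    rw [hn]
    have hk := K1 z h
    have e1 : (1 + Complex.I) ^ 2 = 2 * Complex.I := by linear_combination hI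
    rw [e1]
    linear_combination (-2 * (tt z ^ 2 + Complex.I) ^ 2) * hr - (tt z ^ 2 + Complex.I) ^ 2 * hk
      - (tD z : ℂ) ^ 2 * ((tt z ^ 2 + Complex.I) * (star (tt z) ^ 2 - Complex.I)) * hI

lemma cont_tN : Continuous tN := by unfold tN; fun_prop
lemma cont_tr : Continuous tr := by unfold tr; fun_prop
lemma cont_tD : Continuous tD := cont_tN.add cont_tr

/-- The good part of the torus. -/
def good : Set (Circle × Circle) := {z | tD z ≠ 0}

lemma cont_tt : Continuous fun z : good => tt z := by
  unfold tt
  have := cont_tD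
  refine Continuous.div (by fun_prop) (by fun_prop) ?_
  intro z
  exact_mod_cast z.2

lemma cont_tw : Continuous fun z : good => tw z := by
  have h1 := cont_tt
  have h2 := cont_tD
  have h3 := cont_tN
  have h4 := cont_tr
  refine cont_of_sq (G := fun z : good => tt z ^ 4 + 1) (by fun_prop)
    (fun z => tw_sq z z.2) ?_
  intro z hz
  have hD : (tD z : ℂ) ≠ 0 := by exact_mod_cast z.2
  have hI : Complex.I ^ 2 = -1 := Complex.I_sq
  have hden := tden_ne z z.2 hz
  have hA : tt z ^ 2 + Complex.I ≠ 0 := by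
    intro hA; apply hz
    linear_combination (tt z ^ 2 - Complex.I) * hA + hI
  have hn0 : ((‖tt z ^ 2 + Complex.I‖ : ℝ) : ℂ) ≠ 0 := by
    simpa using hA
  unfold tw
  refine ContinuousAt.div ?_ ?_ (mul_ne_zero hD hn0)
  · refine ContinuousAt.mul (ContinuousAt.mul (by fun_prop) ?_)
      ((h1.pow 2).add continuous_const).continuousAt
    refine ContinuousAt.cpow ?_ continuousAt_const (ratio_slit _ hden)
    refine ContinuousAt.div ?_ ?_ hden
    · unfold tnum; fun_prop
    · unfold tden; fun_prop
  · exact ((Complex.continuous_ofReal.comp (h2.comp continuous_subtype_val)).mul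
      (Complex.continuous_ofReal.comp ((h1.pow 2).add continuous_const).norm)).continuousAt

lemma tN_inv (z : Circle × Circle) : tN z⁻¹ = tN z := by
  simp [tN, Circle.coe_inv_eq_conj]
lemma tr_inv (z : Circle × Circle) : tr z⁻¹ = tr z := by
  simp [tr, Circle.coe_inv_eq_conj]
lemma tD_inv (z : Circle × Circle) : tD z⁻¹ = tD z := by
  rw [tD, tD, tN_inv, tr_inv]
lemma tt_inv (z : Circle × Circle) : tt z⁻¹ = tt z := by
  rw [tt, tt, tD_inv]
  simp [Circle.coe_inv_eq_conj]
lemma tw_inv (z : Circle × Circle) : tw z⁻¹ = -tw z := by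
  have h1 : tnum z⁻¹ = tnum z := by
    rw [tnum, tnum, tN_inv, tr_inv]; simp [Circle.coe_inv_eq_conj]
  have h2 : tden z⁻¹ = tden z := by
    rw [tden, tden, tr_inv]; simp [Circle.coe_inv_eq_conj]
  rw [tw, tw, h1, h2, tt_inv, tD_inv]
  simp only [Prod.fst_inv, Prod.snd_inv, Circle.coe_inv_eq_conj, Complex.conj_im]
  push_cast
  ring

lemma circle_ext {u v : Circle} (h1 : (u : ℂ).re = (v : ℂ).re) (h2 : (u : ℂ).im = (v : ℂ).im) :
    u = v := Circle.ext (Complex.ext h1 h2)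

lemma tt_re (z : Circle × Circle) : (tt z).re = (z.1 : ℂ).re / tD z := by
  rw [tt, Complex.div_ofReal_re]; simp
lemma tt_im (z : Circle × Circle) : (tt z).im = (z.2 : ℂ).re / tD z := by
  rw [tt, Complex.div_ofReal_im]; simp

lemma tt_inj (z z' : Circle × Circle) (h : tD z ≠ 0) (h' : tD z' ≠ 0) (he : tt z = tt z') :
    z = z' ∨ z = z'⁻¹ := by
  have e1 := congrArg Complex.re he
  have e2 := congrArg Complex.im he
  rw [tt_re, tt_re] at e1
  rw [tt_im, tt_im] at e2
  obtain ⟨a, b, hab⟩ := real_inj (circ z.1) (circ z.2) (circ z'.1) (circ z'.2) (tN_sq z) (tN_sq z')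
    rfl rfl ((tD_nonneg z).lt_of_ne' h) ((tD_nonneg z').lt_of_ne' h')
    (by linarith [tN_pos z]) (by linarith [tN_pos z']) e1 e2
  rcases hab with ⟨c, d⟩ | ⟨c, d⟩
  · left
    exact Prod.ext (circle_ext a c) (circle_ext b d)
  · right
    refine Prod.ext (circle_ext ?_ ?_) (circle_ext ?_ ?_) <;>
      simp [Circle.coe_inv_eq_conj, a, b, c, d]

lemma mk_circle (p p' : ℝ) (h : p ^ 2 + p' ^ 2 = 1) :
    ∃ u : Circle, (u : ℂ).re = p ∧ (u : ℂ).im = p' := by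
  refine ⟨⟨⟨p, p'⟩, ?_⟩, rfl, rfl⟩
  refine mem_sphere_zero_iff_norm.2 ?_
  rw [← sq_eq_sq₀ (norm_nonneg _) zero_le_one, ← Complex.normSq_eq_norm_sq, Complex.normSq_mk]
  linarith

lemma tt_surj (t : ℂ) : ∃ z, tD z ≠ 0 ∧ tt z = t := by
  obtain ⟨p, p', q, q', h1, h2, h3, h4, h5⟩ := real_surj t.re t.im
  obtain ⟨u, hu, hu'⟩ := mk_circle p p' h1
  obtain ⟨v, hv, hv'⟩ := mk_circle q q' h2
  have hD : tD (u, v) = Real.sqrt (1 + p ^ 2 * q ^ 2) + p' * q' := by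
    simp [tD, tN, tr, hu, hu', hv, hv']
  rw [← hD] at h3 h4 h5
  refine ⟨(u, v), h3.ne', ?_⟩
  apply Complex.ext
  · rw [tt_re, div_eq_iff h3.ne']; change (u : ℂ).re = _; rw [hu]; exact h4
  · rw [tt_im, div_eq_iff h3.ne']; change (v : ℂ).re = _; rw [hv]; exact h5

/-- The base curve. -/
def base : Set (ℂ × ℂ) := {p | p.2 ^ 2 = p.1 ^ 4 + 1}

/-- The map to the base curve. -/
noncomputable def tmap (z : good) : base := ⟨(tt z, tw z), tw_sq z z.2⟩

lemma cont_tmap : Continuous tmap := (cont_tt.prodMk cont_tw).subtype_mk _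

lemma tmap_bij : Function.Bijective tmap := by
  constructor
  · rintro ⟨z, hz⟩ ⟨z', hz'⟩ h
    have h1 := congrArg Subtype.val h
    have ht : tt z = tt z' := congrArg Prod.fst h1
    have hw : tw z = tw z' := congrArg Prod.snd h1
    rcases tt_inj z z' hz hz' ht with h2 | h2
    · exact Subtype.ext h2
    · have hI : Complex.I ^ 2 = -1 := Complex.I_sq
      rw [h2, tw_inv] at hw
      have hw0 : tw z' = 0 := by linear_combination -hw / 2
      have h4 := tw_sq z' hz'
      rw [hw0] at h4
      have h5 : tden z' = 0 := by
        have hk := K1 z' hz'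
        have hz0 : (tt z' ^ 2 - Complex.I) * (star (tt z') ^ 2 - Complex.I) = 0 := by
          have h6 : (tt z' ^ 2 - Complex.I) * (tt z' ^ 2 + Complex.I) = 0 := by
            linear_combination -h4 - hI
          rcases mul_eq_zero.1 h6 with h7 | h7
          · rw [h7, zero_mul]
          · have h8 := congrArg star h7
            simp only [star_add, star_pow, star_zero, star_I'] at h8
            rw [← sub_eq_add_neg] at h8
            rw [h8, mul_zero]
        rw [hz0, mul_zero] at hk
        have hn : tnum z' = 0 := by linear_combination hk / 2
        have r1 := tnum_re z'
        have r2 := tnum_im z'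
        rw [hn] at r1 r2
        simp only [Complex.zero_re, Complex.zero_im] at r1 r2
        have hN := tN_pos z'
        have hr : tr z' = 0 := by
          rcases mul_eq_zero.1 r1.symm with h9 | h9
          · linarith
          · exact h9
        apply Complex.ext
        · rw [tden_re, hr]; simp
        · rw [tden_im, ← r2]; simp
      rw [tden_eq] at h5
      have h6 : ((z'.1 : ℂ).im + (z'.2 : ℂ).im * Complex.I : ℂ) = 0 := by
        have := (mul_eq_zero.1 h5).resolve_left (neg_ne_zero.2 Complex.I_ne_zero)
        exact pow_eq_zero_iff two_ne_zero |>.1 this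
      have i1 : (z'.1 : ℂ).im = 0 := by simpa using congrArg Complex.re h6
      have i2 : (z'.2 : ℂ).im = 0 := by simpa using congrArg Complex.im h6
      apply Subtype.ext
      change z = z'
      rw [h2]
      refine Prod.ext (circle_ext ?_ ?_) (circle_ext ?_ ?_) <;>
        simp [Circle.coe_inv_eq_conj, i1, i2]
  · rintro ⟨⟨t, w⟩, hp⟩
    have hp' : w ^ 2 = t ^ 4 + 1 := hp
    obtain ⟨z, hz, ht⟩ := tt_surj t
    have h1 := tw_sq z hz
    rw [ht, ← hp'] at h1
    rcases sq_eq_sq_iff_eq_or_eq_neg.1 h1 with h2 | h2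
    · exact ⟨⟨z, hz⟩, Subtype.ext (Prod.ext ht h2)⟩
    · refine ⟨⟨z⁻¹, by rw [good, Set.mem_ofPred_eq, tD_inv]; exact hz⟩, Subtype.ext (Prod.ext ?_ ?_)⟩
      · change tt z⁻¹ = t; rw [tt_inv, ht]
      · change tw z⁻¹ = w; rw [tw_inv, h2, neg_neg]

lemma tt_norm (z : Circle × Circle) (h : tD z ≠ 0) :
    Complex.normSq (tt z) * tD z = tN z - tr z := by
  rw [Complex.normSq_apply, tt_re, tt_im]
  have := pq_sq z
  field_simp
  linarith

lemma tmap_proper : IsProperMap tmap := by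
  rw [isProperMap_iff_ultrafilter]
  refine ⟨cont_tmap, ?_⟩
  intro U y hy
  obtain ⟨z, -, hz⟩ := isCompact_univ.ultrafilter_le_nhds (U.map (Subtype.val : good → _))
    (by simp)
  have hz' : Tendsto (Subtype.val : good → Circle × Circle) U (𝓝 z) := hz
  have hzg : tD z ≠ 0 := by
    intro h0
    have h1 : Tendsto (fun x : good => Complex.normSq (tmap x).1.1 * tD x) U
        (𝓝 (Complex.normSq y.1.1 * tD z)) := by
      refine Tendsto.mul ?_ ((cont_tD.tendsto z).comp hz')
      have : Continuous fun p : base => Complex.normSq p.1.1 := by fun_prop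
      exact (this.tendsto y).comp hy
    have h2 : Tendsto (fun x : good => tN x - tr x) U (𝓝 (tN z - tr z)) :=
      ((cont_tN.sub cont_tr).tendsto z).comp hz'
    have h3 : (fun x : good => Complex.normSq (tmap x).1.1 * tD x) =
        (fun x : good => tN x - tr x) := by
      funext x; exact tt_norm x x.2
    rw [h3] at h1
    have h4 := tendsto_nhds_unique h1 h2
    rw [h0, mul_zero] at h4
    have h5 := tN_pos z
    rw [tD] at h0
    linarith
  have hz2 : Tendsto (id : good → good) U (𝓝 ⟨z, hzg⟩) := by
    rw [tendsto_subtype_rng]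
    exact hz'
  refine ⟨⟨z, hzg⟩, ?_, hz2⟩
  exact tendsto_nhds_unique ((cont_tmap.tendsto _).comp hz2) hy

/-- The twice punctured torus is the base curve. -/
noncomputable def goodHomeo : good ≃ₜ base :=
  IsHomeomorph.homeomorph tmap (isHomeomorph_iff_continuous_isClosedMap_bijective.2
    ⟨cont_tmap, tmap_proper.isClosedMap, tmap_bij⟩)

lemma good_compl : ∃ b₁ b₂ : Circle × Circle, b₁ ≠ b₂ ∧ good = {b₁, b₂}ᶜ := by
  obtain ⟨u, hu, hu'⟩ := mk_circle 0 1 (by norm_num)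
  obtain ⟨v, hv, hv'⟩ := mk_circle 0 (-1) (by norm_num)
  have huv : u ≠ v := by
    rintro rfl
    rw [hu'] at hv'; norm_num at hv'
  refine ⟨(u, v), (v, u), fun h => huv (congrArg Prod.fst h), ?_⟩
  rw [eq_compl_comm]
  ext z
  simp only [Set.mem_insert_iff, Set.mem_singleton_iff, good, Set.mem_compl_iff, Set.mem_ofPred_eq,
    not_not]
  constructor
  · rintro (rfl | rfl)
    · simp [tD, tN, tr, hu, hu', hv, hv']
    · simp [tD, tN, tr, hu, hu', hv, hv']
  · intro h
    obtain ⟨h1, h2, h3⟩ := tD_zero z h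
    have c1 := circ z.1
    rw [h1] at c1
    have c3 : ((z.1 : ℂ).im - 1) * ((z.1 : ℂ).im + 1) = 0 := by linear_combination c1
    rcases mul_eq_zero.1 c3 with c4 | c4
    · left
      have c5 : (z.1 : ℂ).im = 1 := by linarith
      rw [c5] at h3
      exact Prod.ext (circle_ext (by rw [h1, hu]) (by rw [c5, hu']))
        (circle_ext (by rw [h2, hv]) (by rw [hv']; linarith))
    · right
      have c5 : (z.1 : ℂ).im = -1 := by linarith
      rw [c5] at h3
      exact Prod.ext (circle_ext (by rw [h1, hv]) (by rw [c5, hv']))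
        (circle_ext (by rw [h2, hu]) (by rw [hu']; linarith))



lemma torus_base : ∃ p₁ p₂ : AddCircle (1 : ℝ) × AddCircle (1 : ℝ), p₁ ≠ p₂ ∧
    Nonempty (base ≃ₜ ({p₁, p₂}ᶜ : Set (AddCircle (1 : ℝ) × AddCircle (1 : ℝ)))) := by
  obtain ⟨b₁, b₂, hb, hg⟩ := good_compl
  let h : AddCircle (1 : ℝ) ≃ₜ Circle := AddCircle.homeomorphCircle one_ne_zero
  let H : AddCircle (1 : ℝ) × AddCircle (1 : ℝ) ≃ₜ Circle × Circle := h.prodCongr h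
  refine ⟨H.symm b₁, H.symm b₂, fun e => hb (H.symm.injective e), ⟨goodHomeo.symm.trans ?_⟩⟩
  refine H.symm.subtype ?_
  intro z
  rw [hg]
  simp [H.symm.injective.eq_iff]

lemma curve_base (c : ℂ) (hc₁ : c ≠ -16 / 9) (hc₀ : c ≠ 0) :
    Nonempty ({p : ℂ × ℂ | p.2 ^ 2 = (quart c).eval p.1} ≃ₜ base) := by
  have hq : (quart c).natDegree = 4 := quart_natDegree c hc₁
  have hq0 : quart c ≠ 0 := by
    intro h; rw [h] at hq; simp at hq
  obtain ⟨S, hS, ⟨e₁⟩⟩ := poly_curve (quart c) hq0 (fun a h => quart_simple c hc₀ a h)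
  have hd : (Polynomial.X ^ 4 + 1 : Polynomial ℂ).natDegree = 4 := by compute_degree!
  have hd0 : (Polynomial.X ^ 4 + 1 : Polynomial ℂ) ≠ 0 := by
    intro h; rw [h] at hd; simp at hd
  obtain ⟨D, hD, ⟨e₂⟩⟩ := poly_curve (Polynomial.X ^ 4 + 1) hd0 (by
    intro a h h'
    have h1 : a ^ 4 + 1 = 0 := by simpa using h
    have h2 : a = 0 := by
      rcases (by simpa using h' : (3 + 1 : ℂ) = 0 ∨ a = 0) with h3 | h3
      · norm_num at h3
      · exact h3
    rw [h2] at h1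
    norm_num at h1)
  obtain ⟨e⟩ := curve_card _ S D (by rw [hS, hD, hq, hd]) rfl
  have hb : {p : ℂ × ℂ | p.2 ^ 2 = (Polynomial.X ^ 4 + 1 : Polynomial ℂ).eval p.1} = base := by
    ext p; simp [base]
  exact ⟨(e₁.trans (e.trans e₂.symm)).trans (Homeomorph.setCongr hb)⟩

/-- Removing one more point. -/
lemma remove_point {X Y : Type*} [TopologicalSpace X] [TopologicalSpace Y] {A : Set X} {B : Set Y}
    (e : A ≃ₜ B) (a : X) (ha : a ∈ A) :
    Nonempty (({p | p ∈ A ∧ p ≠ a} : Set X) ≃ₜ ({q | q ∈ B ∧ q ≠ (e ⟨a, ha⟩ : Y)} : Set Y)) := by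
  refine ⟨{
    toFun := fun p => ⟨e ⟨p.1, p.2.1⟩, (e ⟨p.1, p.2.1⟩).2, fun h => p.2.2 ?_⟩
    invFun := fun q => ⟨e.symm ⟨q.1, q.2.1⟩, (e.symm ⟨q.1, q.2.1⟩).2, fun h => q.2.2 ?_⟩
    left_inv := fun p => by simp
    right_inv := fun q => by simp
    continuous_toFun := by fun_prop
    continuous_invFun := by fun_prop }⟩
  · exact congrArg Subtype.val (e.injective (Subtype.ext h))
  · have h1 : e.symm ⟨q.1, q.2.1⟩ = ⟨a, ha⟩ := Subtype.ext h
    have h2 := congrArg e h1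
    rw [e.apply_symm_apply] at h2
    exact congrArg Subtype.val h2

theorem final (c : ℂ) (hc₀ : c ≠ 0)
    (hc₁ : c ≠ -16 / 9) :
    ∃ p₁ p₂ p₃ : AddCircle (1 : ℝ) × AddCircle (1 : ℝ),
      p₁ ≠ p₂ ∧ p₁ ≠ p₃ ∧ p₂ ≠ p₃ ∧
      Nonempty (({p : ℂ × ℂ | briancon p.1 p.2 = c} : Set (ℂ × ℂ)) ≃ₜ
        (({p₁, p₂, p₃}ᶜ : Set (AddCircle (1 : ℝ) × AddCircle (1 : ℝ))) :
          Set (AddCircle (1 : ℝ) × AddCircle (1 : ℝ)))) := by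
  obtain ⟨p₁, p₂, hp, ⟨e₁⟩⟩ := torus_base
  obtain ⟨e₂⟩ := curve_base c hc₁ hc₀
  obtain ⟨e₃⟩ := fiber_homeo c hc₀
  have ha : ((-1, -1 / 3) : ℂ × ℂ) ∈ {p : ℂ × ℂ | p.2 ^ 2 = (quart c).eval p.1} := by
    change (-1 / 3 : ℂ) ^ 2 = (quart c).eval (-1)
    rw [quart_eval]
    ring
  obtain ⟨e₄⟩ := remove_point (e₂.trans e₁) _ ha
  have hm := ((e₂.trans e₁) ⟨_, ha⟩).2
  generalize (((e₂.trans e₁) ⟨_, ha⟩ : _) : AddCircle (1 : ℝ) × AddCircle (1 : ℝ)) = p₃ at e₄ hm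
  simp only [Set.mem_compl_iff, Set.mem_insert_iff, Set.mem_singleton_iff, not_or] at hm
  refine ⟨p₁, p₂, p₃, hp, Ne.symm hm.1, Ne.symm hm.2, ⟨(e₃.trans e₄).trans (Homeomorph.setCongr ?_)⟩⟩
  ext z
  simp only [Set.mem_ofPred_eq, Set.mem_compl_iff, Set.mem_insert_iff, Set.mem_singleton_iff, not_or,
    and_assoc, ne_eq]

end Briancon

/-- Every regular fiber of the Briançon polynomial is a thrice-punctured torus. -/
theorem briancon_regular_fiber_thrice_punctured_torus (c : ℂ) (hc₀ : c ≠ 0)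
    (hc₁ : c ≠ -16 / 9) :
    ∃ p₁ p₂ p₃ : AddCircle (1 : ℝ) × AddCircle (1 : ℝ),
      p₁ ≠ p₂ ∧ p₁ ≠ p₃ ∧ p₂ ≠ p₃ ∧
      Nonempty (({p : ℂ × ℂ | briancon p.1 p.2 = c} : Set (ℂ × ℂ)) ≃ₜ
        (({p₁, p₂, p₃}ᶜ : Set (AddCircle (1 : ℝ) × AddCircle (1 : ℝ))) :
          Set (AddCircle (1 : ℝ) × AddCircle (1 : ℝ)))) := by
  exact Briancon.final c hc₀ hc₁
end
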